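/- Fix an integer n ≥ 2 and a real number p ≥ 2n−1. Assume x₀ ≠ y₀. Then there exists a simple curve α ∈ 𝒞 such that λ_{1,p}(α) = sup{λ_{1,p}(β) : β ∈ 𝒞}. -/

import Mathlib

open Set MeasureTheory Filter Topology

noncomputable section

/-- The closed quarter plane `P`. -/
def Pset : Set (ℝ × ℝ) := {z | 0 ≤ z.1 ∧ 0 ≤ z.2}

/-- The interior `P°` of the quarter plane. -/
def Pint : Set (ℝ × ℝ) := {z | 0 < z.1 ∧ 0 < z.2}

/-- The boundary `∂P` of the quarter plane. -/
def Pbdry : Set (ℝ × ℝ) := {z | (0 ≤ z.1 ∧ 0 ≤ z.2) ∧ (z.1 = 0 ∨ z.2 = 0)}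

/-- `F(x,y) = c_n x^(n-1) y^(n-1)`. -/
def Fvol (n : ℕ) (cn : ℝ) (z : ℝ × ℝ) : ℝ := cn * z.1 ^ (n - 1) * z.2 ^ (n - 1)

/-- Euclidean speed of a curve at `t`, computed with derivatives within `s`. -/
def gSpeedOn (s : Set ℝ) (α : ℝ → ℝ × ℝ) (t : ℝ) : ℝ :=
  Real.sqrt ((derivWithin (fun u => (α u).1) s t) ^ 2 + (derivWithin (fun u => (α u).2) s t) ^ 2)

/-- Euclidean speed of a curve defined on `[0,1]`. -/
def gSpeed (α : ℝ → ℝ × ℝ) : ℝ → ℝ := gSpeedOn (Icc 0 1) α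

/-- Euclidean length `L_g` of a curve on `[0,1]`. -/
def Lg (α : ℝ → ℝ × ℝ) : ℝ := ∫ t in (0:ℝ)..1, gSpeed α t

/-- The `h`-speed `|γ'|_h = F(γ) |γ'|_g`, with derivatives within `s`. -/
def hSpeedOn (n : ℕ) (cn : ℝ) (s : Set ℝ) (α : ℝ → ℝ × ℝ) (t : ℝ) : ℝ :=
  Fvol n cn (α t) * gSpeedOn s α t

/-- The `h`-speed for curves defined on `[0,1)`. -/
def hSpeed (n : ℕ) (cn : ℝ) (α : ℝ → ℝ × ℝ) : ℝ → ℝ := hSpeedOn n cn (Ico 0 1) α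

/-- The `h`-length `L_h` of a curve on `[0,1)`. -/
def Lh (n : ℕ) (cn : ℝ) (α : ℝ → ℝ × ℝ) : ℝ := ∫ t in (0:ℝ)..1, hSpeed n cn α t

/-- Numerator integrand of the `g`-Rayleigh quotient:
`|w'(t)|^p F(α t) |α'(t)|_g^(1-p)`. -/
def numG (n : ℕ) (cn p : ℝ) (s : Set ℝ) (α : ℝ → ℝ × ℝ) (w : ℝ → ℝ) (t : ℝ) : ℝ :=
  |derivWithin w (Icc 0 1) t| ^ p * Fvol n cn (α t) * gSpeedOn s α t ^ (1 - p)

/-- Denominator integrand of the `g`-Rayleigh quotient: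
`|w(t)|^p F(α t) |α'(t)|_g`. -/
def denG (n : ℕ) (cn p : ℝ) (s : Set ℝ) (α : ℝ → ℝ × ℝ) (w : ℝ → ℝ) (t : ℝ) : ℝ :=
  |w t| ^ p * Fvol n cn (α t) * gSpeedOn s α t

/-- First Dirichlet eigenvalue of the `p`-Laplacian along a curve, `g`-form:
infimum of the Rayleigh quotient over Lipschitz test functions on `[0,1]`
vanishing at `0` (with admissible, i.e. integrable with positive denominator,
Rayleigh quotients). -/
def lambdaGOn (n : ℕ) (cn p : ℝ) (s : Set ℝ) (α : ℝ → ℝ × ℝ) : ℝ :=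
  sInf {q | ∃ w : ℝ → ℝ, (∃ K, LipschitzOnWith K w (Icc 0 1)) ∧ w 0 = 0 ∧
    IntervalIntegrable (numG n cn p s α w) volume 0 1 ∧
    IntervalIntegrable (denG n cn p s α w) volume 0 1 ∧
    (0 < ∫ t in (0:ℝ)..1, denG n cn p s α w t) ∧
    q = (∫ t in (0:ℝ)..1, numG n cn p s α w t) / (∫ t in (0:ℝ)..1, denG n cn p s α w t)}

/-- `λ_{1,p}` in the `g`-form for curves on `[0,1]`. -/
def lambdaG (n : ℕ) (cn p : ℝ) (α : ℝ → ℝ × ℝ) : ℝ := lambdaGOn n cn p (Icc 0 1) α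

/-- Numerator integrand of the `h`-Rayleigh quotient on `[c,d]`:
`|w'(t)|^p F(γ t)^p |γ'(t)|_h^(1-p)`. -/
def numH (n : ℕ) (cn p c d : ℝ) (s : Set ℝ) (γ : ℝ → ℝ × ℝ) (w : ℝ → ℝ) (t : ℝ) : ℝ :=
  |derivWithin w (Icc c d) t| ^ p * Fvol n cn (γ t) ^ p * hSpeedOn n cn s γ t ^ (1 - p)

/-- Denominator integrand of the `h`-Rayleigh quotient: `|w(t)|^p |γ'(t)|_h`. -/
def denH (n : ℕ) (cn p : ℝ) (s : Set ℝ) (γ : ℝ → ℝ × ℝ) (w : ℝ → ℝ) (t : ℝ) : ℝ :=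
  |w t| ^ p * hSpeedOn n cn s γ t

/-- `λ_{1,p}` in the `h`-form for a curve on `[c,d)`, with test functions
Lipschitz on `[c,d]` vanishing at `c`. -/
def lambdaHOn (n : ℕ) (cn p c d : ℝ) (s : Set ℝ) (γ : ℝ → ℝ × ℝ) : ℝ :=
  sInf {q | ∃ w : ℝ → ℝ, (∃ K, LipschitzOnWith K w (Icc c d)) ∧ w c = 0 ∧
    IntervalIntegrable (numH n cn p c d s γ w) volume c d ∧
    IntervalIntegrable (denH n cn p s γ w) volume c d ∧
    (0 < ∫ t in c..d, denH n cn p s γ w t) ∧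
    q = (∫ t in c..d, numH n cn p c d s γ w t) / (∫ t in c..d, denH n cn p s γ w t)}

/-- `λ_{1,p}` in the `h`-form for curves on `[0,1)`. -/
def lambdaH (n : ℕ) (cn p : ℝ) (γ : ℝ → ℝ × ℝ) : ℝ :=
  lambdaHOn n cn p 0 1 (Ico 0 1) γ

/-- The class `𝒞` of `C¹` curves from `(x₀,y₀)` to the boundary, with constant
speed, interior image on `[0,1)`, endpoint away from the origin, and meeting the
boundary orthogonally. -/
def MemC (x0 y0 : ℝ) (α : ℝ → ℝ × ℝ) : Prop :=
  ContDiffOn ℝ 1 α (Icc 0 1) ∧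
  α 0 = (x0, y0) ∧
  (∀ t ∈ Ico (0:ℝ) 1, α t ∈ Pint) ∧
  α 1 ∈ Pbdry ∧ α 1 ≠ ((0 : ℝ), (0 : ℝ)) ∧
  (∀ t ∈ Icc (0:ℝ) 1, gSpeed α t = Lg α) ∧
  ((α 1).1 = 0 → derivWithin (fun u => (α u).2) (Icc 0 1) 1 = 0) ∧
  ((α 1).2 = 0 → derivWithin (fun u => (α u).1) (Icc 0 1) 1 = 0)

/-- The Simons cone curve `σ(t) = (1-t)·(R,R)`. -/
def simonsCurve (R : ℝ) : ℝ → ℝ × ℝ := fun t => ((1 - t) * R, (1 - t) * R)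

/-- The class `R_h`: locally Lipschitz curves on `[0,1)` with image in `P°`,
starting at `(x₀,y₀)`, with essentially bounded `h`-speed, reaching the collapsed
boundary point as `t → 1` (i.e. `x(γ t)·y(γ t) → 0`). -/
def MemRh (n : ℕ) (cn x0 y0 : ℝ) (γ : ℝ → ℝ × ℝ) : Prop :=
  γ 0 = (x0, y0) ∧
  (∀ t ∈ Ico (0:ℝ) 1, γ t ∈ Pint) ∧
  (∀ a ∈ Ico (0:ℝ) 1, ∃ K, LipschitzOnWith K γ (Icc 0 a)) ∧
  (∃ M : ℝ, ∀ᵐ t ∂(volume : Measure ℝ), t ∈ Ico (0:ℝ) 1 → hSpeed n cn γ t ≤ M) ∧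
  Tendsto (fun t => (γ t).1 * (γ t).2) (𝓝[<] (1:ℝ)) (𝓝 0)

/-- The class `R_h^+`: continuous curves on `[0,1]` into `P` ending on `∂P`
whose restriction to `[0,1)` belongs to `R_h`. -/
def MemRhPlus (n : ℕ) (cn x0 y0 : ℝ) (α : ℝ → ℝ × ℝ) : Prop :=
  ContinuousOn α (Icc 0 1) ∧ (∀ t ∈ Icc (0:ℝ) 1, α t ∈ Pset) ∧ α 1 ∈ Pbdry ∧
  MemRh n cn x0 y0 α

/-- The class `R_g`: Lipschitz curves on `[0,1]` from `(x₀,y₀)` to `∂P` with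
interior image on `[0,1)`. -/
def MemRg (x0 y0 : ℝ) (α : ℝ → ℝ × ℝ) : Prop :=
  (∃ K, LipschitzOnWith K α (Icc 0 1)) ∧ α 0 = (x0, y0) ∧ α 1 ∈ Pbdry ∧
  ∀ t ∈ Ico (0:ℝ) 1, α t ∈ Pint

/-- The coordinate `u(x,y) = (x² - y²)/2`. -/
def ucoord (z : ℝ × ℝ) : ℝ := (z.1 ^ 2 - z.2 ^ 2) / 2

/-- The coordinate `v(x,y) = xy`. -/
def vcoord (z : ℝ × ℝ) : ℝ := z.1 * z.2

/-- The coordinate `r = √(u² + v²)`. -/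
def rcoord (z : ℝ × ℝ) : ℝ := Real.sqrt (ucoord z ^ 2 + vcoord z ^ 2)

/-- The class `R_g^*`: simple curves in `R_g` with a.e. constant speed,
`u(α(1)) > 0`, and `v(α(t)) ≥ c(1-t)` for some `c > 0`. -/
def MemRgStar (x0 y0 : ℝ) (α : ℝ → ℝ × ℝ) : Prop :=
  MemRg x0 y0 α ∧ InjOn α (Icc 0 1) ∧
  (∀ᵐ t ∂(volume : Measure ℝ), t ∈ Icc (0:ℝ) 1 → gSpeed α t = Lg α) ∧
  0 < ucoord (α 1) ∧
  ∃ c > (0:ℝ), ∀ t ∈ Icc (0:ℝ) 1, c * (1 - t) ≤ vcoord (α t)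

/-- The product of the positive parts of the two coordinates. -/
def quadProd (z : ℂ) : ℝ := max z.re 0 * max z.im 0

/-- The exponent `N / (p - 1)`. -/
def volExp (N : ℕ) (p : ℝ) : ℝ := N / (p - 1)

/-- The largest speed, per unit of Riccati time `μ`, of a path located where the coordinate
product equals `v`. -/
def rate (N : ℕ) (p c v μ : ℝ) : ℝ :=
  v ^ volExp N p / (1 + c * (v ^ N * v ^ volExp N p * max μ 0 ^ p))

lemma quadProd_nonneg (z : ℂ) : 0 ≤ quadProd z := by unfold quadProd; positivity

lemma continuous_quadProd : Continuous quadProd := by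
  unfold quadProd
  fun_prop

lemma quadProd_le_sq_norm (z : ℂ) : quadProd z ≤ ‖z‖ ^ 2 := by
  have h1 : max z.re 0 ≤ ‖z‖ := max_le (Complex.re_le_norm z) (norm_nonneg z)
  have h2 : max z.im 0 ≤ ‖z‖ := max_le (Complex.im_le_norm z) (norm_nonneg z)
  unfold quadProd
  have := le_max_right z.im 0
  nlinarith [norm_nonneg z]

section Rate

variable {N : ℕ} {p c : ℝ}

lemma volExp_pos (hN : 1 ≤ N) (hp : 2 * (N : ℝ) + 1 ≤ p) : 0 < volExp N p := by
  have : (1 : ℝ) ≤ N := by exact_mod_cast hN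
  exact div_pos (by linarith) (by linarith)

lemma volExp_le_half (hN : 1 ≤ N) (hp : 2 * (N : ℝ) + 1 ≤ p) : volExp N p ≤ 1 / 2 := by
  have : (1 : ℝ) ≤ N := by exact_mod_cast hN
  unfold volExp
  rw [div_le_div_iff₀ (by linarith) (by norm_num)]
  linarith

lemma three_le_of_exponent (hN : 1 ≤ N) (hp : 2 * (N : ℝ) + 1 ≤ p) : 3 ≤ p := by
  have : (1 : ℝ) ≤ N := by exact_mod_cast hN
  linarith

lemma volExp_mul (hN : 1 ≤ N) (hp : 2 * (N : ℝ) + 1 ≤ p) : volExp N p * (p - 1) = N := by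
  have := three_le_of_exponent hN hp
  unfold volExp
  rw [div_mul_cancel₀ _ (by linarith)]

lemma rate_denom_pos (hc : 0 ≤ c) {v : ℝ} (hv : 0 ≤ v) (μ : ℝ) :
    0 < 1 + c * (v ^ N * v ^ volExp N p * max μ 0 ^ p) := by
  have : 0 ≤ max μ 0 := le_max_right _ _
  positivity

lemma rate_nonneg (hc : 0 ≤ c) {v : ℝ} (hv : 0 ≤ v) (μ : ℝ) : 0 ≤ rate N p c v μ :=
  div_nonneg (Real.rpow_nonneg hv _) (rate_denom_pos hc hv μ).le

lemma rate_pos (hc : 0 ≤ c) {v : ℝ} (hv : 0 < v) (μ : ℝ) : 0 < rate N p c v μ :=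
  div_pos (Real.rpow_pos_of_pos hv _) (rate_denom_pos hc hv.le μ)

lemma rate_of_nonpos (hN : 1 ≤ N) (hp : 2 * (N : ℝ) + 1 ≤ p) {μ : ℝ} (hμ : μ ≤ 0) (v : ℝ) :
    rate N p c v μ = v ^ volExp N p := by
  have := three_le_of_exponent hN hp
  simp [rate, max_eq_right hμ, Real.zero_rpow (by linarith : p ≠ 0)]

lemma rate_le_rpow (hc : 0 ≤ c) {v : ℝ} (hv : 0 ≤ v) (μ : ℝ) :
    rate N p c v μ ≤ v ^ volExp N p := by
  have : 0 ≤ max μ 0 := le_max_right _ _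
  have h : 0 ≤ c * (v ^ N * v ^ volExp N p * max μ 0 ^ p) := by positivity
  exact div_le_self (Real.rpow_nonneg hv _) (by linarith)

lemma rpow_volExp_le (hN : 1 ≤ N) (hp : 2 * (N : ℝ) + 1 ≤ p) (z : ℂ) :
    quadProd z ^ volExp N p ≤ 1 + ‖z‖ := by
  rcases le_total (quadProd z) 1 with h | h
  · have := Real.rpow_le_one (quadProd_nonneg z) h (volExp_pos hN hp).le
    linarith [norm_nonneg z]
  · calc quadProd z ^ volExp N p ≤ quadProd z ^ (1 / 2 : ℝ) :=
          Real.rpow_le_rpow_of_exponent_le h (volExp_le_half hN hp)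
      _ = √(quadProd z) := (Real.sqrt_eq_rpow _).symm
      _ ≤ √(‖z‖ ^ 2) := Real.sqrt_le_sqrt (quadProd_le_sq_norm z)
      _ = ‖z‖ := Real.sqrt_sq (norm_nonneg z)
      _ ≤ _ := by linarith

lemma continuous_rate (hN : 1 ≤ N) (hp : 2 * (N : ℝ) + 1 ≤ p) (hc : 0 ≤ c)
    {X : Type*} [TopologicalSpace X] {f g : X → ℝ} (hf : Continuous f) (hg : Continuous g)
    (hf0 : ∀ x, 0 ≤ f x) : Continuous fun x => rate N p c (f x) (g x) := by
  have h1 : Continuous fun x => f x ^ volExp N p :=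
    hf.rpow_const fun x => Or.inr (volExp_pos hN hp).le
  have h2 : Continuous fun x => max (g x) 0 ^ p :=
    (hg.max continuous_const).rpow_const fun x =>
      Or.inr (by linarith [three_le_of_exponent hN hp])
  unfold rate
  refine h1.div ?_ fun x => (rate_denom_pos hc (hf0 x) (g x)).ne'
  fun_prop

lemma rate_anti (hN : 1 ≤ N) (hp : 2 * (N : ℝ) + 1 ≤ p) {c' : ℝ} (hc : 0 ≤ c) (hcc : c ≤ c')
    {v : ℝ} (hv : 0 ≤ v) {μ μ' : ℝ} (hμ : μ ≤ μ') : rate N p c' v μ' ≤ rate N p c v μ := by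
  have := three_le_of_exponent hN hp
  have h0 : 0 ≤ max μ 0 := le_max_right _ _
  have h1 : max μ 0 ^ p ≤ max μ' 0 ^ p := by gcongr
  unfold rate
  have := rate_denom_pos (N := N) (p := p) hc hv μ
  have hc' := hc.trans hcc
  gcongr

lemma rate_le_inv (hc : 0 < c) {v μ : ℝ} (hv : 0 < v) (hμ : 0 < μ) :
    rate N p c v μ ≤ (c * v ^ N * μ ^ p)⁻¹ := by
  unfold rate
  rw [max_eq_left hμ.le]
  have h1 : 0 < v ^ volExp N p := Real.rpow_pos_of_pos hv _
  have h2 : 0 < μ ^ p := Real.rpow_pos_of_pos hμ _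
  rw [← one_div, div_le_div_iff₀ (by positivity) (by positivity)]
  nlinarith

lemma inv_rate (hc : 0 ≤ c) {v μ : ℝ} (hv : 0 < v) (hμ : 0 ≤ μ) :
    (rate N p c v μ)⁻¹ = (v ^ volExp N p)⁻¹ + c * v ^ N * μ ^ p := by
  unfold rate
  rw [max_eq_left hμ]
  have h1 : 0 < v ^ volExp N p := Real.rpow_pos_of_pos hv _
  field_simp

end Rate

/-- Continuous paths respecting the speed limit `rate`. -/
structure IsSlow (N : ℕ) (p c : ℝ) (γ : ℝ → ℂ) : Prop where
  cont : Continuous γ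
  le : ∀ s t κ : ℝ, s ≤ t → (∀ ν ∈ Icc s t, rate N p c (quadProd (γ ν)) ν ≤ κ) →
    ‖γ t - γ s‖ ≤ κ * (t - s)

namespace IsSlow

variable {N : ℕ} {p c : ℝ} {γ : ℝ → ℂ}

lemma slope_bound (hγ : IsSlow N p c γ) (hN : 1 ≤ N) (hp : 2 * (N : ℝ) + 1 ≤ p) (hc : 0 ≤ c)
    {h : ℝ → ℝ} {h' x s t : ℝ} (hx : x ∈ Ico s t) (hmono : MonotoneOn h (Icc s t))
    (hd : HasDerivWithinAt h h' (Ici x) x) {r : ℝ}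
    (hr : rate N p c (quadProd (γ (h x))) (h x) * h' < r) :
    ∀ᶠ z in 𝓝[>] x, ‖γ (h z) - γ (h x)‖ ≤ r * (z - x) := by
  have hd' : Tendsto (slope h x) (𝓝[>] x) (𝓝 h') := by
    have := hasDerivWithinAt_iff_tendsto_slope.1 hd
    simpa using this
  have hh : Tendsto h (𝓝[>] x) (𝓝 (h x)) :=
    hd.continuousWithinAt.tendsto.mono_left (nhdsWithin_mono _ Ioi_subset_Ici_self)
  have hcr : Continuous fun ν => rate N p c (quadProd (γ ν)) ν :=
    continuous_rate hN hp hc (continuous_quadProd.comp hγ.cont) continuous_id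
      fun _ => quadProd_nonneg _
  set ρ := rate N p c (quadProd (γ (h x))) (h x) with hρ
  obtain ⟨κ, hκ1, hκ2⟩ : ∃ κ, ρ < κ ∧ κ * h' < r := by
    have : Tendsto (fun κ : ℝ => κ * h') (𝓝[>] ρ) (𝓝 (ρ * h')) :=
      ((continuous_id.mul continuous_const).tendsto ρ).mono_left nhdsWithin_le_nhds
    obtain ⟨κ, h1, h2⟩ := ((this.eventually_lt_const hr).and self_mem_nhdsWithin).exists
    exact ⟨κ, h2, h1⟩
  have e1 : ∀ᶠ z in 𝓝[>] x, κ * slope h x z < r := (hd'.const_mul κ).eventually_lt_const hκ2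
  have e2 : ∀ᶠ ν in 𝓝 (h x), rate N p c (quadProd (γ ν)) ν < κ :=
    hcr.tendsto (h x) |>.eventually_lt_const hκ1
  obtain ⟨δ, hδ, hball⟩ := Metric.eventually_nhds_iff.1 e2
  have e3 : ∀ᶠ z in 𝓝[>] x, dist (h z) (h x) < δ := hh.eventually (Metric.ball_mem_nhds _ hδ)
  have e4 : ∀ᶠ z in 𝓝[>] x, z ∈ Ioo x t := Ioo_mem_nhdsGT hx.2
  filter_upwards [e1, e3, e4] with z h1 h3 h4
  have hle : h x ≤ h z := hmono ⟨hx.1, hx.2.le⟩ ⟨hx.1.trans h4.1.le, h4.2.le⟩ h4.1.le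
  have := hγ.le (h x) (h z) κ hle fun ν hν => (hball (by
    rw [Real.dist_eq, abs_of_nonneg (by linarith [hν.1])]
    rw [Real.dist_eq, abs_of_nonneg (by linarith)] at h3
    linarith [hν.2])).le
  have hpos : 0 < z - x := sub_pos.2 h4.1
  rw [slope_def_field, mul_div_assoc', div_lt_iff₀ hpos] at h1
  linarith

lemma norm_sub_comp_le (hγ : IsSlow N p c γ) (hN : 1 ≤ N) (hp : 2 * (N : ℝ) + 1 ≤ p)
    (hc : 0 ≤ c) {h h' B B' : ℝ → ℝ} {s t : ℝ} (hst : s ≤ t) (hmono : MonotoneOn h (Icc s t))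
    (hcont : ContinuousOn h (Icc s t))
    (hd : ∀ x ∈ Ico s t, HasDerivWithinAt h (h' x) (Ici x) x)
    (hB : ContinuousOn B (Icc s t)) (hB' : ∀ x ∈ Ico s t, HasDerivWithinAt B (B' x) (Ici x) x)
    (hle : ∀ x ∈ Ico s t, rate N p c (quadProd (γ (h x))) (h x) * h' x ≤ B' x) :
    ‖γ (h t) - γ (h s)‖ ≤ B t - B s := by
  have key := image_le_of_liminf_slope_right_le_deriv_boundary
    (f := fun x => ‖γ (h x) - γ (h s)‖) (a := s) (b := t) (B := fun x => B x - B s) (B' := B')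
    ((hγ.cont.comp_continuousOn hcont).sub continuousOn_const).norm (by simp)
    (hB.sub continuousOn_const) (fun x hx => (hB' x hx).sub_const _)
    (fun x hx r hr => by
      refine Eventually.frequently ?_
      obtain ⟨r', hr1, hr2⟩ := exists_between hr
      filter_upwards [slope_bound hγ hN hp hc hx hmono (hd x hx) ((hle x hx).trans_lt hr1),
        self_mem_nhdsWithin] with z hz hz'
      have hpos : 0 < z - x := sub_pos.2 hz'
      rw [slope_def_field, div_lt_iff₀ hpos]
      have := norm_sub_le_norm_sub_add_norm_sub (γ (h z)) (γ (h x)) (γ (h s))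
      nlinarith)
  exact key ⟨hst, le_rfl⟩

lemma norm_sub_le (hγ : IsSlow N p c γ) (hN : 1 ≤ N) (hp : 2 * (N : ℝ) + 1 ≤ p)
    (hc : 0 ≤ c) {B B' : ℝ → ℝ} {s t : ℝ} (hst : s ≤ t)
    (hB : ContinuousOn B (Icc s t)) (hB' : ∀ x ∈ Ico s t, HasDerivWithinAt B (B' x) (Ici x) x)
    (hle : ∀ x ∈ Ico s t, rate N p c (quadProd (γ x)) x ≤ B' x) :
    ‖γ t - γ s‖ ≤ B t - B s :=
  norm_sub_comp_le (h := id) (h' := fun _ => 1) hγ hN hp hc hst (monotone_id.monotoneOn _)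
    continuousOn_id (fun x _ => hasDerivWithinAt_id x _) hB hB' (by simpa using hle)

lemma norm_le_exp (hγ : IsSlow N p c γ) (hN : 1 ≤ N) (hp : 2 * (N : ℝ) + 1 ≤ p)
    (hc : 0 ≤ c) {t : ℝ} (ht : 0 ≤ t) : ‖γ t‖ ≤ (‖γ 0‖ + 1) * Real.exp (3 * t) := by
  have key := image_le_of_liminf_slope_right_lt_deriv_boundary
    (f := fun x => ‖γ x‖) (f' := fun x => 1 + ‖γ x‖) (a := 0) (b := t)
    (B := fun x => (‖γ 0‖ + 1) * Real.exp (3 * x))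
    (B' := fun x => (‖γ 0‖ + 1) * (Real.exp (3 * x) * (3 * 1)))
    hγ.cont.norm.continuousOn
    (fun x hx r hr => by
      refine Eventually.frequently ?_
      obtain ⟨r', hr1, hr2⟩ := exists_between hr
      filter_upwards [slope_bound (h := id) (h' := 1) hγ hN hp hc hx (monotone_id.monotoneOn _)
        (hasDerivWithinAt_id x _) (by
          rw [mul_one]
          exact ((rate_le_rpow hc (quadProd_nonneg _) _).trans
            (rpow_volExp_le hN hp _)).trans_lt hr1), self_mem_nhdsWithin] with z hz hz'
      have hpos : 0 < z - x := sub_pos.2 hz'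
      simp only [id] at hz
      rw [slope_def_field, div_lt_iff₀ hpos]
      have := norm_sub_norm_le (γ z) (γ x)
      nlinarith)
    (by simp)
    (fun x => (((hasDerivAt_id x).const_mul 3).exp).const_mul _)
    (fun x hx hfx => by
      have h1 : 1 ≤ Real.exp (3 * x) := Real.one_le_exp (by linarith [hx.1])
      rw [hfx]
      nlinarith [norm_nonneg (γ 0), mul_nonneg (norm_nonneg (γ 0)) (Real.exp_pos (3 * x)).le])
  exact key ⟨ht, le_rfl⟩

lemma const (hc : 0 ≤ c) (z : ℂ) : IsSlow N p c fun _ => z where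
  cont := continuous_const
  le s t κ hst h := by
    have h1 := h s ⟨le_rfl, hst⟩
    have h2 : 0 ≤ κ := (rate_nonneg hc (quadProd_nonneg _) _).trans h1
    simpa using mul_nonneg h2 (sub_nonneg.2 hst)

lemma glue {γ₁ γ₂ : ℝ → ℂ} (h₁ : IsSlow N p c γ₁) (h₂ : IsSlow N p c γ₂) {m : ℝ}
    (hm : γ₁ m = γ₂ m) : IsSlow N p c fun t => if t ≤ m then γ₁ t else γ₂ t where
  cont := h₁.cont.if_le h₂.cont continuous_id continuous_const (by rintro x rfl; exact hm)
  le s t κ hst h := by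
    by_cases ht : t ≤ m
    · rw [if_pos ht, if_pos (hst.trans ht)]
      refine h₁.le s t κ hst fun ν hν => ?_
      simpa [if_pos (hν.2.trans ht)] using h ν hν
    by_cases hs : s ≤ m
    · rw [if_neg ht, if_pos hs]
      push Not at ht
      have e1 := h₁.le s m κ hs fun ν hν => by
        simpa [if_pos hν.2] using h ν ⟨hν.1, hν.2.trans ht.le⟩
      have e2 := h₂.le m t κ ht.le fun ν hν => by
        rcases eq_or_lt_of_le hν.1 with rfl | hlt
        · simpa [hm] using h m ⟨hs, ht.le⟩
        · simpa [if_neg (not_le.2 hlt)] using h ν ⟨hs.trans hν.1, hν.2⟩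
      calc ‖γ₂ t - γ₁ s‖ ≤ ‖γ₂ t - γ₂ m‖ + ‖γ₂ m - γ₁ s‖ :=
            norm_sub_le_norm_sub_add_norm_sub _ _ _
        _ ≤ κ * (t - m) + κ * (m - s) := by rw [← hm] at *; exact add_le_add e2 e1
        _ = _ := by ring
    · rw [if_neg ht, if_neg hs]
      refine h₂.le s t κ hst fun ν hν => ?_
      push Not at hs
      simpa [if_neg (not_le.2 (hs.trans_le hν.1))] using h ν hν

lemma shift (hγ : IsSlow N p c γ) (hN : 1 ≤ N) (hp : 2 * (N : ℝ) + 1 ≤ p) (hc : 0 ≤ c)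
    {d : ℝ} (hd : 0 ≤ d) : IsSlow N p c fun t => γ (t + d) where
  cont := hγ.cont.comp (continuous_id.add continuous_const)
  le s t κ hst h := by
    have := hγ.le (s + d) (t + d) κ (by linarith) fun ν hν => by
      have h1 := h (ν - d) ⟨by linarith [hν.1], by linarith [hν.2]⟩
      simp only [sub_add_cancel] at h1
      exact (rate_anti hN hp hc le_rfl (quadProd_nonneg _) (by linarith)).trans h1
    simpa using this

lemma comp_lipschitz (hγ : IsSlow N p c γ) {Φ : ℂ → ℂ} (hΦ : LipschitzWith 1 Φ)
    (hV : ∀ z, quadProd (Φ z) = quadProd z) : IsSlow N p c fun t => Φ (γ t) where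
  cont := hΦ.continuous.comp hγ.cont
  le s t κ hst h := by
    simp only [hV] at h
    have := hΦ.dist_le_mul (γ t) (γ s)
    simp only [NNReal.coe_one, one_mul, dist_eq_norm] at this
    exact this.trans (hγ.le s t κ hst h)

lemma anti (hγ : IsSlow N p c γ) (hN : 1 ≤ N) (hp : 2 * (N : ℝ) + 1 ≤ p) {c' : ℝ}
    (hc : 0 ≤ c') (hcc : c' ≤ c) : IsSlow N p c' γ where
  cont := hγ.cont
  le s t κ hst h := hγ.le s t κ hst fun ν hν =>
    (rate_anti hN hp hc hcc (quadProd_nonneg _) le_rfl).trans (h ν hν)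

end IsSlow

section Reparam

variable {N : ℕ} {p c : ℝ}

/-- A curve satisfying the speed limit with respect to a clock `M` yields a slow path. -/
lemma exists_isSlow_of_clock (hc : 0 ≤ c) {β β' : ℝ → ℂ} {M M' : ℝ → ℝ}
    (hβ : ContinuousOn β (Icc 0 1)) (hβ' : ∀ t ∈ Ico (0:ℝ) 1, HasDerivWithinAt β (β' t) (Ici t) t)
    (hM : ContinuousOn M (Icc 0 1)) (hMm : StrictMonoOn M (Icc 0 1))
    (hM' : ∀ t ∈ Ico (0:ℝ) 1, HasDerivWithinAt M (M' t) (Ici t) t)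
    (hM0 : ∀ t ∈ Ico (0:ℝ) 1, 0 ≤ M' t)
    (hle : ∀ t ∈ Ico (0:ℝ) 1, ‖β' t‖ ≤ rate N p c (quadProd (β t)) (M t) * M' t) :
    ∃ γ, IsSlow N p c γ ∧ (∀ μ ≤ M 0, γ μ = β 0) ∧ γ (M 1) = β 1 := by
  let cl : ℝ → ℝ := fun t => max 0 (min t 1)
  have hcl : ∀ t, cl t ∈ Icc (0:ℝ) 1 := fun t =>
    ⟨le_max_left _ _, max_le zero_le_one (min_le_right _ _)⟩
  have hclc : Continuous cl := by fun_prop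
  have hclm : Monotone cl := fun s t h => max_le_max le_rfl (min_le_min h le_rfl)
  have hcld : ∀ s t, s ≤ t → cl t - cl s ≤ t - s := by
    intro s t h
    simp only [cl]
    rcases le_total s 1 with h1 | h1 <;> rcases le_total t 1 with h2 | h2 <;>
      simp only [min_eq_left, min_eq_right, h1, h2] <;>
      rcases le_total 0 s with h3 | h3 <;> rcases le_total 0 t with h4 | h4 <;>
      simp only [max_eq_left, max_eq_right, h3, h4, zero_le_one] <;> linarith
  have hcl_of : ∀ t ∈ Icc (0:ℝ) 1, cl t = t := fun t ht => by
    simp [cl, min_eq_left ht.2, max_eq_right ht.1]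
  let Mt : ℝ → ℝ := fun t => M (cl t) + (t - cl t)
  have hMtc : Continuous Mt :=
    (hM.comp_continuous hclc hcl).add (continuous_id.sub hclc)
  have hMtm : StrictMono Mt := by
    intro s t h
    rcases (hclm h.le).eq_or_lt with h1 | h1
    · simp only [Mt, h1]; linarith
    · have := hMm (hcl s) (hcl t) h1
      have := hcld s t h.le
      simp only [Mt]; linarith
  have htop : Tendsto Mt atTop atTop := by
    refine tendsto_atTop_mono' atTop (f₁ := fun t => t + (M 1 - 1)) ?_
      (tendsto_atTop_add_const_right _ _ tendsto_id)
    filter_upwards [eventually_ge_atTop 1] with t ht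
    simp [Mt, cl, min_eq_right ht]; linarith
  have hbot : Tendsto Mt atBot atBot := by
    refine tendsto_atBot_mono' atBot (f₂ := Mt) (f₁ := fun t => t + M 0) ?_
      (tendsto_atBot_add_const_right _ _ tendsto_id)
    filter_upwards [eventually_le_atBot 0] with t ht
    simp [Mt, cl, min_eq_left (ht.trans zero_le_one), max_eq_left ht]; linarith
  let e : ℝ ≃o ℝ := hMtm.orderIsoOfSurjective Mt (hMtc.surjective htop hbot)
  have he : ∀ t, e t = Mt t := fun t => rfl
  have hes : ∀ μ, Mt (e.symm μ) = μ := fun μ => by rw [← he, e.apply_symm_apply]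
  have hse : ∀ t, e.symm (Mt t) = t := fun t => by rw [← he, e.symm_apply_apply]
  have hMt_of : ∀ t ∈ Icc (0:ℝ) 1, Mt t = M t := fun t ht => by simp [Mt, hcl_of t ht]
  refine ⟨fun μ => β (cl (e.symm μ)), ⟨?_, ?_⟩, ?_, ?_⟩
  · exact hβ.comp_continuous (hclc.comp e.symm.continuous) fun _ => hcl _
  · intro s t κ hst hκ
    have hκ0 : 0 ≤ κ := (rate_nonneg hc (quadProd_nonneg _) _).trans (hκ s ⟨le_rfl, hst⟩)
    have hστ : e.symm s ≤ e.symm t := e.symm.monotone hst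
    set σ := e.symm s with hσ
    set τ := e.symm t with hτ
    have hab := hclm hστ
    have hsub : Icc (cl σ) (cl τ) ⊆ Icc 0 1 := Icc_subset_Icc (hcl σ).1 (hcl τ).2
    have key := image_norm_le_of_norm_deriv_right_le_deriv_boundary' (a := cl σ) (b := cl τ)
      (f := fun x => β x - β (cl σ)) (f' := β')
      (B := fun x => κ * (M x - M (cl σ))) (B' := fun x => κ * M' x)
      ((hβ.mono hsub).sub continuousOn_const)
      (fun x hx => (hβ' x ⟨(hcl σ).1.trans hx.1, hx.2.trans_le (hcl τ).2⟩).sub_const _)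
      (by simp) (((hM.mono hsub).sub continuousOn_const).const_smul κ)
      (fun x hx => ((hM' x ⟨(hcl σ).1.trans hx.1, hx.2.trans_le (hcl τ).2⟩).sub_const _).const_mul
        κ)
      (fun x hx => by
        have hx01 : x ∈ Ico (0:ℝ) 1 := ⟨(hcl σ).1.trans hx.1, hx.2.trans_le (hcl τ).2⟩
        have hxσ : σ ≤ x := by
          refine le_trans ?_ hx.1
          by_contra hlt
          push Not at hlt
          have h1 : 1 ≤ cl σ := by
            simp only [cl] at hlt ⊢
            rcases le_total σ 1 with h | h
            · rw [min_eq_left h] at hlt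
              exact absurd (le_max_right 0 σ) (not_le.2 hlt)
            · rw [min_eq_right h]; simp
          linarith [hx.1, hx01.2]
        have hxτ : x ≤ τ := by
          refine hx.2.le.trans ?_
          by_contra hlt
          push Not at hlt
          have h1 : cl τ ≤ 0 := by
            simp only [cl] at hlt ⊢
            rcases le_total 0 τ with h | h
            · exact absurd (max_le h (min_le_left τ 1)) (not_le.2 hlt)
            · exact max_le le_rfl ((min_le_left _ _).trans h)
          linarith [hx.2, hx01.1]
        refine (hle x hx01).trans ?_
        refine mul_le_mul_of_nonneg_right ?_ (hM0 x hx01)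
        have h1 := hκ (Mt x) ⟨by rw [← hes s]; exact hMtm.monotone hxσ,
          by rw [← hes t]; exact hMtm.monotone hxτ⟩
        rw [hse, hcl_of x (Ico_subset_Icc_self hx01),
          hMt_of x (Ico_subset_Icc_self hx01)] at h1
        exact h1)
    refine (key ⟨hab, le_rfl⟩).trans ?_
    have h1 : Mt τ = t := hes t
    have h2 : Mt σ = s := hes s
    have h3 := hcld σ τ hστ
    simp only [Mt] at h1 h2
    exact mul_le_mul_of_nonneg_left (by linarith) hκ0
  · intro μ hμ
    have : e.symm μ ≤ 0 := by
      rw [← hse 0]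
      exact e.symm.monotone (by rw [hMt_of 0 (by simp)]; exact hμ)
    simp [cl, min_eq_left (this.trans zero_le_one), max_eq_left this]
  · have : e.symm (M 1) = 1 := by rw [← hMt_of 1 (by simp), hse]
    simp [this, cl]

lemma exists_isSlow_segment (hc : 0 ≤ c) {z w : ℂ} {s τ κ : ℝ} (hτ : 0 < τ)
    (hκ : ∀ θ ∈ Icc (0:ℝ) 1, ∀ ν ∈ Icc s (s + τ),
      κ ≤ rate N p c (quadProd (z + θ * (w - z))) ν)
    (hzw : ‖w - z‖ ≤ κ * τ) :
    ∃ γ, IsSlow N p c γ ∧ (∀ μ ≤ s, γ μ = z) ∧ γ (s + τ) = w := by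
  have := exists_isSlow_of_clock (N := N) (p := p) hc
    (β := fun t : ℝ => z + t * (w - z)) (β' := fun _ => w - z)
    (M := fun t => s + t * τ) (M' := fun _ => τ) (by fun_prop)
    (fun t _ => by
      have h := ((Complex.ofRealCLM.hasDerivAt (x := t)).mul_const (w - z)).const_add z
      simpa using h.hasDerivWithinAt)
    (by fun_prop) (fun x _ y _ h => by
      have := mul_lt_mul_of_pos_right h hτ
      simpa using this)
    (fun t _ => by
      have h := ((hasDerivAt_id t).mul_const τ).const_add s
      simpa using h.hasDerivWithinAt)
    (fun _ _ => hτ.le)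
    (fun t ht => hzw.trans (mul_le_mul_of_nonneg_right (hκ t (Ico_subset_Icc_self ht) _
      ⟨by nlinarith [ht.1], by nlinarith [ht.2]⟩) hτ.le))
  simpa using this

/-- Descent along the vertical segment from `x + y₁ i` to `x`. -/
lemma exists_isSlow_descent (hN : 1 ≤ N) (hp : 2 * (N : ℝ) + 1 ≤ p) (hc : 0 ≤ c)
    {x y₁ A ε : ℝ} (hx : 0 < x) (hy₁ : 0 < y₁) (hA : 0 ≤ A) (hε : 0 < ε)
    (hcond : ∀ y ∈ Ioc 0 y₁,
      (p - 1) * (x ^ volExp N p)⁻¹ *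
        (A * y ^ (N + 1) + ε * (1 + y ^ (1 - volExp N p))) ^ (1 + 1 / (p - 1)) ≤
      ((N + 1) * A - c * (p - 1) * x ^ N) * (y ^ N * y ^ volExp N p) + ε * (1 - volExp N p)) :
    ∃ γ T, IsSlow N p c γ ∧
      (∀ μ ≤ (A * y₁ ^ (N + 1) + ε * (1 + y₁ ^ (1 - volExp N p))) ^ (-(1 / (p - 1))),
        γ μ = ⟨x, y₁⟩) ∧ γ T = ⟨x, 0⟩ := by
  have hp3 := three_le_of_exponent hN hp
  have ha := volExp_pos hN hp
  have ha2 := volExp_le_half hN hp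
  set a := volExp N p with hadef
  set b := 1 / (p - 1) with hb
  have hb0 : 0 < b := by rw [hb]; exact one_div_pos.2 (by linarith)
  have hbp : b * p = 1 + b := by rw [hb]; field_simp [show p - 1 ≠ 0 by linarith]; ring
  let q : ℝ → ℝ := fun y => A * y ^ (N + 1) + ε * (1 + y ^ (1 - a))
  let q' : ℝ → ℝ := fun y => A * ((N + 1) * y ^ N) + ε * ((1 - a) * y ^ (-a))
  have hq0 : ∀ y, 0 ≤ y → 0 < q y := fun y hy => by
    have := Real.rpow_nonneg hy (1 - a)
    have : 0 < ε * (1 + y ^ (1 - a)) := by positivity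
    have : 0 ≤ A * y ^ (N + 1) := by positivity
    simp only [q]; linarith
  have hqm : StrictMonoOn q (Ici 0) := by
    intro y hy z hz hyz
    have h1 : y ^ (1 - a) < z ^ (1 - a) := Real.rpow_lt_rpow hy hyz (by linarith)
    have h2 : y ^ (N + 1) ≤ z ^ (N + 1) := pow_le_pow_left₀ hy hyz.le _
    have h3 := mul_le_mul_of_nonneg_left h2 hA
    have h4 := mul_lt_mul_of_pos_left h1 hε
    simp only [q]; linarith
  have hqc : Continuous q := by
    have : Continuous fun y : ℝ => y ^ (1 - a) :=
      Real.continuous_rpow_const (by linarith)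
    simp only [q]; fun_prop
  have hqd : ∀ y, 0 < y → HasDerivAt q (q' y) y := fun y hy => by
    have h1 := Real.hasDerivAt_rpow_const (x := y) (p := 1 - a) (Or.inl hy.ne')
    have h2 := ((hasDerivAt_pow (N + 1) y).const_mul A).add ((h1.const_add 1).const_mul ε)
    convert! h2 using 1
    simp [q']
  have hy : ∀ t ∈ Icc (0:ℝ) 1, 0 ≤ y₁ * (1 - t) := fun t ht =>
    mul_nonneg hy₁.le (by linarith [ht.2])
  have hyd : ∀ t : ℝ, HasDerivAt (fun t => y₁ * (1 - t)) (-y₁) t := fun t => by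
    simpa using ((hasDerivAt_id t).const_sub 1).const_mul y₁
  obtain ⟨γ, h1, h2, h3⟩ := exists_isSlow_of_clock (N := N) (p := p) hc
    (β := fun t : ℝ => ⟨x, y₁ * (1 - t)⟩) (β' := fun _ => ⟨0, -y₁⟩)
    (M := fun t => q (y₁ * (1 - t)) ^ (-b))
    (M' := fun t => (q' (y₁ * (1 - t)) * -y₁) * -b * q (y₁ * (1 - t)) ^ (-b - 1))
    (by
      refine Continuous.continuousOn ?_
      have : (fun t : ℝ => (⟨x, y₁ * (1 - t)⟩ : ℂ)) =
          fun t : ℝ => (x : ℂ) + (y₁ * (1 - t) : ℝ) * Complex.I := by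
        ext t; apply Complex.ext <;> simp
      rw [this]; fun_prop)
    (fun t _ => by
      have : (fun t : ℝ => (⟨x, y₁ * (1 - t)⟩ : ℂ)) =
          fun t : ℝ => (x : ℂ) + (y₁ * (1 - t) : ℝ) * Complex.I := by
        ext t; apply Complex.ext <;> simp
      rw [this]
      have h := (((hyd t).ofReal_comp).mul_const Complex.I).const_add (x : ℂ)
      convert! h.hasDerivWithinAt using 1
      apply Complex.ext <;> simp)
    (by
      refine ContinuousOn.rpow_const (by fun_prop) fun t ht => Or.inl (hq0 _ (hy t ht)).ne')
    (fun s hs t ht hst => by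
      refine Real.rpow_lt_rpow_of_neg (hq0 _ (hy t ht)) (hqm (hy t ht) (hy s hs) ?_)
        (by linarith)
      exact mul_lt_mul_of_pos_left (by linarith) hy₁)
    (fun t ht => by
      have hpos : 0 < y₁ * (1 - t) := mul_pos hy₁ (by linarith [ht.2])
      have h : HasDerivAt (fun t => q (y₁ * (1 - t))) (q' (y₁ * (1 - t)) * -y₁) t :=
        HasDerivAt.comp (h₂ := q) (h := fun t => y₁ * (1 - t)) t (hqd _ hpos) (hyd t)
      exact (h.rpow_const (Or.inl (hq0 _ hpos.le).ne')).hasDerivWithinAt)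
    (fun t ht => by
      have hpos : 0 < y₁ * (1 - t) := mul_pos hy₁ (by linarith [ht.2])
      have h1 := Real.rpow_pos_of_pos (hq0 _ hpos.le) (-b - 1)
      have h2 := Real.rpow_pos_of_pos hpos (-a)
      have h3 : 0 ≤ q' (y₁ * (1 - t)) := by
        have : 0 ≤ 1 - a := by linarith
        simp only [q']; positivity
      have : q' (y₁ * (1 - t)) * -y₁ * -b * q (y₁ * (1 - t)) ^ (-b - 1) =
        q' (y₁ * (1 - t)) * y₁ * b * q (y₁ * (1 - t)) ^ (-b - 1) := by ring
      rw [this]; positivity)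
    (fun t ht => by
      have hpos : 0 < y₁ * (1 - t) := mul_pos hy₁ (by linarith [ht.2])
      set y := y₁ * (1 - t) with hydef
      have hqp := hq0 y hpos.le
      have hV : quadProd ⟨x, y⟩ = x * y := by
        simp [quadProd, max_eq_left hx.le, max_eq_left hpos.le]
      have hn : ‖(⟨0, -y₁⟩ : ℂ)‖ = y₁ := by
        have : (⟨0, -y₁⟩ : ℂ) = ((-y₁ : ℝ) : ℂ) * Complex.I := by apply Complex.ext <;> simp
        rw [this, norm_mul, Complex.norm_I, Complex.norm_real, mul_one, norm_neg,
          Real.norm_of_nonneg hy₁.le]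
      have hVp : 0 < x * y := mul_pos hx hpos
      have hr := rate_pos (N := N) (p := p) hc hVp (q y ^ (-b))
      have hinv := inv_rate (N := N) (p := p) hc hVp (Real.rpow_nonneg hqp.le (-b))
      rw [hn, hV]
      have hyle : y ≤ y₁ := by rw [hydef]; nlinarith [ht.1]
      have hco := hcond y ⟨hpos, hyle⟩
      have hqpow : (q y ^ (-b)) ^ p = q y ^ (-b - 1) := by
        rw [← Real.rpow_mul hqp.le]; congr 1; linarith
      have hqq : q y ^ (1 + b) * q y ^ (-b - 1) = 1 := by
        rw [← Real.rpow_add hqp, show 1 + b + (-b - 1) = 0 by ring, Real.rpow_zero]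
      rw [hqpow, Real.mul_rpow hx.le hpos.le, mul_pow, ← hadef] at hinv
      have hxa := Real.rpow_pos_of_pos hx a
      have hya := Real.rpow_pos_of_pos hpos a
      have hQ := Real.rpow_pos_of_pos hqp (-b - 1)
      set Q := q y ^ (-b - 1)
      have hmain : (rate N p c (x * y) (q y ^ (-b)))⁻¹ ≤ q' y * b * Q := by
        rw [hinv]
        have e1 : q' y = (((N + 1) * A) * (y ^ N * y ^ a) + ε * (1 - a)) / y ^ a := by
          simp only [q', Real.rpow_neg hpos.le]
          field_simp
        have e2 : (p - 1) * b = 1 := by rw [hb]; field_simp [show p - 1 ≠ 0 by linarith]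
        have e3 : (p - 1) * (x ^ a)⁻¹ * q y ^ (1 + b) + c * (p - 1) * x ^ N * (y ^ N * y ^ a) ≤
          ((N + 1) * A) * (y ^ N * y ^ a) + ε * (1 - a) := by
          have : q y = A * y ^ (N + 1) + ε * (1 + y ^ (1 - a)) := rfl
          rw [this]; linarith
        have e4 := mul_le_mul_of_nonneg_right e3 (mul_pos (mul_pos hb0 hQ) (inv_pos.2 hya)).le
        calc (x ^ a * y ^ a)⁻¹ + c * (x ^ N * y ^ N) * Q
            = ((p - 1) * b) * (x ^ a)⁻¹ * (y ^ a)⁻¹ * (q y ^ (1 + b) * Q)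
              + c * ((p - 1) * b) * x ^ N * y ^ N * (y ^ a * (y ^ a)⁻¹) * Q := by
              rw [e2, hqq, mul_inv_cancel₀ hya.ne', mul_inv]; ring
          _ = ((p - 1) * (x ^ a)⁻¹ * q y ^ (1 + b) + c * (p - 1) * x ^ N * (y ^ N * y ^ a))
              * (b * Q * (y ^ a)⁻¹) := by ring
          _ ≤ _ := e4
          _ = q' y * b * Q := by rw [e1]; ring
      have h5 := mul_le_mul_of_nonneg_left hmain hr.le
      rw [mul_inv_cancel₀ hr.ne'] at h5
      calc y₁ = 1 * y₁ := by ring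
        _ ≤ (rate N p c (x * y) (q y ^ (-b)) * (q' y * b * Q)) * y₁ :=
            mul_le_mul_of_nonneg_right h5 hy₁.le
        _ = _ := by ring)
  refine ⟨γ, _, h1, ?_, by simpa using h3⟩
  simpa [q] using h2

end Reparam

section Projection

/-- `(x² - y²) / 2` evaluated at the positive parts of the coordinates. -/
def quadDiff (z : ℂ) : ℝ := (max z.re 0 ^ 2 - max z.im 0 ^ 2) / 2

/-- Projection onto the region `(x² - y²) / 2 ≥ u₀` of the quadrant along the level sets
of `x y`. -/
def quadProj (u₀ : ℝ) (z : ℂ) : ℂ :=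
  ⟨√(√(max |quadDiff z| u₀ ^ 2 + quadProd z ^ 2) + max |quadDiff z| u₀),
    √(√(max |quadDiff z| u₀ ^ 2 + quadProd z ^ 2) - max |quadDiff z| u₀)⟩

lemma quadProj_spec {u₀ : ℝ} (hu : 0 < u₀) (z : ℂ) :
    0 ≤ (quadProj u₀ z).im ∧ (quadProj u₀ z).im ≤ (quadProj u₀ z).re ∧
    √(2 * u₀) ≤ (quadProj u₀ z).re ∧ (quadProj u₀ z).re * (quadProj u₀ z).im = quadProd z ∧
    (quadProj u₀ z).re ^ 2 - (quadProj u₀ z).im ^ 2 = 2 * max |quadDiff z| u₀ ∧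
    (quadProj u₀ z).re ^ 2 + (quadProj u₀ z).im ^ 2 =
      2 * √(max |quadDiff z| u₀ ^ 2 + quadProd z ^ 2) := by
  have hv := quadProd_nonneg z
  set v := quadProd z with hvd
  set U := max |quadDiff z| u₀ with hU
  have hU0 : u₀ ≤ U := le_max_right _ _
  have hR : U ≤ √(U ^ 2 + v ^ 2) := Real.le_sqrt_of_sq_le (by nlinarith)
  have hR2 : √(U ^ 2 + v ^ 2) ^ 2 = U ^ 2 + v ^ 2 := Real.sq_sqrt (by positivity)
  set R := √(U ^ 2 + v ^ 2) with hRd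
  have e1 : (quadProj u₀ z).re = √(R + U) := rfl
  have e2 : (quadProj u₀ z).im = √(R - U) := rfl
  rw [e1, e2, Real.sq_sqrt (by linarith), Real.sq_sqrt (by linarith),
    ← Real.sqrt_mul (by linarith)]
  refine ⟨Real.sqrt_nonneg _, Real.sqrt_le_sqrt (by linarith), Real.sqrt_le_sqrt (by linarith),
    ?_, by ring, by ring⟩
  rw [show (R + U) * (R - U) = v ^ 2 by nlinarith, Real.sqrt_sq hv]

lemma quadProd_quadProj {u₀ : ℝ} (hu : 0 < u₀) (z : ℂ) :
    quadProd (quadProj u₀ z) = quadProd z := by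
  obtain ⟨h1, h2, -, h3, -⟩ := quadProj_spec hu z
  rw [quadProd, max_eq_left (h1.trans h2), max_eq_left h1, h3]

lemma quadProj_self {x y : ℝ} (hy : 0 ≤ y) (hxy : y < x) :
    quadProj ((x ^ 2 - y ^ 2) / 2) ⟨x, y⟩ = ⟨x, y⟩ := by
  have hx : 0 ≤ x := hy.trans hxy.le
  have hu : 0 < (x ^ 2 - y ^ 2) / 2 := by nlinarith
  have h1 : quadDiff ⟨x, y⟩ = (x ^ 2 - y ^ 2) / 2 := by
    simp [quadDiff, max_eq_left hx, max_eq_left hy]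
  have h2 : quadProd ⟨x, y⟩ = x * y := by simp [quadProd, max_eq_left hx, max_eq_left hy]
  have h3 : √(((x ^ 2 - y ^ 2) / 2) ^ 2 + (x * y) ^ 2) = (x ^ 2 + y ^ 2) / 2 := by
    rw [show ((x ^ 2 - y ^ 2) / 2) ^ 2 + (x * y) ^ 2 = ((x ^ 2 + y ^ 2) / 2) ^ 2 by ring,
      Real.sqrt_sq (by positivity)]
  unfold quadProj
  rw [h1, h2, abs_of_pos hu, max_self, h3]
  apply Complex.ext
  · simp only; rw [show (x ^ 2 + y ^ 2) / 2 + (x ^ 2 - y ^ 2) / 2 = x ^ 2 by ring, Real.sqrt_sq hx]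
  · simp only; rw [show (x ^ 2 + y ^ 2) / 2 - (x ^ 2 - y ^ 2) / 2 = y ^ 2 by ring, Real.sqrt_sq hy]

lemma le_of_mul_le_mul_of_add_le_add {D E d e : ℝ} (hd : 0 ≤ d) (hDE : D ≤ E)
    (hmul : D * E ≤ d * e) (hadd : d + e ≤ D + E) : D ≤ d := by
  by_contra h
  push Not at h
  nlinarith [mul_pos (sub_pos.2 h) (sub_pos.2 (h.trans_le hDE)), mul_le_mul_of_nonneg_left hadd hd]

lemma quadrant_contraction {a b a' b' A B A' B' : ℝ} (hA : 0 ≤ A) (hB : 0 ≤ B) (hA' : 0 ≤ A')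
    (hB' : 0 ≤ B') (hm : A * B = a * b) (hm' : A' * B' = a' * b')
    (hU : |(A ^ 2 - B ^ 2) - (A' ^ 2 - B' ^ 2)| ≤ |(a ^ 2 - b ^ 2) - (a' ^ 2 - b' ^ 2)|)
    (hs : a ^ 2 + b ^ 2 ≤ A ^ 2 + B ^ 2) (hs' : a' ^ 2 + b' ^ 2 ≤ A' ^ 2 + B' ^ 2) :
    (A - A') ^ 2 + (B - B') ^ 2 ≤ (a - a') ^ 2 + (b - b') ^ 2 := by
  refine le_of_mul_le_mul_of_add_le_add (E := (A + A') ^ 2 + (B + B') ^ 2)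
    (e := (a + a') ^ 2 + (b + b') ^ 2) (by positivity) ?_ ?_ ?_
  · linarith [mul_nonneg hA hA', mul_nonneg hB hB']
  · have e1 : ((A - A') ^ 2 + (B - B') ^ 2) * ((A + A') ^ 2 + (B + B') ^ 2) =
      ((A ^ 2 - B ^ 2) - (A' ^ 2 - B' ^ 2)) ^ 2 + 4 * (A * B - A' * B') ^ 2 := by ring
    have e2 : ((a - a') ^ 2 + (b - b') ^ 2) * ((a + a') ^ 2 + (b + b') ^ 2) =
      ((a ^ 2 - b ^ 2) - (a' ^ 2 - b' ^ 2)) ^ 2 + 4 * (a * b - a' * b') ^ 2 := by ring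
    rw [e1, e2, hm, hm']
    linarith [sq_le_sq.2 hU]
  · linarith

lemma sq_add_sq_le_quadProj {u₀ : ℝ} (hu : 0 < u₀) (z : ℂ) :
    max z.re 0 ^ 2 + max z.im 0 ^ 2 ≤ (quadProj u₀ z).re ^ 2 + (quadProj u₀ z).im ^ 2 := by
  obtain ⟨-, -, -, -, -, z5⟩ := quadProj_spec hu z
  have h1 : quadDiff z ^ 2 ≤ max |quadDiff z| u₀ ^ 2 := by
    rw [← sq_abs (quadDiff z)]
    exact pow_le_pow_left₀ (abs_nonneg _) (le_max_left _ _) 2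
  have h2 : (max z.re 0 ^ 2 + max z.im 0 ^ 2) / 2 ≤
      √(max |quadDiff z| u₀ ^ 2 + quadProd z ^ 2) := by
    refine Real.le_sqrt_of_sq_le ?_
    have : ((max z.re 0 ^ 2 + max z.im 0 ^ 2) / 2) ^ 2 = quadDiff z ^ 2 + quadProd z ^ 2 := by
      unfold quadDiff quadProd; ring
    linarith
  linarith

lemma lipschitzWith_quadProj {u₀ : ℝ} (hu : 0 < u₀) : LipschitzWith 1 (quadProj u₀) := by
  refine LipschitzWith.of_dist_le_mul fun z w => ?_
  rw [NNReal.coe_one, one_mul, dist_eq_norm, dist_eq_norm]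
  refine (sq_le_sq₀ (norm_nonneg _) (norm_nonneg _)).1 ?_
  rw [← Complex.normSq_eq_norm_sq, ← Complex.normSq_eq_norm_sq, Complex.normSq_apply,
    Complex.normSq_apply]
  simp only [Complex.sub_re, Complex.sub_im, ← sq]
  obtain ⟨z1, z2, -, z3, z4, -⟩ := quadProj_spec hu z
  obtain ⟨w1, w2, -, w3, w4, -⟩ := quadProj_spec hu w
  have hUV : |max |quadDiff z| u₀ - max |quadDiff w| u₀| ≤ |quadDiff z - quadDiff w| :=
    (abs_max_sub_max_le_abs _ _ _).trans (abs_abs_sub_abs_le _ _)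
  have hRe : (max z.re 0 - max w.re 0) ^ 2 ≤ (z.re - w.re) ^ 2 :=
    sq_le_sq.2 (abs_max_sub_max_le_abs _ _ _)
  have hIm : (max z.im 0 - max w.im 0) ^ 2 ≤ (z.im - w.im) ^ 2 :=
    sq_le_sq.2 (abs_max_sub_max_le_abs _ _ _)
  have key := quadrant_contraction (z1.trans z2) z1 (w1.trans w2) w1 z3 w3
    (by
      rw [z4, w4, ← mul_sub, abs_mul, abs_two]
      calc 2 * |max |quadDiff z| u₀ - max |quadDiff w| u₀| ≤ 2 * |quadDiff z - quadDiff w| := by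
            linarith
        _ = |2 * (quadDiff z - quadDiff w)| := by rw [abs_mul, abs_two]
        _ = _ := by congr 1; unfold quadDiff; ring)
    (sq_add_sq_le_quadProj hu z) (sq_add_sq_le_quadProj hu w)
  linarith

end Projection

lemma exists_first_hit {f : ℝ → ℝ} (hf : Continuous f) {s t r : ℝ} (hst : s ≤ t) (hs : f s ≤ r)
    (ht : r ≤ f t) : ∃ τ ∈ Icc s t, f τ = r ∧ ∀ ν ∈ Icc s τ, f ν ≤ r := by
  let S := Icc s t ∩ f ⁻¹' Ici r
  have hS : IsCompact S := isCompact_Icc.inter_right (isClosed_Ici.preimage hf)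
  obtain ⟨τ, hτ, hmin⟩ := hS.exists_isLeast ⟨t, ⟨hst, le_rfl⟩, ht⟩
  have hle : ∀ ν ∈ Ico s τ, f ν < r := fun ν hν => by
    by_contra h
    push Not at h
    exact absurd (hmin ⟨⟨hν.1, hν.2.le.trans hτ.1.2⟩, h⟩) (not_le.2 hν.2)
  have heq : f τ = r := by
    refine le_antisymm ?_ hτ.2
    rcases hτ.1.1.eq_or_lt with h | h
    · rw [← h]; exact hs
    have : Tendsto f (𝓝[<] τ) (𝓝 (f τ)) := hf.continuousAt.tendsto.mono_left nhdsWithin_le_nhds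
    refine le_of_tendsto this ?_
    filter_upwards [Ioo_mem_nhdsLT h] with ν hν using (hle ν ⟨hν.1.le, hν.2⟩).le
  refine ⟨τ, hτ.1, heq, fun ν hν => ?_⟩
  rcases hν.2.eq_or_lt with h | h
  · rw [h, heq]
  · exact (hle ν ⟨hν.1, h⟩).le

/-- Some slow path from `z₀` reaches the boundary of the quadrant. -/
def Reaches (N : ℕ) (p c : ℝ) (z₀ : ℂ) : Prop :=
  ∃ γ T, IsSlow N p c γ ∧ 0 ≤ T ∧ (∀ μ ≤ 0, γ μ = z₀) ∧ quadProd (γ T) = 0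

section

variable {N : ℕ} {p c : ℝ}

lemma IsSlow.norm_sub_le_of_rate_le_rpow {γ : ℝ → ℂ} (hγ : IsSlow N p c γ) (hN : 1 ≤ N)
    (hp : 2 * (N : ℝ) + 1 ≤ p) (hc : 0 ≤ c) {s t K e : ℝ} (hs : 0 < s) (hst : s ≤ t)
    (he : 0 < e) (h : ∀ ν ∈ Icc s t, rate N p c (quadProd (γ ν)) ν ≤ K * ν ^ (-e - 1)) :
    ‖γ t - γ s‖ ≤ K / e * (s ^ (-e) - t ^ (-e)) := by
  have hd : ∀ x, 0 < x → HasDerivAt (fun x : ℝ => -(K / e) * x ^ (-e)) (K * x ^ (-e - 1)) x :=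
    fun x hx => by
      have := (Real.hasDerivAt_rpow_const (x := x) (p := -e) (Or.inl hx.ne')).const_mul (-(K / e))
      convert! this using 1
      field_simp
  have := hγ.norm_sub_le hN hp hc hst
    (fun x hx => (hd x (hs.trans_le hx.1)).continuousAt.continuousWithinAt)
    (fun x hx => (hd x (hs.trans_le hx.1)).hasDerivWithinAt)
    (fun x hx => h x (Ico_subset_Icc_self hx))
  linarith

lemma quadProd_of_nonneg {z : ℂ} (h1 : 0 ≤ z.re) (h2 : 0 ≤ z.im) :
    quadProd z = z.re * z.im := by rw [quadProd, max_eq_left h1, max_eq_left h2]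

lemma quarter_quadProd_le {z w : ℂ} (h2 : 0 ≤ z.im) (h1 : z.im ≤ z.re)
    (h : ‖w - z‖ ≤ z.im / 2) : quadProd z / 4 ≤ quadProd w := by
  have hr := (abs_le.1 ((Complex.abs_re_le_norm (w - z)).trans h)).1
  have hi := (abs_le.1 ((Complex.abs_im_le_norm (w - z)).trans h)).1
  rw [Complex.sub_re] at hr
  rw [Complex.sub_im] at hi
  rw [quadProd_of_nonneg (h2.trans h1) h2, quadProd_of_nonneg (by linarith) (by linarith)]
  have : (z.re / 2) * (z.im / 2) ≤ w.re * w.im :=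
    mul_le_mul (by linarith) (by linarith) (by linarith) (by linarith)
  linarith

/-- A path that reaches the boundary is close to it. -/
lemma IsSlow.height_le {γ : ℝ → ℂ} (hγ : IsSlow N p c γ) (hN : 1 ≤ N)
    (hp : 2 * (N : ℝ) + 1 ≤ p) (hc : 0 < c) {s T : ℝ} (hs : 0 < s) (hsT : s ≤ T)
    (hT : quadProd (γ T) = 0) (h2 : 0 ≤ (γ s).im) (h1 : (γ s).im ≤ (γ s).re) :
    quadProd (γ s) ^ N * (γ s).im ≤ 2 * 4 ^ N / (c * (p - 1)) * s ^ (-(p - 1)) := by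
  have hp3 := three_le_of_exponent hN hp
  have hRHS : 0 ≤ 2 * 4 ^ N / (c * (p - 1)) * s ^ (-(p - 1)) := by
    have : 0 < p - 1 := by linarith
    positivity
  rcases h2.eq_or_lt with h0 | h0
  · rw [← h0, mul_zero]; exact hRHS
  have hV : 0 < quadProd (γ s) := by
    rw [quadProd_of_nonneg (h2.trans h1) h2]; exact mul_pos (h0.trans_le h1) h0
  have hTn : (γ s).im / 2 ≤ ‖γ T - γ s‖ := by
    by_contra h
    push Not at h
    have := quarter_quadProd_le h2 h1 h.le
    linarith
  obtain ⟨t, ht, hteq, hle⟩ := exists_first_hit (f := fun ν => ‖γ ν - γ s‖)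
    (hγ.cont.sub continuous_const).norm hsT (by simp; linarith) hTn
  have hV4 : 0 < quadProd (γ s) / 4 := by linarith
  have key := hγ.norm_sub_le_of_rate_le_rpow hN hp hc.le (K := 4 ^ N / (c * quadProd (γ s) ^ N))
    (e := p - 1) hs ht.1 (by linarith) (fun ν hν => by
      have hν0 : 0 < ν := hs.trans_le hν.1
      have hq := quarter_quadProd_le h2 h1 (hle ν hν)
      refine (rate_le_inv hc (hV4.trans_le hq) hν0).trans ?_
      have h4 := pow_le_pow_left₀ hV4.le hq N
      rw [div_pow] at h4
      rw [show -(p - 1) - 1 = -p by ring, Real.rpow_neg hν0.le, mul_inv]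
      have hνp := Real.rpow_pos_of_pos hν0 p
      refine mul_le_mul_of_nonneg_right ?_ (by positivity)
      rw [inv_le_comm₀ (by have := hV4.trans_le hq; positivity) (by positivity), inv_div,
        mul_div_assoc]
      exact mul_le_mul_of_nonneg_left h4 hc.le)
  rw [hteq] at key
  have ht0 := Real.rpow_pos_of_pos (hs.trans_le ht.1) (-(p - 1))
  have hs0 := Real.rpow_pos_of_pos hs (-(p - 1))
  have hp1 : 0 < p - 1 := by linarith
  have hK : 0 ≤ 4 ^ N / (c * quadProd (γ s) ^ N) / (p - 1) := by positivity
  have key2 : (γ s).im / 2 ≤ 4 ^ N / (c * quadProd (γ s) ^ N) / (p - 1) * s ^ (-(p - 1)) :=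
    key.trans (mul_le_mul_of_nonneg_left (by linarith) hK)
  have hVN : 0 < quadProd (γ s) ^ N := pow_pos hV N
  have key3 := mul_le_mul_of_nonneg_left key2 (show 0 ≤ 2 * quadProd (γ s) ^ N by positivity)
  calc quadProd (γ s) ^ N * (γ s).im = 2 * quadProd (γ s) ^ N * ((γ s).im / 2) := by ring
    _ ≤ _ := key3
    _ = _ := by field_simp

lemma Reaches.exists_proj {x y : ℝ} (hy : 0 < y) (hxy : y < x) (h : Reaches N p c ⟨x, y⟩) :
    ∃ γ T, IsSlow N p c γ ∧ 0 ≤ T ∧ (∀ μ ≤ 0, γ μ = ⟨x, y⟩) ∧ quadProd (γ T) = 0 ∧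
      ∀ μ, 0 ≤ (γ μ).im ∧ (γ μ).im ≤ (γ μ).re ∧ √(x ^ 2 - y ^ 2) ≤ (γ μ).re := by
  obtain ⟨γ, T, hγ, hT, h0, hV⟩ := h
  have hu : 0 < (x ^ 2 - y ^ 2) / 2 := by nlinarith
  refine ⟨_, T, hγ.comp_lipschitz (lipschitzWith_quadProj hu) (quadProd_quadProj hu), hT,
    fun μ hμ => ?_, ?_, fun μ => ?_⟩
  · rw [h0 μ hμ, quadProj_self hy.le hxy]
  · rw [quadProd_quadProj hu, hV]
  · obtain ⟨h1, h2, h3, -⟩ := quadProj_spec hu (γ μ)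
    rw [mul_div_cancel₀ _ two_ne_zero] at h3
    exact ⟨h1, h2, h3⟩

lemma Reaches.anti (hN : 1 ≤ N) (hp : 2 * (N : ℝ) + 1 ≤ p) {z : ℂ} (h : Reaches N p c z)
    {c' : ℝ} (hc : 0 ≤ c') (hcc : c' ≤ c) : Reaches N p c' z := by
  obtain ⟨γ, T, hγ, h⟩ := h
  exact ⟨γ, T, hγ.anti hN hp hc hcc, h⟩

lemma IsSlow.norm_sub_le_mul {γ : ℝ → ℂ} (hγ : IsSlow N p c γ) (hN : 1 ≤ N)
    (hp : 2 * (N : ℝ) + 1 ≤ p) (hc : 0 ≤ c) {s t m : ℝ} (hs : 0 ≤ s) (hst : s ≤ t)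
    (htm : t ≤ m) :
    ‖γ t - γ s‖ ≤ (1 + (‖γ 0‖ + 1) * Real.exp (3 * m)) * (t - s) := by
  refine hγ.le s t _ hst fun ν hν => ?_
  refine (rate_le_rpow hc (quadProd_nonneg _) _).trans ((rpow_volExp_le hN hp _).trans ?_)
  have h1 := hγ.norm_le_exp hN hp hc (hs.trans hν.1)
  have h2 : Real.exp (3 * ν) ≤ Real.exp (3 * m) := Real.exp_le_exp.2 (by linarith [hν.2])
  have := mul_le_mul_of_nonneg_left h2 (show 0 ≤ ‖γ 0‖ + 1 by positivity)
  linarith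

lemma bddAbove_reaches (hN : 1 ≤ N) (hp : 2 * (N : ℝ) + 1 ≤ p) {x y : ℝ} (hy : 0 < y)
    (hxy : y < x) : BddAbove {c | 0 < c ∧ Reaches N p c ⟨x, y⟩} := by
  have hp3 := three_le_of_exponent hN hp
  set z₀ : ℂ := ⟨x, y⟩ with hz₀
  set κ := 1 + (‖z₀‖ + 1) * Real.exp (3 * 1) with hκ
  have hκ0 : 0 < κ := by positivity
  obtain ⟨ε, hε, hε1, hεκ⟩ : ∃ ε, 0 < ε ∧ ε ≤ 1 ∧ κ * ε ≤ y / 2 := by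
    refine ⟨min 1 (y / 2 / κ), by positivity, min_le_left _ _, ?_⟩
    calc κ * min 1 (y / 2 / κ) ≤ κ * (y / 2 / κ) :=
          mul_le_mul_of_nonneg_left (min_le_right _ _) hκ0.le
      _ = _ := by field_simp
  have hV0 : quadProd z₀ = x * y := quadProd_of_nonneg (hy.trans hxy).le hy.le
  have hV0' : 0 < x * y := mul_pos (hy.trans hxy) hy
  refine ⟨2 * 4 ^ N / (p - 1) * ε ^ (-(p - 1)) / ((x * y / 4) ^ N * (y / 2)), ?_⟩
  rintro c ⟨hc, hr⟩
  obtain ⟨γ, T, hγ, hT, h0, hV, hq⟩ := hr.exists_proj hy hxy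
  have hγ0 : γ 0 = z₀ := h0 0 le_rfl
  have hnear : ∀ t ∈ Icc 0 ε, ‖γ t - z₀‖ ≤ y / 2 := fun t ht => by
    have := hγ.norm_sub_le_mul hN hp hc.le le_rfl ht.1 (ht.2.trans hε1)
    rw [hγ0, ← hκ] at this
    refine this.trans (le_trans ?_ hεκ)
    exact mul_le_mul_of_nonneg_left (by linarith [ht.2]) hκ0.le
  have hnear' : ∀ t ∈ Icc 0 ε, x * y / 4 ≤ quadProd (γ t) := fun t ht => by
    rw [← hV0]
    exact quarter_quadProd_le (z := z₀) hy.le hxy.le (hnear t ht)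
  have hεT : ε ≤ T := by
    by_contra h
    push Not at h
    have := hnear' T ⟨hT, h.le⟩
    rw [hV] at this; linarith
  have key := hγ.height_le hN hp hc hε hεT hV (hq ε).1 (hq ε).2.1
  have him : y / 2 ≤ (γ ε).im := by
    have := (abs_le.1 ((Complex.abs_im_le_norm _).trans (hnear ε ⟨hε.le, le_rfl⟩))).1
    rw [Complex.sub_im] at this
    have h3 : z₀.im = y := rfl
    linarith
  have h1 : (x * y / 4) ^ N * (y / 2) ≤ quadProd (γ ε) ^ N * (γ ε).im :=
    mul_le_mul (pow_le_pow_left₀ (by positivity) (hnear' ε ⟨hε.le, le_rfl⟩) N) him (by positivity)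
      (pow_nonneg (quadProd_nonneg _) _)
  have hp1 : 0 < p - 1 := by linarith
  rw [le_div_iff₀ (by positivity)]
  calc c * ((x * y / 4) ^ N * (y / 2))
      ≤ c * (2 * 4 ^ N / (c * (p - 1)) * ε ^ (-(p - 1))) :=
        mul_le_mul_of_nonneg_left (h1.trans key) hc.le
    _ = _ := by field_simp

end

section

variable {N : ℕ} {p c : ℝ}

lemma isSlow_clamp (hc : 0 ≤ c) {f : ℝ → ℂ} {T : ℝ} (hT : 0 ≤ T) (hf : ContinuousOn f (Icc 0 T))
    (h : ∀ s t κ : ℝ, 0 ≤ s → s ≤ t → t ≤ T →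
      (∀ ν ∈ Icc s t, rate N p c (quadProd (f ν)) ν ≤ κ) → ‖f t - f s‖ ≤ κ * (t - s)) :
    IsSlow N p c fun t => f (max 0 (min t T)) where
  cont := hf.comp_continuous (by fun_prop) fun t =>
    ⟨le_max_left _ _, max_le hT (min_le_right _ _)⟩
  le s t κ hst hκ := by
    have hκ0 : 0 ≤ κ := (rate_nonneg hc (quadProd_nonneg _) _).trans (hκ s ⟨le_rfl, hst⟩)
    rcases le_total t 0 with ht | ht
    · rw [min_eq_left (ht.trans hT), min_eq_left (hst.trans (ht.trans hT)), max_eq_left ht,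
        max_eq_left (hst.trans ht)]
      simpa using mul_nonneg hκ0 (sub_nonneg.2 hst)
    rcases le_total T s with hs | hs
    · rw [min_eq_right hs, min_eq_right (hs.trans hst)]
      simpa using mul_nonneg hκ0 (sub_nonneg.2 hst)
    rw [min_eq_left hs, max_eq_right (le_min ht hT)]
    have hle : max 0 s ≤ min t T := max_le (le_min ht hT) (le_min hst hs)
    refine (h (max 0 s) (min t T) κ (le_max_left _ _) hle (min_le_right _ _)
      fun ν hν => ?_).trans ?_
    · have := hκ ν ⟨(le_max_right _ _).trans hν.1, hν.2.trans (min_le_left _ _)⟩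
      rwa [min_eq_left (hν.2.trans (min_le_right _ _)),
        max_eq_right ((le_max_left _ _).trans hν.1)] at this
    · exact mul_le_mul_of_nonneg_left (by linarith [min_le_left t T, le_max_right 0 s]) hκ0

lemma exists_reaches (hN : 1 ≤ N) (hp : 2 * (N : ℝ) + 1 ≤ p) {x y : ℝ} (hx : 0 < x)
    (hy : 0 < y) : ∃ c, 0 < c ∧ Reaches N p c ⟨x, y⟩ := by
  have hp3 := three_le_of_exponent hN hp
  have ha := volExp_pos hN hp
  have ha2 := volExp_le_half hN hp
  have hp1 : 0 < p - 1 := by linarith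
  have hb0 : 0 < 1 / (p - 1) := one_div_pos.2 hp1
  set a := volExp N p with hadef
  set b := 1 / (p - 1) with hb
  have hxa := Real.rpow_pos_of_pos hx a
  have hya := Real.rpow_pos_of_pos hy (1 - a)
  set C := y ^ (N + 1) + (1 + y ^ (1 - a)) with hC
  have hC0 : 0 < C := by positivity
  have hCb := Real.rpow_pos_of_pos hC0 (1 + b)
  set D := (p - 1) * (x ^ a)⁻¹ * C ^ (1 + b) with hD
  have hD0 : 0 < D := by positivity
  obtain ⟨ε, hε, hεD⟩ : ∃ ε : ℝ, 0 < ε ∧ D * ε ^ b ≤ 1 - a := by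
    have : Tendsto (fun ε : ℝ => D * ε ^ b) (𝓝[>] 0) (𝓝 (D * 0 ^ b)) :=
      (((Real.continuous_rpow_const hb0.le).tendsto 0).const_mul D).mono_left nhdsWithin_le_nhds
    rw [Real.zero_rpow hb0.ne', mul_zero] at this
    obtain ⟨ε, h1, h2⟩ := ((this.eventually_lt_const (show 0 < 1 - a by linarith)).and
      self_mem_nhdsWithin).exists
    exact ⟨ε, h2, h1.le⟩
  refine ⟨(N + 1) * ε / ((p - 1) * x ^ N), by positivity, ?_⟩
  have hc : 0 < (N + 1) * ε / ((p - 1) * x ^ N) := by positivity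
  obtain ⟨γ, T, h1, h2, h3⟩ := exists_isSlow_descent hN hp hc.le hx hy hε.le hε (fun z hz => by
    rw [← hadef, ← hb]
    have e1 : ((N : ℝ) + 1) * ε - (N + 1) * ε / ((p - 1) * x ^ N) * (p - 1) * x ^ N = 0 := by
      field_simp; ring
    rw [e1, zero_mul, zero_add]
    have e2 : ε * z ^ (N + 1) + ε * (1 + z ^ (1 - a)) ≤ ε * C := by
      rw [← mul_add]
      refine mul_le_mul_of_nonneg_left ?_ hε.le
      have := pow_le_pow_left₀ hz.1.le hz.2 (N + 1)
      have := Real.rpow_le_rpow hz.1.le hz.2 (show 0 ≤ 1 - a by linarith)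
      rw [hC]; linarith
    have hz0 : 0 < z ^ (N + 1) := pow_pos hz.1 _
    have hz1 := Real.rpow_pos_of_pos hz.1 (1 - a)
    calc (p - 1) * (x ^ a)⁻¹ * (ε * z ^ (N + 1) + ε * (1 + z ^ (1 - a))) ^ (1 + b)
        ≤ (p - 1) * (x ^ a)⁻¹ * (ε * C) ^ (1 + b) := by
          gcongr
      _ = ε * (D * ε ^ b) := by
          rw [Real.mul_rpow hε.le hC0.le, Real.rpow_add hε, Real.rpow_one, hD]; ring
      _ ≤ ε * (1 - a) := mul_le_mul_of_nonneg_left hεD hε.le)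
  refine ⟨γ, max T 0, h1, le_max_right _ _, fun μ hμ => h2 μ (hμ.trans ?_), ?_⟩
  · positivity
  · rcases le_total T 0 with hT | hT
    · have e1 := h2 T (hT.trans (by positivity))
      rw [h3] at e1
      have := congrArg Complex.im e1
      simp only at this
      exact absurd this hy.ne
    · rw [max_eq_left hT, h3]; simp [quadProd]

lemma rate_slowdown (hN : 1 ≤ N) (hp : 2 * (N : ℝ) + 1 ≤ p) (hc : 0 ≤ c) {c' T K v x : ℝ}
    (hcc : c ≤ c') (hT : 0 < T) (hv : 0 ≤ v) (hK : v ^ N * v ^ volExp N p ≤ K)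
    (hcK : (c' - c) * K * T ≤ (T ^ (p - 1))⁻¹) (hx : 0 ≤ x) (hxT : x ≤ T) :
    rate N p c v (x - (T ^ (p - 1))⁻¹ * x ^ p / p) * (1 - (T ^ (p - 1))⁻¹ * x ^ (p - 1)) ≤
      rate N p c' v x := by
  have hp3 := three_le_of_exponent hN hp
  have hTp := Real.rpow_pos_of_pos hT (p - 1)
  set δ := (T ^ (p - 1))⁻¹ with hδ
  have hδ0 : 0 < δ := inv_pos.2 hTp
  have hy0 : 0 ≤ x ^ (p - 1) := Real.rpow_nonneg hx _
  have hyT : δ * x ^ (p - 1) ≤ 1 := by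
    rw [hδ, inv_mul_le_iff₀ hTp, mul_one]
    exact Real.rpow_le_rpow hx hxT (by linarith)
  rcases hx.eq_or_lt with h0 | h0
  · rw [← h0, Real.zero_rpow (by linarith), Real.zero_rpow (by linarith)]
    simp only [mul_zero, zero_div, sub_zero, mul_one]
    rw [rate_of_nonpos hN hp le_rfl, rate_of_nonpos hN hp le_rfl]
  have hxp : x ^ p = x * x ^ (p - 1) := by
    rw [← Real.rpow_one_add' hx (by linarith)]; congr 1; ring
  set y := x ^ (p - 1) with hy
  have hhx : x - δ * x ^ p / p = x * (1 + -(δ * y / p)) := by rw [hxp]; ring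
  have hyp : δ * y / p ≤ 1 := by
    rw [div_le_one (by linarith)]; linarith
  have hh0 : 0 ≤ x * (1 + -(δ * y / p)) := mul_nonneg hx (by linarith)
  have hbern : x ^ p * (1 - δ * y) ≤ (x * (1 + -(δ * y / p))) ^ p := by
    rw [Real.mul_rpow hx (by linarith)]
    refine mul_le_mul_of_nonneg_left ?_ (Real.rpow_nonneg hx _)
    refine le_trans (le_of_eq ?_) (one_add_mul_self_le_rpow_one_add (by linarith)
      (by linarith : 1 ≤ p))
    field_simp; ring
  rw [hhx]
  unfold rate
  rw [max_eq_left hx, max_eq_left hh0]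
  set H := (x * (1 + -(δ * y / p))) ^ p with hH
  have hw : 0 ≤ v ^ volExp N p := Real.rpow_nonneg hv _
  set w := v ^ volExp N p
  have hX : 0 ≤ v ^ N * w := mul_nonneg (pow_nonneg hv _) hw
  set X := v ^ N * w
  have hH0 : 0 ≤ H := Real.rpow_nonneg hh0 _
  have hxp0 : 0 ≤ x ^ p := Real.rpow_nonneg hx _
  rw [div_mul_eq_mul_div, div_le_div_iff₀ (by positivity)
    (by have := hc.trans hcc; positivity), mul_assoc]
  refine mul_le_mul_of_nonneg_left ?_ hw
  have h1 : (c' - c) * X * x ≤ δ := by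
    refine le_trans ?_ hcK
    have : 0 ≤ c' - c := by linarith
    exact mul_le_mul (mul_le_mul_of_nonneg_left hK this) hxT hx
      (mul_nonneg this (hX.trans hK))
  have h2 := mul_le_mul_of_nonneg_right h1 hy0
  have h3 := mul_le_mul_of_nonneg_left hbern (mul_nonneg hc hX)
  have h4 : 0 ≤ δ * y * ((c' - c) * (X * x ^ p)) := by
    have : 0 ≤ c' - c := by linarith
    positivity
  have h5 : (c' - c) * X * x * y = (c' - c) * (X * x ^ p) := by rw [hxp]; ring
  nlinarith

lemma Reaches.exists_gt (hN : 1 ≤ N) (hp : 2 * (N : ℝ) + 1 ≤ p) (hc : 0 ≤ c) {z : ℂ}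
    (hz : quadProd z ≠ 0) (h : Reaches N p c z) : ∃ c', c < c' ∧ Reaches N p c' z := by
  have hp3 := three_le_of_exponent hN hp
  have hp1 : 0 < p - 1 := by linarith
  obtain ⟨γ, T₀, hγ, hT₀, h0, hV⟩ := h
  have hT₀' : 0 < T₀ := by
    rcases hT₀.eq_or_lt with h | h
    · rw [← h, h0 0 le_rfl] at hV; exact absurd hV hz
    · exact h
  have hcq := continuous_quadProd.comp hγ.cont
  obtain ⟨K₀, hK₀⟩ : ∃ K, ∀ ν ∈ Icc 0 T₀, quadProd (γ ν) ^ N * quadProd (γ ν) ^ volExp N p ≤ K := by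
    obtain ⟨K, hK⟩ := (isCompact_Icc (a := (0:ℝ)) (b := T₀)).exists_bound_of_continuousOn
      (f := fun ν => quadProd (γ ν) ^ N * quadProd (γ ν) ^ volExp N p)
      ((hcq.pow N).mul (hcq.rpow_const fun _ => Or.inr (volExp_pos hN hp).le)).continuousOn
    exact ⟨K, fun ν hν => (le_abs_self _).trans (hK ν hν)⟩
  set K := max K₀ 1
  have hK1 : 0 < K := lt_of_lt_of_le one_pos (le_max_right _ _)
  set T := T₀ * p / (p - 1) with hT
  have hT0 : 0 < T := by positivity
  have hTp := Real.rpow_pos_of_pos hT0 (p - 1)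
  set δ := (T ^ (p - 1))⁻¹ with hδ
  have hδ0 : 0 < δ := inv_pos.2 hTp
  let h : ℝ → ℝ := fun x => x - δ * x ^ p / p
  let h' : ℝ → ℝ := fun x => 1 - δ * x ^ (p - 1)
  have hd : ∀ x, HasDerivAt h (h' x) x := fun x => by
    have := ((Real.hasDerivAt_rpow_const (x := x) (p := p) (Or.inr (by linarith))).const_mul
      δ).div_const p
    convert! (hasDerivAt_id x).sub this using 1
    simp only [h']; field_simp
  have hhT : h T = T₀ := by
    have : T ^ p = T * T ^ (p - 1) := by
      rw [← Real.rpow_one_add' hT0.le (by linarith)]; congr 1; ring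
    simp only [h]
    rw [this, hδ, hT]
    field_simp
  have hcont : Continuous h := continuous_iff_continuousAt.2 fun x => (hd x).continuousAt
  have hmono : MonotoneOn h (Icc 0 T) := by
    refine monotoneOn_of_deriv_nonneg (convex_Icc _ _) hcont.continuousOn
      (fun x _ => (hd x).differentiableAt.differentiableWithinAt) fun x hx => ?_
    rw [interior_Icc] at hx
    rw [(hd x).deriv]
    simp only [h']
    have : δ * x ^ (p - 1) ≤ 1 := by
      rw [hδ, inv_mul_le_iff₀ hTp, mul_one]
      exact Real.rpow_le_rpow hx.1.le hx.2.le hp1.le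
    linarith
  have hh0 : h 0 = 0 := by simp [h, Real.zero_rpow (show p ≠ 0 by linarith)]
  have hpos : 0 < δ / (K * T) := by positivity
  refine ⟨c + δ / (K * T), by linarith, fun t => γ (h (max 0 (min t T))), T, ?_, hT0.le, ?_, ?_⟩
  · refine isSlow_clamp (f := fun t => γ (h t)) (by linarith) hT0.le
      (hγ.cont.comp hcont).continuousOn fun s t κ hs hst ht hκ => ?_
    have hsub : Icc s t ⊆ Icc 0 T := Icc_subset_Icc hs ht
    have := hγ.norm_sub_comp_le hN hp hc (h := h) (h' := h') (B := fun x => κ * x)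
      (B' := fun _ => κ * 1) hst (hmono.mono hsub) hcont.continuousOn
      (fun x _ => (hd x).hasDerivWithinAt) (by fun_prop)
      (fun x _ => ((hasDerivAt_id x).const_mul κ).hasDerivWithinAt)
      (fun x hx => by
        have hx' := hsub (Ico_subset_Icc_self hx)
        rw [mul_one]
        refine le_trans ?_ (hκ x (Ico_subset_Icc_self hx))
        refine rate_slowdown hN hp hc (K := K) (by linarith) hT0 (quadProd_nonneg _)
          ((hK₀ _ ⟨?_, ?_⟩).trans (le_max_left _ _)) ?_ hx'.1 hx'.2
        · rw [← hh0]; exact hmono ⟨le_rfl, hT0.le⟩ hx' hx'.1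
        · rw [← hhT]; exact hmono hx' ⟨hT0.le, le_rfl⟩ hx'.2
        · rw [add_sub_cancel_left, mul_assoc, div_mul_cancel₀ _ (by positivity)])
    linarith
  · intro μ hμ
    simp only [min_eq_left (hμ.trans hT0.le), max_eq_left hμ, hh0, h0 0 le_rfl]
  · simp only [min_self, max_eq_right hT0.le, hhT, hV]

lemma exists_critical (hN : 1 ≤ N) (hp : 2 * (N : ℝ) + 1 ≤ p) {x y : ℝ} (hy : 0 < y)
    (hxy : y < x) : ∃ cs, 0 < cs ∧ ¬ Reaches N p cs ⟨x, y⟩ ∧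
      ∀ c, 0 < c → c < cs → Reaches N p c ⟨x, y⟩ := by
  have hbdd := bddAbove_reaches hN hp hy hxy
  obtain ⟨c₀, hc₀, hr₀⟩ := exists_reaches hN hp (hy.trans hxy) hy
  set S := {c | 0 < c ∧ Reaches N p c ⟨x, y⟩} with hS
  have h0 : 0 < sSup S := lt_of_lt_of_le hc₀ (le_csSup hbdd ⟨hc₀, hr₀⟩)
  refine ⟨sSup S, h0, fun hr => ?_, fun c hc hcs => ?_⟩
  · have hz : quadProd ⟨x, y⟩ ≠ 0 := by
      rw [quadProd_of_nonneg (hy.trans hxy).le hy.le]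
      exact (mul_pos (hy.trans hxy) hy).ne'
    obtain ⟨c', h1, h2⟩ := hr.exists_gt hN hp h0.le hz
    exact absurd (le_csSup hbdd ⟨h0.trans h1, h2⟩) (not_le.2 h1)
  · have hne : S.Nonempty := ⟨c₀, hc₀, hr₀⟩
    obtain ⟨c', ⟨h1, h2⟩, h3⟩ := exists_lt_of_lt_csSup hne hcs
    exact h2.anti hN hp hc.le h3.le

end

section

variable {N : ℕ} {p c : ℝ}

/-- A slow path reaching the boundary at a time that is optimal up to `ε`. -/
lemma Reaches.exists_almost_optimal (hN : 1 ≤ N) (hp : 2 * (N : ℝ) + 1 ≤ p) (hc : 0 < c)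
    {x y : ℝ} (hy : 0 < y) (hxy : y < x) (h : Reaches N p c ⟨x, y⟩) {ε : ℝ} (hε : 0 < ε) :
    ∃ γ T, IsSlow N p c γ ∧ (∀ μ ≤ 0, γ μ = ⟨x, y⟩) ∧ (∀ μ, T ≤ μ → quadProd (γ μ) = 0) ∧
      (∀ μ, 0 ≤ (γ μ).im ∧ (γ μ).im ≤ (γ μ).re ∧ √(x ^ 2 - y ^ 2) ≤ (γ μ).re) ∧
      (∀ s, 0 < s →
        quadProd (γ s) ^ N * (γ s).im ≤ 2 * 4 ^ N / (c * (p - 1)) * s ^ (-(p - 1))) ∧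
      ∀ s t κ, 0 ≤ s → s < t → t ≤ T → 0 < κ →
        (∀ θ ∈ Icc (0:ℝ) 1, ∀ ν ∈ Icc s t,
          κ ≤ rate N p c (quadProd (γ s + θ * (γ t - γ s))) ν) →
        κ * (t - s - ε) ≤ ‖γ t - γ s‖ := by
  have hp3 := three_le_of_exponent hN hp
  let S : Set ℝ := {T | 0 ≤ T ∧ ∃ γ, IsSlow N p c γ ∧ (∀ μ ≤ 0, γ μ = ⟨x, y⟩) ∧
    quadProd (γ T) = 0}
  have hSne : S.Nonempty := by
    obtain ⟨γ, T, h1, h2, h3⟩ := h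
    exact ⟨T, h2, γ, h1, h3⟩
  have hSbdd : BddBelow S := ⟨0, fun T hT => hT.1⟩
  obtain ⟨T, ⟨hT, hγ⟩, hTlt⟩ := exists_lt_of_csInf_lt hSne (lt_add_of_pos_right (sInf S) hε)
  have hu : 0 < (x ^ 2 - y ^ 2) / 2 := by nlinarith
  obtain ⟨γ, hγ, h0, hV, hq⟩ : ∃ γ, IsSlow N p c γ ∧ (∀ μ ≤ 0, γ μ = ⟨x, y⟩) ∧
      quadProd (γ T) = 0 ∧
      ∀ μ, 0 ≤ (γ μ).im ∧ (γ μ).im ≤ (γ μ).re ∧ √(x ^ 2 - y ^ 2) ≤ (γ μ).re := by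
    obtain ⟨γ, hγ, h0, hV⟩ := hγ
    refine ⟨_, hγ.comp_lipschitz (lipschitzWith_quadProj hu) (quadProd_quadProj hu),
      fun μ hμ => ?_, ?_, fun μ => ?_⟩
    · rw [h0 μ hμ, quadProj_self hy.le hxy]
    · rw [quadProd_quadProj hu, hV]
    · obtain ⟨h1, h2, h3, -⟩ := quadProj_spec hu (γ μ)
      rw [mul_div_cancel₀ _ two_ne_zero] at h3
      exact ⟨h1, h2, h3⟩
  have hfix : ∀ μ, T ≤ μ → (if μ ≤ T then γ μ else γ T) = γ T := fun μ hμ => by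
    split_ifs with h
    · rw [le_antisymm h hμ]
    · rfl
  refine ⟨fun μ => if μ ≤ T then γ μ else γ T, T, hγ.glue (IsSlow.const hc.le _) rfl,
    fun μ hμ => ?_, fun μ hμ => ?_, fun μ => ?_, fun s hs => ?_,
    fun s t κ hs hst ht hκ hle => ?_⟩
  · simp only [if_pos (hμ.trans hT), h0 μ hμ]
  · dsimp only
    rw [hfix μ hμ, hV]
  · dsimp only; split_ifs
    · exact hq μ
    · exact hq T
  · rcases le_or_gt s T with hsT | hsT
    · simp only [if_pos hsT]
      exact hγ.height_le hN hp hc hs hsT hV (hq s).1 (hq s).2.1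
    · dsimp only
      rw [hfix s hsT.le, hV, zero_pow (by lia), zero_mul]
      have : 0 < p - 1 := by linarith
      positivity
  · simp only [if_pos ht, if_pos (hst.le.trans ht)] at hle ⊢
    by_contra hcon
    push Not at hcon
    set Δ := ‖γ t - γ s‖ with hΔ
    have h1 : Δ / κ < t - s - ε := by rw [div_lt_iff₀ hκ]; linarith
    have h2 : 0 ≤ Δ / κ := by positivity
    obtain ⟨τ, hτ1, hτ2⟩ := exists_between h1
    have hτ0 : 0 < τ := h2.trans_lt hτ1
    obtain ⟨σ, hσ, hσ1, hσ2⟩ := exists_isSlow_segment (N := N) (p := p) hc.le (z := γ s)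
      (w := γ t) (s := s) (τ := τ) (κ := κ) hτ0
      (fun θ hθ ν hν => hle θ hθ ν ⟨hν.1, hν.2.trans (by linarith)⟩)
      (by rw [div_lt_iff₀ hκ] at hτ1; linarith)
    have hd : 0 ≤ t - (s + τ) := by linarith
    have g1 := hγ.glue hσ (m := s) (hσ1 s le_rfl).symm
    have g2 := g1.glue (hγ.shift hN hp hc.le hd) (m := s + τ) (by
      rw [if_neg (by linarith), hσ2]; congr 1; ring)
    have hmem : T - (t - (s + τ)) ∈ S := by
      refine ⟨by linarith, _, g2, fun μ hμ => ?_, ?_⟩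
      · simp only [if_pos (show μ ≤ s + τ by linarith), if_pos (show μ ≤ s by linarith), h0 μ hμ]
      · rcases ht.eq_or_lt with h | h
        · subst h
          rw [if_pos (by linarith), if_neg (by linarith), show t - (t - (s + τ)) = s + τ by ring,
            hσ2, hV]
        · rw [if_neg (by linarith), sub_add_cancel, hV]
    have := csInf_le hSbdd hmem
    linarith

lemma tendsto_rate (hN : 1 ≤ N) (hp : 2 * (N : ℝ) + 1 ≤ p) {ι : Type*} {l : Filter ι}
    {cs v μ : ι → ℝ} {v₀ μ₀ : ℝ} (hc : 0 ≤ c) (hv₀ : 0 ≤ v₀) (hcs : Tendsto cs l (𝓝 c))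
    (hv : Tendsto v l (𝓝 v₀)) (hμ : Tendsto μ l (𝓝 μ₀)) :
    Tendsto (fun i => rate N p (cs i) (v i) (μ i)) l (𝓝 (rate N p c v₀ μ₀)) := by
  have h1 := hv.rpow_const (p := volExp N p) (Or.inr (volExp_pos hN hp).le)
  have h2 := (hμ.max (tendsto_const_nhds (x := (0:ℝ)))).rpow_const (p := p)
    (Or.inr (by linarith [three_le_of_exponent hN hp]))
  exact h1.div ((hcs.mul (((hv.pow N).mul h1).mul h2)).const_add 1)
    (rate_denom_pos hc hv₀ μ₀).ne'

lemma eventually_forall_lt_of_compact {ι X : Type*} [TopologicalSpace X] {U : Ultrafilter ι}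
    {K : Set X} (hK : IsCompact K) (hne : K.Nonempty) {F : ι → X → ℝ} {f : X → ℝ} {κ : ℝ}
    (h : ∀ (u : ι → X) (x : X), (∀ i, u i ∈ K) → Tendsto u U (𝓝 x) →
      Tendsto (fun i => F i (u i)) U (𝓝 (f x)))
    (hlt : ∀ x ∈ K, f x < κ) : ∀ᶠ i in (U : Filter ι), ∀ x ∈ K, F i x < κ := by
  by_contra hcon
  have hcon' := Ultrafilter.eventually_not.2 hcon
  have hex : ∀ i, ∃ x ∈ K, (¬ ∀ x ∈ K, F i x < κ) → κ ≤ F i x := fun i => by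
    by_cases hi : ∀ x ∈ K, F i x < κ
    · obtain ⟨x, hx⟩ := hne
      exact ⟨x, hx, fun h => absurd hi h⟩
    · push Not at hi
      obtain ⟨x, hx, hx'⟩ := hi
      exact ⟨x, hx, fun _ => hx'⟩
  choose u huK hu using hex
  obtain ⟨x, hxK, hx⟩ := hK.ultrafilter_le_nhds (U.map u)
    (le_principal_iff.2 (Filter.mem_map.2 (Eventually.of_forall huK)))
  have hlim := h u x huK hx
  have : κ ≤ f x := ge_of_tendsto hlim (hcon'.mono hu)
  exact absurd (hlt x hxK) (not_lt.2 this)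

/-- A slow path defined for all times that never reaches the boundary and locally realizes the
largest possible speed. -/
structure IsExtremal (N : ℕ) (p c : ℝ) (γ : ℝ → ℂ) : Prop extends IsSlow N p c γ where
  im_nonneg : ∀ μ, 0 ≤ (γ μ).im
  im_le_re : ∀ μ, (γ μ).im ≤ (γ μ).re
  prod_pos : ∀ μ, 0 ≤ μ → 0 < quadProd (γ μ)
  min : ∀ s t κ, 0 ≤ s → s ≤ t →
    (∀ θ ∈ Icc (0:ℝ) 1, ∀ ν ∈ Icc s t, κ ≤ rate N p c (quadProd (γ s + θ * (γ t - γ s))) ν) →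
    κ * (t - s) ≤ ‖γ t - γ s‖

lemma exists_isExtremal (hN : 1 ≤ N) (hp : 2 * (N : ℝ) + 1 ≤ p) {x y : ℝ} (hy : 0 < y)
    (hxy : y < x) (hc : 0 < c) (hnot : ¬ Reaches N p c ⟨x, y⟩)
    (hlt : ∀ c', 0 < c' → c' < c → Reaches N p c' ⟨x, y⟩) :
    ∃ γ, IsExtremal N p c γ ∧ (∀ μ ≤ 0, γ μ = ⟨x, y⟩) ∧ (∀ μ, √(x ^ 2 - y ^ 2) ≤ (γ μ).re) ∧
      ∀ s, 0 < s → quadProd (γ s) ^ N * (γ s).im ≤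
        2 * 4 ^ N / (c * (p - 1)) * s ^ (-(p - 1)) := by
  have hp3 := three_le_of_exponent hN hp
  let ck : ℕ → ℝ := fun k => c * (1 - 1 / ((k : ℝ) + 2))
  have hk0 : ∀ k : ℕ, 0 < 1 - 1 / ((k : ℝ) + 2) := fun k => by
    rw [sub_pos, div_lt_one (by positivity)]; linarith [(Nat.cast_nonneg k : (0:ℝ) ≤ k)]
  have hck0 : ∀ k, 0 < ck k := fun k => mul_pos hc (hk0 k)
  have hckc : ∀ k, ck k < c := fun k => by
    have : 0 < 1 / ((k : ℝ) + 2) := by positivity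
    simp only [ck]; nlinarith
  let U : Ultrafilter ℕ := hyperfilter ℕ
  have hU : (U : Filter ℕ) ≤ atTop := by
    rw [← Nat.cofinite_eq_atTop]; exact hyperfilter_le_cofinite
  have hcklim : Tendsto ck U (𝓝 c) := by
    have h1 : Tendsto (fun k : ℕ => 1 / ((k : ℝ) + 2)) atTop (𝓝 0) := by
      simp only [one_div]
      exact (tendsto_natCast_atTop_atTop.atTop_add
        (tendsto_const_nhds (x := (2:ℝ)))).inv_tendsto_atTop
    have h2 := (h1.const_sub 1).const_mul c
    rw [sub_zero, mul_one] at h2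
    exact h2.mono_left hU
  have hεlim : Tendsto (fun k : ℕ => 1 / ((k : ℝ) + 1)) U (𝓝 0) :=
    tendsto_one_div_add_atTop_nhds_zero_nat.mono_left hU
  have hex := fun k : ℕ => (hlt (ck k) (hck0 k) (hckc k)).exists_almost_optimal hN hp (hck0 k) hy
    hxy (show (0:ℝ) < 1 / ((k : ℝ) + 1) by positivity)
  choose γk Tk hγk h0k hVk hqk hik hmk using hex
  set z₀ : ℂ := ⟨x, y⟩ with hz₀
  have hbound : ∀ k m ν, 0 ≤ m → ν ≤ m → ‖γk k ν‖ ≤ (‖z₀‖ + 1) * Real.exp (3 * m) := by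
    intro k m ν hm hν
    rcases le_total 0 ν with h | h
    · have := (hγk k).norm_le_exp hN hp (hck0 k).le h
      rw [h0k k 0 le_rfl] at this
      refine this.trans (mul_le_mul_of_nonneg_left (Real.exp_le_exp.2 (by linarith))
        (by positivity))
    · rw [h0k k ν h]
      have := Real.one_le_exp (show 0 ≤ 3 * m by linarith)
      nlinarith [norm_nonneg z₀]
  let R : ℝ → ℝ := fun m => 1 + (‖z₀‖ + 1) * Real.exp (3 * m)
  have hLip : ∀ k m s t, 0 ≤ m → s ≤ t → t ≤ m → ‖γk k t - γk k s‖ ≤ R m * (t - s) :=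
    fun k m s t hm hst ht => (hγk k).le s t _ hst fun ν hν =>
      (rate_le_rpow (hck0 k).le (quadProd_nonneg _) _).trans ((rpow_volExp_le hN hp _).trans
        (by have := hbound k m ν hm (hν.2.trans ht); simp only [R]; linarith))
  have hLip' : ∀ k m s t, 0 ≤ m → s ≤ m → t ≤ m → ‖γk k t - γk k s‖ ≤ R m * |t - s| := by
    intro k m s t hm hs ht
    rcases le_total s t with h | h
    · rw [abs_of_nonneg (sub_nonneg.2 h)]; exact hLip k m s t hm h ht
    · rw [norm_sub_rev, abs_of_nonpos (sub_nonpos.2 h), neg_sub]; exact hLip k m t s hm h hs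
  have hlimex : ∀ μ, ∃ z, Tendsto (fun k => γk k μ) U (𝓝 z) := fun μ => by
    obtain ⟨z, -, hz⟩ := (isCompact_closedBall (0:ℂ)
      ((‖z₀‖ + 1) * Real.exp (3 * max μ 0))).ultrafilter_le_nhds (U.map fun k => γk k μ)
      (le_principal_iff.2 (Filter.mem_map.2 (Eventually.of_forall fun k => by
        simpa using hbound k (max μ 0) μ (le_max_right _ _) (le_max_left _ _))))
    exact ⟨z, hz⟩
  choose γ hγ using hlimex
  have hγLip : ∀ m s t, 0 ≤ m → s ≤ m → t ≤ m → ‖γ t - γ s‖ ≤ R m * |t - s| :=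
    fun m s t hm hs ht => le_of_tendsto ((hγ t).sub (hγ s)).norm
      (Eventually.of_forall fun k => hLip' k m s t hm hs ht)
  have hmov : ∀ (u : ℕ → ℝ) (x m : ℝ), 0 ≤ m → (∀ k, u k ≤ m) → x ≤ m → Tendsto u U (𝓝 x) →
      Tendsto (fun k => γk k (u k)) U (𝓝 (γ x)) := by
    intro u x m hm hu hx hux
    have h1 : Tendsto (fun k => γk k (u k) - γk k x) U (𝓝 0) := by
      refine squeeze_zero_norm (fun k => hLip' k m x (u k) hm hx (hu k)) ?_
      have := ((hux.sub_const x).abs).const_mul (R m)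
      simpa using this
    simpa using h1.add (hγ x)
  have hcont : Continuous γ := by
    refine continuous_iff_continuousAt.2 fun x => ?_
    rw [ContinuousAt, tendsto_iff_norm_sub_tendsto_zero]
    have h1 : Tendsto (fun t => R (|x| + 1) * |t - x|) (𝓝 x) (𝓝 0) := by
      have : Continuous fun t => R (|x| + 1) * |t - x| := by fun_prop
      simpa using this.tendsto x
    refine squeeze_zero' (Eventually.of_forall fun _ => norm_nonneg _) ?_ h1
    filter_upwards [eventually_lt_nhds (show x < |x| + 1 by linarith [le_abs_self x])] with t ht
    exact hγLip _ _ _ (by positivity) (by linarith [le_abs_self x]) ht.le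
  have hslow : IsSlow N p c γ := ⟨hcont, fun s t κ hst hκ => by
    refine le_of_forall_gt_imp_ge_of_dense fun B hB => ?_
    obtain ⟨κ', hκ1, hκ2⟩ : ∃ κ', κ < κ' ∧ κ' * (t - s) < B := by
      have : Tendsto (fun κ' : ℝ => κ' * (t - s)) (𝓝[>] κ) (𝓝 (κ * (t - s))) :=
        ((continuous_id.mul continuous_const).tendsto κ).mono_left nhdsWithin_le_nhds
      obtain ⟨κ', h1, h2⟩ := ((this.eventually_lt_const hB).and self_mem_nhdsWithin).exists
      exact ⟨κ', h2, h1⟩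
    refine le_trans ?_ hκ2.le
    have hev := eventually_forall_lt_of_compact (U := U) (isCompact_Icc (a := s) (b := t))
      ⟨s, le_rfl, hst⟩ (F := fun k ν => rate N p (ck k) (quadProd (γk k ν)) ν)
      (f := fun ν => rate N p c (quadProd (γ ν)) ν) (κ := κ')
      (fun u ν hu hlim => tendsto_rate hN hp hc.le (quadProd_nonneg _) hcklim
        ((continuous_quadProd.tendsto _).comp (hmov u ν (max t 0) (le_max_right _ _)
          (fun k => (hu k).2.trans (le_max_left _ _))
          ((le_of_tendsto hlim (Eventually.of_forall fun k => (hu k).2)).trans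
            (le_max_left _ _)) hlim)) hlim)
      (fun ν hν => (hκ ν hν).trans_lt hκ1)
    refine le_of_tendsto ((hγ t).sub (hγ s)).norm (hev.mono fun k hk => ?_)
    exact (hγk k).le s t κ' hst fun ν hν => (hk ν hν).le⟩
  have h0 : ∀ μ ≤ 0, γ μ = z₀ := fun μ hμ =>
    tendsto_nhds_unique (hγ μ) (by simp only [fun k => h0k k μ hμ]; exact tendsto_const_nhds)
  have hre : ∀ μ, Tendsto (fun k => (γk k μ).re) U (𝓝 (γ μ).re) := fun μ =>
    (Complex.continuous_re.tendsto _).comp (hγ μ)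
  have him : ∀ μ, Tendsto (fun k => (γk k μ).im) U (𝓝 (γ μ).im) := fun μ =>
    (Complex.continuous_im.tendsto _).comp (hγ μ)
  have hVlim : ∀ μ, Tendsto (fun k => quadProd (γk k μ)) U (𝓝 (quadProd (γ μ))) := fun μ =>
    (continuous_quadProd.tendsto _).comp (hγ μ)
  have hpos : ∀ μ, 0 ≤ μ → 0 < quadProd (γ μ) := fun μ hμ =>
    lt_of_le_of_ne (quadProd_nonneg _) fun h => hnot ⟨γ, μ, hslow, hμ, h0, h.symm⟩
  refine ⟨γ, ⟨hslow, fun μ => ?_, fun μ => ?_, hpos, fun s t κ hs hst hκ => ?_⟩, h0, fun μ => ?_,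
    fun s hs => ?_⟩
  · exact ge_of_tendsto (him μ) (Eventually.of_forall fun k => (hqk k μ).1)
  · exact le_of_tendsto_of_tendsto (him μ) (hre μ) (Eventually.of_forall fun k => (hqk k μ).2.1)
  · rcases hst.eq_or_lt with rfl | hst'
    · simp
    refine le_of_forall_lt_imp_le_of_dense fun B hB => ?_
    rcases le_or_gt B 0 with hB0 | hB0
    · exact hB0.trans (norm_nonneg _)
    have hts : 0 < t - s := sub_pos.2 hst'
    have hTk : ∀ᶠ k in (U : Filter ℕ), t ≤ Tk k := by
      by_contra hcon
      have hcon' := Ultrafilter.eventually_not.2 hcon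
      have : quadProd (γ t) = 0 := tendsto_nhds_unique (hVlim t)
        ((tendsto_const_nhds (x := (0:ℝ))).congr' (hcon'.mono fun k hk =>
          (hVk k t (not_le.1 hk).le).symm))
      exact (hpos t (hs.trans hst)).ne' this
    have hκ' : B / (t - s) < κ := by rwa [div_lt_iff₀ hts]
    have hev := eventually_forall_lt_of_compact (U := U)
      ((isCompact_Icc (a := (0:ℝ)) (b := 1)).prod (isCompact_Icc (a := s) (b := t)))
      ⟨(0, s), ⟨le_rfl, zero_le_one⟩, le_rfl, hst⟩
      (F := fun k w => -rate N p (ck k) (quadProd (γk k s + w.1 * (γk k t - γk k s))) w.2)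
      (f := fun w => -rate N p c (quadProd (γ s + w.1 * (γ t - γ s))) w.2) (κ := -(B / (t - s)))
      (fun u w hu hlim => by
        have hl1 : Tendsto (fun k => (u k).1) U (𝓝 w.1) := (continuous_fst.tendsto _).comp hlim
        have hl2 : Tendsto (fun k => (u k).2) U (𝓝 w.2) := (continuous_snd.tendsto _).comp hlim
        have hl3 : Tendsto (fun k => (((u k).1 : ℝ) : ℂ)) U (𝓝 (w.1 : ℂ)) :=
          (Complex.continuous_ofReal.tendsto _).comp hl1
        exact (tendsto_rate hN hp hc.le (quadProd_nonneg _) hcklim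
          ((continuous_quadProd.tendsto _).comp
            ((hγ s).add (hl3.mul ((hγ t).sub (hγ s))))) hl2).neg)
      (fun w hw => neg_lt_neg (hκ'.trans_le (hκ w.1 hw.1 w.2 hw.2)))
    have hlim1 : Tendsto (fun k : ℕ => B / (t - s) * (t - s - 1 / ((k : ℝ) + 1))) U
        (𝓝 (B / (t - s) * (t - s - 0))) := (hεlim.const_sub _).const_mul _
    rw [sub_zero, div_mul_cancel₀ _ hts.ne'] at hlim1
    refine le_of_tendsto_of_tendsto hlim1 ((hγ t).sub (hγ s)).norm ?_
    filter_upwards [hTk, hev] with k hk1 hk2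
    exact hmk k s t _ hs hst' hk1 (by positivity) fun θ hθ ν hν =>
      (neg_lt_neg_iff.1 (hk2 (θ, ν) ⟨hθ, hν⟩)).le
  · exact ge_of_tendsto (hre μ) (Eventually.of_forall fun k => (hqk k μ).2.2)
  · refine le_of_tendsto_of_tendsto (((hVlim s).pow N).mul (him s))
      (Tendsto.mul_const _ ((tendsto_const_nhds.div (hcklim.mul_const _) ?_)))
      (Eventually.of_forall fun k => hik k s hs)
    have : 0 < p - 1 := by linarith
    positivity

end

/-- An extremal trajectory that stays right of `X₀` and whose height is asymptotically governed by
the clock `μ` from above and, with the sharp constant, from below. -/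
structure IsCritical (N : ℕ) (p c X₀ C : ℝ) (γ : ℝ → ℂ) : Prop extends IsExtremal N p c γ where
  base : ∀ μ ≤ 0, γ μ = γ 0
  X₀_pos : 0 < X₀
  le_re : ∀ μ, X₀ ≤ (γ μ).re
  upper : ∀ s, 0 < s → quadProd (γ s) ^ N * (γ s).im ≤ C * s ^ (-(p - 1))
  lower : ∀ η, 0 < η → ∀ᶠ μ in atTop, μ ^ (-(p - 1)) ≤
    (1 + η) * (c * (p - 1) / (N + 1)) * (quadProd (γ μ) ^ N * (γ μ).im)

section Lower

variable {N : ℕ} {p c : ℝ} {γ : ℝ → ℂ}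

lemma IsExtremal.im_pos (hγ : IsExtremal N p c γ) {μ : ℝ} (hμ : 0 ≤ μ) : 0 < (γ μ).im := by
  refine (hγ.im_nonneg μ).lt_of_ne fun h => ?_
  have := hγ.prod_pos μ hμ
  rw [quadProd, ← h] at this
  simp at this

lemma IsExtremal.quadProd_eq (hγ : IsExtremal N p c γ) (μ : ℝ) :
    quadProd (γ μ) = (γ μ).re * (γ μ).im :=
  quadProd_of_nonneg ((hγ.im_nonneg μ).trans (hγ.im_le_re μ)) (hγ.im_nonneg μ)

lemma IsExtremal.im_pow_le (hγ : IsExtremal N p c γ) {X₀ C μ : ℝ} (hX₀ : 0 < X₀)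
    (hX : X₀ ≤ (γ μ).re)
    (h : quadProd (γ μ) ^ N * (γ μ).im ≤ C * μ ^ (-(p - 1))) :
    (γ μ).im ^ (N + 1) ≤ C / X₀ ^ N * μ ^ (-(p - 1)) := by
  rw [hγ.quadProd_eq, mul_pow] at h
  have h1 : X₀ ^ N * (γ μ).im ^ (N + 1) ≤ C * μ ^ (-(p - 1)) := by
    refine le_trans ?_ h
    rw [mul_assoc, ← pow_succ]
    exact mul_le_mul_of_nonneg_right (pow_le_pow_left₀ hX₀.le hX N)
      (pow_nonneg (hγ.im_nonneg μ) _)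
  rw [div_mul_eq_mul_div, le_div_iff₀ (by positivity)]
  linarith

/-- If the clock were below the threshold, the trajectory could be continued straight down to the
axis in finite clock time. -/
lemma reaches_of_low_clock (hN : 1 ≤ N) (hp : 2 * (N : ℝ) + 1 ≤ p) (hc : 0 < c)
    (hγ : IsSlow N p c γ) (h0 : ∀ μ ≤ 0, γ μ = γ 0) {μ η X₀ : ℝ} (hη : 0 < η) (hX₀ : 0 < X₀)
    (hX : X₀ ≤ (γ μ).re) (hy : 0 < (γ μ).im) (hy1 : (γ μ).im ≤ 1) (hμ : 0 < μ)
    (hμ1 : (p - 1) * (X₀ ^ volExp N p)⁻¹ * ((1 + η / 2) / (N + 1)) * μ⁻¹ ≤ η / 2)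
    (hμ2 : (p - 1) * (X₀ ^ volExp N p)⁻¹ * 2 * μ⁻¹ ≤ 1 / 2)
    (hlt : (1 + η) * (c * (p - 1) / (N + 1)) * ((γ μ).re ^ N * (γ μ).im ^ (N + 1)) <
      μ ^ (-(p - 1))) : Reaches N p c (γ 0) := by
  have hp3 := three_le_of_exponent hN hp
  have ha := volExp_pos hN hp
  have ha2 := volExp_le_half hN hp
  set a := volExp N p with had
  set x := (γ μ).re with hxd
  set y₁ := (γ μ).im with hyd
  have hx : 0 < x := hX₀.trans_le hX
  have hp1 : 0 < p - 1 := by linarith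
  set A := (1 + η / 2) * (c * (p - 1) / (N + 1)) * x ^ N with hA
  have hA0 : 0 < A := by positivity
  have hAlt : A * y₁ ^ (N + 1) < μ ^ (-(p - 1)) := by
    refine lt_of_le_of_lt ?_ hlt
    rw [hA, mul_assoc]
    gcongr
    linarith
  have hden : 0 < 1 + y₁ ^ (1 - a) := by positivity
  set ε := (μ ^ (-(p - 1)) - A * y₁ ^ (N + 1)) / (1 + y₁ ^ (1 - a)) with hε
  have hε0 : 0 < ε := div_pos (by linarith) hden
  have hQ1 : A * y₁ ^ (N + 1) + ε * (1 + y₁ ^ (1 - a)) = μ ^ (-(p - 1)) := by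
    rw [hε, div_mul_cancel₀ _ hden.ne']; ring
  obtain ⟨σ, T, hσ, hσ1, hσ2⟩ := exists_isSlow_descent hN hp hc.le hx hy hA0.le hε0
    (fun y hy' => by
      have hy0 := hy'.1
      rw [← had]
      set Q := A * y ^ (N + 1) + ε * (1 + y ^ (1 - a)) with hQ
      have hya1 : y ^ (1 - a) ≤ 1 :=
        Real.rpow_le_one hy0.le (hy'.2.trans hy1) (by linarith)
      have hyy : y ^ (1 - a) ≤ y₁ ^ (1 - a) :=
        Real.rpow_le_rpow hy0.le hy'.2 (by linarith)
      have hQ0 : 0 < Q := by positivity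
      have hQle : Q ≤ μ ^ (-(p - 1)) := by
        rw [← hQ1, hQ]
        have := hy'.2
        gcongr
      have hQb : Q ^ (1 / (p - 1)) ≤ μ⁻¹ := by
        refine (Real.rpow_le_rpow hQ0.le hQle (by positivity)).trans_eq ?_
        rw [← Real.rpow_mul hμ.le, ← Real.rpow_neg_one]
        congr 1
        field_simp
      have hsplit : A * y ^ (N + 1) = A * (y ^ N * y ^ a) * y ^ (1 - a) := by
        have : y ^ a * y ^ (1 - a) = y := by
          rw [← Real.rpow_add hy0, add_sub_cancel, Real.rpow_one]
        calc A * y ^ (N + 1) = A * y ^ N * y := by ring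
          _ = A * y ^ N * (y ^ a * y ^ (1 - a)) := by rw [this]
          _ = _ := by ring
      have hya := Real.rpow_pos_of_pos hy0 a
      have hQle2 : Q ≤ A * (y ^ N * y ^ a) + ε * 2 := by
        rw [hQ, hsplit]
        have h1 : A * (y ^ N * y ^ a) * y ^ (1 - a) ≤ A * (y ^ N * y ^ a) * 1 := by gcongr
        have h2 : ε * (1 + y ^ (1 - a)) ≤ ε * 2 := by gcongr; linarith
        linarith
      have hxa : (x ^ a)⁻¹ ≤ (X₀ ^ a)⁻¹ := by gcongr
      have hxa0 : 0 < X₀ ^ a := Real.rpow_pos_of_pos hX₀ a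
      rw [Real.rpow_add hQ0, Real.rpow_one]
      calc (p - 1) * (x ^ a)⁻¹ * (Q * Q ^ (1 / (p - 1)))
          ≤ (p - 1) * (X₀ ^ a)⁻¹ * ((A * (y ^ N * y ^ a) + ε * 2) * μ⁻¹) := by gcongr
        _ = ((p - 1) * (X₀ ^ a)⁻¹ * ((1 + η / 2) / (N + 1)) * μ⁻¹) *
              (c * (p - 1) * x ^ N * (y ^ N * y ^ a)) +
              ε * ((p - 1) * (X₀ ^ a)⁻¹ * 2 * μ⁻¹) := by rw [hA]; field_simp
        _ ≤ η / 2 * (c * (p - 1) * x ^ N * (y ^ N * y ^ a)) + ε * (1 / 2) := by gcongr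
        _ ≤ η / 2 * (c * (p - 1) * x ^ N * (y ^ N * y ^ a)) + ε * (1 - a) := by
            gcongr; linarith
        _ = _ := by rw [hA]; field_simp; ring)
  rw [← had, hQ1, ← Real.rpow_mul hμ.le] at hσ1
  have hex : -(p - 1) * -(1 / (p - 1)) = 1 := by field_simp
  rw [hex, Real.rpow_one] at hσ1
  have hglue : γ μ = σ μ := by
    rw [hσ1 μ le_rfl]
  have hT : μ < T := by
    by_contra h
    have h1 := hσ1 T (not_lt.1 h)
    rw [hσ2] at h1
    exact hy.ne (Complex.ext_iff.1 h1).2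
  refine ⟨_, T, hγ.glue hσ hglue, (hμ.trans hT).le, fun ν hν => ?_, ?_⟩
  · simp only [if_pos (hν.trans hμ.le), h0 ν hν]
  · simp only [if_neg (not_le.2 hT), hσ2]
    simp [quadProd]

lemma tendsto_mul_rpow_neg {e : ℝ} (he : 0 < e) (K : ℝ) :
    Tendsto (fun μ : ℝ => K * μ ^ (-e)) atTop (𝓝 0) := by
  simpa using (tendsto_rpow_neg_atTop he).const_mul K

lemma IsExtremal.isCritical (hγ : IsExtremal N p c γ) (hN : 1 ≤ N) (hp : 2 * (N : ℝ) + 1 ≤ p)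
    (hc : 0 < c) (hnot : ¬ Reaches N p c (γ 0)) (h0 : ∀ μ ≤ 0, γ μ = γ 0) {X₀ C : ℝ}
    (hX₀ : 0 < X₀) (hX : ∀ μ, X₀ ≤ (γ μ).re)
    (hup : ∀ s, 0 < s → quadProd (γ s) ^ N * (γ s).im ≤ C * s ^ (-(p - 1))) :
    IsCritical N p c X₀ C γ := by
  refine ⟨hγ, h0, hX₀, hX, hup, fun η hη => ?_⟩
  have hp3 := three_le_of_exponent hN hp
  have hinv : ∀ K : ℝ, Tendsto (fun μ : ℝ => K * μ⁻¹) atTop (𝓝 0) := fun K => by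
    simpa using tendsto_inv_atTop_zero.const_mul K
  have e1 := (tendsto_mul_rpow_neg (show 0 < p - 1 by linarith) (C / X₀ ^ N)).eventually
    (ge_mem_nhds one_pos)
  filter_upwards [e1, (hinv _).eventually (ge_mem_nhds (half_pos hη)),
    (hinv _).eventually (ge_mem_nhds (show (0:ℝ) < 1 / 2 by norm_num)), eventually_gt_atTop 0]
    with μ h1 h2 h3 hμ
  by_contra hcon
  push Not at hcon
  have him := hγ.im_pos hμ.le
  refine hnot (reaches_of_low_clock hN hp hc hγ.toIsSlow h0 hη hX₀ (hX μ) him ?_ hμ h2 h3 ?_)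
  · have := (hγ.im_pow_le hX₀ (hX μ) (hup μ hμ)).trans h1
    by_contra hgt
    exact absurd this (not_le.2 (one_lt_pow₀ (not_le.1 hgt) (by lia)))
  · rw [hγ.quadProd_eq, mul_pow, mul_assoc (_ ^ N), ← pow_succ] at hcon
    exact hcon

end Lower

section Decay

variable {N : ℕ} {p c : ℝ} {γ : ℝ → ℂ}

/-- The speed allowed at clock time `μ` along the trajectory `γ`. -/
def speed (N : ℕ) (p c : ℝ) (γ : ℝ → ℂ) (μ : ℝ) : ℝ := rate N p c (quadProd (γ μ)) μ

lemma IsSlow.continuous_speed (hγ : IsSlow N p c γ) (hN : 1 ≤ N) (hp : 2 * (N : ℝ) + 1 ≤ p)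
    (hc : 0 ≤ c) : Continuous (speed N p c γ) :=
  continuous_rate hN hp hc (continuous_quadProd.comp hγ.cont) continuous_id
    fun _ => quadProd_nonneg _

lemma IsExtremal.speed_pos (hγ : IsExtremal N p c γ) (hc : 0 ≤ c) {μ : ℝ} (hμ : 0 ≤ μ) :
    0 < speed N p c γ μ := rate_pos hc (hγ.prod_pos μ hμ) μ

/-- Quantitative decay of a trajectory along the clock. -/
structure HasDecay (N : ℕ) (p c K : ℝ) (γ : ℝ → ℂ) : Prop where
  one_le : 1 ≤ K
  speed_le : ∀ s, 0 ≤ s → speed N p c γ s * (1 + s) ≤ K * (γ s).im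
  im_le : ∀ s, 0 ≤ s → (γ s).im ≤ K * (speed N p c γ s * (1 + s))
  speed_le_rpow : ∀ s, 0 ≤ s → speed N p c γ s ≤ K * (1 + s) ^ (-((p - 1) / (N + 1)) - 1)
  clock_le : ∀ s, 0 ≤ s → speed N p c γ s * (c * quadProd (γ s) ^ N * (1 + s) ^ p) ≤ K

lemma bddAbove_of_eventually_le {f : ℝ → ℝ} (hf : ContinuousOn f (Ici 0)) {K : ℝ}
    (h : ∀ᶠ s in atTop, f s ≤ K) : ∃ K', ∀ s, 0 ≤ s → f s ≤ K' := by
  obtain ⟨s₀, hs₀⟩ := eventually_atTop.1 h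
  obtain ⟨K₁, hK₁⟩ := isCompact_Icc.bddAbove_image (hf.mono (Icc_subset_Ici_self : Icc 0 s₀ ⊆ _))
  refine ⟨max K K₁, fun s hs => ?_⟩
  rcases le_total s₀ s with h | h
  · exact (hs₀ s h).trans (le_max_left _ _)
  · exact (hK₁ (mem_image_of_mem f ⟨hs, h⟩)).trans (le_max_right _ _)

lemma IsCritical.exists_hasDecay {X₀ C : ℝ} (hγ : IsCritical N p c X₀ C γ) (hN : 1 ≤ N)
    (hp : 2 * (N : ℝ) + 1 ≤ p) (hc : 0 < c) : ∃ K, HasDecay N p c K γ := by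
  have hp3 := three_le_of_exponent hN hp
  have hp1 : 0 < p - 1 := by linarith
  have ha := volExp_pos hN hp
  have ha2 := volExp_le_half hN hp
  have hX₀ := hγ.X₀_pos
  have hψc := hγ.continuous_speed hN hp hc.le
  have him : Continuous fun s => (γ s).im := Complex.continuous_im.comp hγ.cont
  have hy : ∀ s, 0 ≤ s → 0 < (γ s).im := fun s hs => hγ.im_pos hs
  have hψ : ∀ s, 0 ≤ s → 0 < speed N p c γ s := fun s hs => hγ.speed_pos hc.le hs
  set e := (p - 1) / ((N : ℝ) + 1) with he
  have he0 : 0 < e := by positivity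
  -- the speed is controlled by the height
  have b1 : ∀ᶠ s in atTop, speed N p c γ s ≤ 2 * (p - 1) / (N + 1) * ((γ s).im * s⁻¹) := by
    filter_upwards [hγ.lower 1 one_pos, eventually_gt_atTop 0] with s h hs
    have hV := hγ.prod_pos s hs.le
    refine (rate_le_inv hc hV hs).trans ?_
    rw [inv_le_iff_one_le_mul₀ (by positivity)]
    have h1 : s ^ p = s ^ (p - 1) * s := by
      rw [← Real.rpow_add_one hs.ne']; ring_nf
    have h2 : 0 < s ^ (p - 1) := Real.rpow_pos_of_pos hs _
    rw [Real.rpow_neg hs.le, inv_le_iff_one_le_mul₀ h2] at h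
    refine h.trans_eq ?_
    rw [h1]
    field_simp
    ring
  have b2 : ∀ᶠ s in atTop, (γ s).im ≤ (max (C / X₀ ^ N) 1) ^ (1 / ((N : ℝ) + 1)) * s ^ (-e) := by
    filter_upwards [eventually_gt_atTop 0] with s hs
    have h1 := hγ.im_pow_le hX₀ (hγ.le_re s) (hγ.upper s hs)
    have hs1 : 0 < s ^ (-(p - 1)) := Real.rpow_pos_of_pos hs _
    have h2 : (γ s).im ^ (N + 1) ≤ max (C / X₀ ^ N) 1 * s ^ (-(p - 1)) :=
      h1.trans (mul_le_mul_of_nonneg_right (le_max_left _ _) hs1.le)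
    have h3 : ((γ s).im ^ (N + 1)) ^ (1 / ((N : ℝ) + 1)) = (γ s).im := by
      rw [one_div]
      have := Real.pow_rpow_inv_natCast (hy s hs.le).le (Nat.succ_ne_zero N)
      push_cast at this
      exact this
    rw [← h3]
    have h4 : (s ^ (-(p - 1))) ^ (1 / ((N : ℝ) + 1)) = s ^ (-e) := by
      rw [← Real.rpow_mul hs.le]; congr 1; rw [he]; field_simp
    rw [← h4, ← Real.mul_rpow (by positivity) hs1.le]
    exact Real.rpow_le_rpow (pow_nonneg (hy s hs.le).le _) h2 (by positivity)
  set K₁ := (max (C / X₀ ^ N) 1) ^ (1 / ((N : ℝ) + 1)) with hK₁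
  have hK₁0 : 0 ≤ K₁ := by positivity
  have b3 : ∀ᶠ s in atTop, speed N p c γ s ≤ 2 * (p - 1) / (N + 1) * K₁ * s ^ (-e - 1) := by
    filter_upwards [b1, b2, eventually_gt_atTop 0] with s h1 h2 hs
    refine h1.trans ?_
    rw [Real.rpow_sub_one hs.ne', div_eq_mul_inv (s ^ (-e)), mul_assoc _ K₁, ← mul_assoc K₁]
    gcongr
  -- uniform bounds
  obtain ⟨k1, hk1⟩ := bddAbove_of_eventually_le
    (f := fun s => speed N p c γ s * (1 + s) / (γ s).im)
    ((by fun_prop : Continuous fun s => speed N p c γ s * (1 + s)).continuousOn.div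
      him.continuousOn fun s hs => (hy s hs).ne') (K := 2 * (p - 1) / (N + 1) * 2) (by
      filter_upwards [b1, eventually_ge_atTop 1] with s h1 hs
      have hs0 : 0 < s := by linarith
      have hyp := hy s hs0.le
      rw [div_le_iff₀ hyp]
      calc speed N p c γ s * (1 + s)
          ≤ (2 * (p - 1) / (N + 1) * ((γ s).im * s⁻¹)) * (2 * s) := by
            gcongr; linarith
        _ = _ := by field_simp)
  obtain ⟨k3, hk3⟩ := bddAbove_of_eventually_le
    (f := fun s => speed N p c γ s / (1 + s) ^ (-e - 1))
    (hψc.continuousOn.div (ContinuousOn.rpow_const (by fun_prop)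
      fun s hs => Or.inl (by linarith [mem_Ici.1 hs] : (0:ℝ) < 1 + s).ne') fun s hs =>
      (Real.rpow_pos_of_pos (by linarith [mem_Ici.1 hs] : (0:ℝ) < 1 + s) _).ne')
    (K := 2 * (p - 1) / (N + 1) * K₁ * 2 ^ (e + 1)) (by
      filter_upwards [b3, eventually_ge_atTop 1] with s h1 hs
      have hs0 : 0 < s := by linarith
      rw [div_le_iff₀ (Real.rpow_pos_of_pos (by linarith) _), mul_assoc]
      refine h1.trans (mul_le_mul_of_nonneg_left ?_ (by positivity))
      have h2 : s ^ (-e - 1) = 2 ^ (e + 1) * (2 * s) ^ (-e - 1) := by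
        rw [Real.mul_rpow (by norm_num) hs0.le, ← mul_assoc,
          ← Real.rpow_add (by norm_num : (0:ℝ) < 2)]
        simp
      rw [h2]
      refine mul_le_mul_of_nonneg_left ?_ (by positivity)
      exact Real.rpow_le_rpow_of_nonpos (by linarith) (by linarith) (by linarith))
  obtain ⟨k4, hk4⟩ := bddAbove_of_eventually_le
    (f := fun s => speed N p c γ s * (c * quadProd (γ s) ^ N * (1 + s) ^ p))
    (by
      have hq : Continuous fun s => quadProd (γ s) := continuous_quadProd.comp hγ.cont
      have : ContinuousOn (fun s : ℝ => (1 + s) ^ p) (Ici 0) :=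
        ContinuousOn.rpow_const (by fun_prop)
          fun s hs => Or.inl (by linarith [mem_Ici.1 hs] : (0:ℝ) < 1 + s).ne'
      exact hψc.continuousOn.mul (((hq.pow N).const_mul c).continuousOn.mul this))
    (K := 2 ^ p) (by
      filter_upwards [eventually_ge_atTop 1] with s hs
      have hs0 : 0 < s := by linarith
      have hV := hγ.prod_pos s hs0.le
      have h1 := rate_le_inv (N := N) (p := p) hc hV hs0
      calc speed N p c γ s * (c * quadProd (γ s) ^ N * (1 + s) ^ p)
          ≤ (c * quadProd (γ s) ^ N * s ^ p)⁻¹ * (c * quadProd (γ s) ^ N * (2 * s) ^ p) := by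
            have := hψ s hs0.le
            refine mul_le_mul h1 ?_ (by positivity) (by positivity)
            gcongr; linarith
        _ = 2 ^ p := by
            rw [Real.mul_rpow (by norm_num) hs0.le]
            have := Real.rpow_pos_of_pos hs0 p
            field_simp)
  obtain ⟨k2, hk2⟩ := bddAbove_of_eventually_le
    (f := fun s => (γ s).im / (speed N p c γ s * (1 + s)))
    (him.continuousOn.div (by fun_prop) fun s hs =>
      (mul_pos (hψ s hs) (by linarith [mem_Ici.1 hs])).ne') (K := X₀ ^ (-volExp N p) + c * C) (by
      filter_upwards [b2, (tendsto_mul_rpow_neg he0 K₁).eventually (ge_mem_nhds one_pos),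
        eventually_ge_atTop 1] with s h1 h2 hs
      have hs0 : 0 < s := by linarith
      have hyp := hy s hs0.le
      have hV := hγ.prod_pos s hs0.le
      rw [← div_div, div_le_iff₀ (by linarith), div_eq_mul_inv, speed, inv_rate hc.le hV hs0.le,
        mul_add]
      have hs1 : 0 < s ^ (-(p - 1)) := Real.rpow_pos_of_pos hs0 _
      have h3 := hγ.upper s hs0
      have h4 : s ^ p * s ^ (-(p - 1)) = s := by
        rw [← Real.rpow_add hs0]; ring_nf; exact Real.rpow_one s
      have hsp : 0 < s ^ p := Real.rpow_pos_of_pos hs0 _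
      have h5 : (γ s).im * (c * quadProd (γ s) ^ N * s ^ p) ≤ c * C * s := by
        calc _ = c * s ^ p * (quadProd (γ s) ^ N * (γ s).im) := by ring
          _ ≤ c * s ^ p * (C * s ^ (-(p - 1))) := by gcongr
          _ = c * C * (s ^ p * s ^ (-(p - 1))) := by ring
          _ = _ := by rw [h4]
      have h6 : (γ s).im * (quadProd (γ s) ^ volExp N p)⁻¹ ≤ X₀ ^ (-volExp N p) := by
        have hxa := Real.rpow_pos_of_pos hX₀ (volExp N p)
        have hya := Real.rpow_pos_of_pos hyp (volExp N p)
        have hge : X₀ ^ volExp N p * (γ s).im ≤ quadProd (γ s) ^ volExp N p := by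
          rw [hγ.quadProd_eq, Real.mul_rpow (hX₀.le.trans (hγ.le_re s)) hyp.le]
          refine mul_le_mul (Real.rpow_le_rpow hX₀.le (hγ.le_re s) ha.le) ?_ hyp.le (by
            have := hX₀.le.trans (hγ.le_re s); positivity)
          have := Real.rpow_le_rpow_of_exponent_ge hyp (h1.trans h2)
            (show volExp N p ≤ 1 by linarith)
          rwa [Real.rpow_one] at this
        rw [Real.rpow_neg hX₀.le, ← div_eq_mul_inv, div_le_iff₀ (Real.rpow_pos_of_pos hV _),
          inv_mul_eq_div, le_div_iff₀ hxa]
        linarith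
      have hC0 : 0 ≤ c * C * s := le_trans (by positivity) h5
      have h7 : 0 < X₀ ^ (-volExp N p) := Real.rpow_pos_of_pos hX₀ _
      have h8 : 0 ≤ c * C := nonneg_of_mul_nonneg_left hC0 hs0
      nlinarith)
  have hall : ∀ k ∈ ({k1, k2, k3, k4} : Set ℝ), k ≤ max 1 (|k1| + |k2| + |k3| + |k4|) := by
    intro k hk
    refine le_trans ?_ (le_max_right _ _)
    have := abs_nonneg k1
    have := abs_nonneg k2
    have := abs_nonneg k3
    have := abs_nonneg k4
    rcases hk with rfl | rfl | rfl | rfl <;> linarith [le_abs_self k]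
  refine ⟨max 1 (|k1| + |k2| + |k3| + |k4|), le_max_left _ _, fun s hs => ?_, fun s hs => ?_,
    fun s hs => ?_, fun s hs => ?_⟩
  · exact (div_le_iff₀ (hy s hs)).1 ((hk1 s hs).trans (hall _ (by simp)))
  · exact (div_le_iff₀ (mul_pos (hψ s hs) (by linarith))).1 ((hk2 s hs).trans (hall _ (by simp)))
  · exact (div_le_iff₀ (Real.rpow_pos_of_pos (by linarith) _)).1
      ((hk3 s hs).trans (hall _ (by simp)))
  · exact (hk4 s hs).trans (hall _ (by simp))

end Decay

section Compare

variable {N : ℕ} {p c : ℝ}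

lemma rpow_sub_rpow_le {p s ν : ℝ} (hp : 1 ≤ p) (hs : 0 ≤ s) (hsν : s ≤ ν) :
    ν ^ p - s ^ p ≤ p * (ν - s) * ν ^ (p - 1) := by
  rcases (hs.trans hsν).eq_or_lt with h0 | hν
  · obtain rfl : s = ν := le_antisymm hsν (h0 ▸ hs)
    simp
  have h := one_add_mul_self_le_rpow_one_add (s := (s - ν) / ν) (p := p) (by
    rw [le_div_iff₀ hν]; linarith) hp
  have h1 : 1 + (s - ν) / ν = s / ν := by field_simp; ring
  have hνp := Real.rpow_pos_of_pos hν p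
  rw [h1, Real.div_rpow hs hν.le, le_div_iff₀ hνp] at h
  rw [Real.rpow_sub_one hν.ne']
  have : (1 + p * ((s - ν) / ν)) * ν ^ p = ν ^ p - p * (ν - s) * (ν ^ p / ν) := by
    field_simp; ring
  linarith

lemma one_add_pow_le {δ : ℝ} (h0 : 0 ≤ δ) (h1 : δ ≤ 1) (N : ℕ) :
    (1 + δ) ^ N ≤ 1 + (2 ^ N - 1) * δ := by
  induction N with
  | zero => simp
  | succ k ih =>
    have h2 : (1:ℝ) ≤ 2 ^ k := one_le_pow₀ (by norm_num)
    calc (1 + δ) ^ (k + 1) = (1 + δ) ^ k * (1 + δ) := pow_succ _ _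
      _ ≤ (1 + (2 ^ k - 1) * δ) * (1 + δ) := by gcongr
      _ = 1 + (2 ^ k + (2 ^ k - 1) * δ) * δ := by ring
      _ ≤ 1 + (2 ^ k + (2 ^ k - 1) * 1) * δ := by
          have := sub_nonneg.2 h2
          gcongr
      _ = _ := by ring

lemma inv_rpow_near {a V₀ V δ : ℝ} (ha : 0 < a) (ha2 : a ≤ 1 / 2) (hV₀ : 0 < V₀) (hδ : 0 ≤ δ)
    (hδ2 : δ ≤ 1 / 2) (hVlo : V₀ * (1 - δ) ≤ V) (hVhi : V ≤ V₀ * (1 + δ)) :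
    (V ^ a)⁻¹ ≤ (V₀ ^ a)⁻¹ * (1 + 2 * δ) ∧ (V₀ ^ a)⁻¹ * (1 - δ) ≤ (V ^ a)⁻¹ := by
  have hVpos : 0 < V := lt_of_lt_of_le (mul_pos hV₀ (by linarith)) hVlo
  have hW0 := Real.rpow_pos_of_pos hV₀ a
  have hW := Real.rpow_pos_of_pos hVpos a
  constructor
  · have h1 : V₀ ^ a * (1 - δ) ≤ V ^ a := by
      refine le_trans ?_ (Real.rpow_le_rpow (mul_nonneg hV₀.le (by linarith)) hVlo ha.le)
      rw [Real.mul_rpow hV₀.le (by linarith)]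
      refine mul_le_mul_of_nonneg_left ?_ hW0.le
      have := Real.rpow_le_rpow_of_exponent_ge (show 0 < 1 - δ by linarith) (by linarith)
        (show a ≤ 1 by linarith)
      rwa [Real.rpow_one] at this
    rw [inv_le_iff_one_le_mul₀ hW]
    calc 1 ≤ (1 + 2 * δ) * (1 - δ) := by nlinarith
      _ = (V₀ ^ a)⁻¹ * (1 + 2 * δ) * (V₀ ^ a * (1 - δ)) := by
          field_simp
      _ ≤ _ := by gcongr
  · have h1 : V ^ a ≤ V₀ ^ a * (1 + δ) := by
      refine (Real.rpow_le_rpow hVpos.le hVhi ha.le).trans ?_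
      rw [Real.mul_rpow hV₀.le (by linarith)]
      refine mul_le_mul_of_nonneg_left ?_ hW0.le
      have := Real.rpow_le_rpow_of_exponent_le (show 1 ≤ 1 + δ by linarith)
        (show a ≤ 1 by linarith)
      rwa [Real.rpow_one] at this
    rw [le_inv_comm₀ (mul_pos (inv_pos.2 hW0) (by linarith)) hW]
    refine h1.trans ?_
    rw [mul_inv, inv_inv]
    refine mul_le_mul_of_nonneg_left ?_ hW0.le
    rw [← one_div, le_div_iff₀ (by linarith)]
    nlinarith

lemma pow_near {V₀ V δ : ℝ} (N : ℕ) (hV₀ : 0 < V₀) (hδ : 0 ≤ δ) (hδ2 : δ ≤ 1 / 2)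
    (hVlo : V₀ * (1 - δ) ≤ V) (hVhi : V ≤ V₀ * (1 + δ)) :
    V ^ N ≤ V₀ ^ N * (1 + 2 ^ N * δ) ∧ V₀ ^ N * (1 - N * δ) ≤ V ^ N := by
  have hVpos : 0 < V := lt_of_lt_of_le (mul_pos hV₀ (by linarith)) hVlo
  constructor
  · refine (pow_le_pow_left₀ hVpos.le hVhi N).trans ?_
    rw [mul_pow]
    have := one_add_pow_le hδ (by linarith) N
    refine mul_le_mul_of_nonneg_left (by linarith) (by positivity)
  · refine le_trans ?_ (pow_le_pow_left₀ (mul_nonneg hV₀.le (by linarith)) hVlo N)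
    rw [mul_pow]
    refine mul_le_mul_of_nonneg_left ?_ (by positivity)
    have := one_add_mul_le_pow (show (-2:ℝ) ≤ -δ by linarith) N
    rw [← sub_eq_add_neg] at this
    linarith

lemma rpow_clock_le {p s ν τ : ℝ} (hp : 1 ≤ p) (hs : 0 ≤ s) (hτ : 0 ≤ τ) (hτ1 : τ ≤ 1)
    (hsν : s ≤ ν) (hντ : ν ≤ s + τ * (1 + s)) :
    ν ^ p ≤ s ^ p + p * 2 ^ (p - 1) * τ * (1 + s) ^ p := by
  have hν : 0 ≤ ν := hs.trans hsν
  have h1 := rpow_sub_rpow_le hp hs hsν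
  have h2 : ν ^ (p - 1) ≤ 2 ^ (p - 1) * (1 + s) ^ (p - 1) := by
    rw [← Real.mul_rpow (by norm_num) (by linarith)]
    exact Real.rpow_le_rpow hν (by nlinarith) (by linarith)
  have h3 : (1 + s) ^ (p - 1) * (1 + s) = (1 + s) ^ p := by
    rw [← Real.rpow_add_one (by linarith)]; ring_nf
  have h4 : p * (ν - s) * ν ^ (p - 1) ≤
      p * (τ * (1 + s)) * (2 ^ (p - 1) * (1 + s) ^ (p - 1)) := by
    gcongr
    linarith
  rw [← h3]
  linarith

lemma bounds_of_inv_bounds {r r₀ u w : ℝ} (hr0 : 0 < r₀) (hr : 0 < r) (hw : 0 ≤ w)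
    (hw2 : w ≤ 1 / 2) (hup : r⁻¹ ≤ r₀⁻¹ * (1 + u)) (hlo : r₀⁻¹ * (1 - w) ≤ r⁻¹) :
    r₀ * (1 - u) ≤ r ∧ r ≤ r₀ * (1 + 2 * w) := by
  constructor
  · have h1 : r₀ ≤ r * (1 + u) := by
      have := mul_le_mul_of_nonneg_left hup (mul_pos hr hr0).le
      field_simp at this
      linarith
    rcases le_total u 1 with h | h
    · calc r₀ * (1 - u) ≤ r * (1 + u) * (1 - u) :=
            mul_le_mul_of_nonneg_right h1 (by linarith)
        _ = r - r * u ^ 2 := by ring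
        _ ≤ r := by
            have : 0 ≤ r * u ^ 2 := by positivity
            linarith
    · nlinarith
  · have h1 : r * (1 - w) ≤ r₀ := by
      have := mul_le_mul_of_nonneg_left hlo (mul_pos hr hr0).le
      field_simp at this
      linarith
    have h3 : 1 ≤ (1 - w) * (1 + 2 * w) := by nlinarith
    calc r ≤ r * ((1 - w) * (1 + 2 * w)) := le_mul_of_one_le_right hr.le h3
      _ = r * (1 - w) * (1 + 2 * w) := by ring
      _ ≤ _ := by gcongr

set_option maxHeartbeats 400000 in
/-- The rate is Lipschitz in relative terms: small relative changes of the volume and of the clock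
change it by a comparable relative amount. -/
lemma exists_rate_near (hN : 1 ≤ N) (hp : 2 * (N : ℝ) + 1 ≤ p) (hc : 0 ≤ c) {K : ℝ} (hK : 0 ≤ K) :
    ∃ C, 1 ≤ C ∧ ∀ V₀ V s ν δ τ, 0 < V₀ → 0 ≤ s → 0 ≤ τ → τ ≤ 1 → 0 ≤ δ → C * δ ≤ 1 →
      |V - V₀| ≤ δ * V₀ → s ≤ ν → ν ≤ s + τ * (1 + s) →
      rate N p c V₀ s * (c * V₀ ^ N * (1 + s) ^ p) ≤ K →
      rate N p c V₀ s * (1 - C * (δ + τ)) ≤ rate N p c V ν ∧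
      rate N p c V ν ≤ rate N p c V₀ s * (1 + C * (δ + τ)) := by
  have hp3 := three_le_of_exponent hN hp
  have ha := volExp_pos hN hp
  have ha2 := volExp_le_half hN hp
  have hN1 : (1:ℝ) ≤ N := by exact_mod_cast hN
  have h2N : (2:ℝ) ≤ 2 ^ N := le_self_pow₀ (by norm_num) (by lia)
  refine ⟨2 * N + 2 + 2 ^ N + 2 ^ N * (p * 2 ^ (p - 1) * K), ?_,
    fun V₀ V s ν δ τ hV₀ hs hτ hτ1 hδ hCδ hV hsν hντ hclock => ?_⟩
  · have : 0 ≤ 2 ^ N * (p * 2 ^ (p - 1) * K) := by positivity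
    linarith
  set B := p * 2 ^ (p - 1) * K with hB
  have hB0 : 0 ≤ B := by positivity
  set C := 2 * N + 2 + 2 ^ N + 2 ^ N * B with hC
  have hNB : 0 ≤ 2 ^ N * B := by positivity
  have hNδ : N * δ ≤ 1 / 2 := by nlinarith
  have hδ2 : δ ≤ 1 / 2 := by nlinarith
  have hVlo : V₀ * (1 - δ) ≤ V := by linarith [(abs_le.1 hV).1]
  have hVhi : V ≤ V₀ * (1 + δ) := by linarith [(abs_le.1 hV).2]
  have hVpos : 0 < V := lt_of_lt_of_le (mul_pos hV₀ (by linarith)) hVlo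
  have hν : 0 ≤ ν := hs.trans hsν
  have hr0 := rate_pos (N := N) (p := p) hc hV₀ s
  have hr := rate_pos (N := N) (p := p) hc hVpos ν
  have hi0 := inv_rate (N := N) (p := p) hc hV₀ hs
  have hi := inv_rate (N := N) (p := p) hc hVpos hν
  set r₀ := rate N p c V₀ s
  set r := rate N p c V ν
  have hW0 := Real.rpow_pos_of_pos hV₀ (volExp N p)
  have hW := Real.rpow_pos_of_pos hVpos (volExp N p)
  have hsp : 0 ≤ s ^ p := Real.rpow_nonneg hs p
  have hνp : 0 ≤ ν ^ p := Real.rpow_nonneg hν p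
  have hspν : s ^ p ≤ ν ^ p := Real.rpow_le_rpow hs hsν (by linarith)
  -- comparison of the volume terms
  obtain ⟨u1, u2⟩ := inv_rpow_near ha ha2 hV₀ hδ hδ2 hVlo hVhi
  obtain ⟨u3, u4⟩ := pow_near N hV₀ hδ hδ2 hVlo hVhi
  have u5 := rpow_clock_le (p := p) (by linarith) hs hτ hτ1 hsν hντ
  have hclock' : c * V₀ ^ N * (1 + s) ^ p ≤ K * r₀⁻¹ := by
    rw [← div_eq_mul_inv, le_div_iff₀ hr0]; linarith
  -- comparison of the inverse rates
  have hup : r⁻¹ ≤ r₀⁻¹ * (1 + C * (δ + τ)) := by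
    have h1 : c * V ^ N * ν ^ p ≤ c * V ^ N * s ^ p +
        2 ^ N * (p * 2 ^ (p - 1) * τ) * (c * V₀ ^ N * (1 + s) ^ p) := by
      have h2 : V ^ N ≤ V₀ ^ N * 2 ^ N := by
        refine u3.trans (mul_le_mul_of_nonneg_left ?_ (by positivity))
        nlinarith
      calc c * V ^ N * ν ^ p ≤ c * V ^ N * (s ^ p + p * 2 ^ (p - 1) * τ * (1 + s) ^ p) := by gcongr
        _ = c * V ^ N * s ^ p + c * V ^ N * (p * 2 ^ (p - 1) * τ * (1 + s) ^ p) := by ring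
        _ ≤ c * V ^ N * s ^ p + c * (V₀ ^ N * 2 ^ N) * (p * 2 ^ (p - 1) * τ * (1 + s) ^ p) := by
            gcongr
        _ = _ := by ring
    have h3 : 2 ^ N * (p * 2 ^ (p - 1) * τ) * (c * V₀ ^ N * (1 + s) ^ p) ≤
        2 ^ N * (p * 2 ^ (p - 1) * τ) * (K * r₀⁻¹) := by gcongr
    have h4 : c * V ^ N * s ^ p ≤ (c * V₀ ^ N * s ^ p) * (1 + 2 ^ N * δ) := by
      calc c * V ^ N * s ^ p ≤ c * (V₀ ^ N * (1 + 2 ^ N * δ)) * s ^ p := by gcongr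
        _ = _ := by ring
    have h5 : 0 ≤ c * V₀ ^ N * s ^ p := by positivity
    have h6 : 0 < (V₀ ^ volExp N p)⁻¹ := inv_pos.2 hW0
    have h7 : 0 < r₀⁻¹ := inv_pos.2 hr0
    calc r⁻¹ = (V ^ volExp N p)⁻¹ + c * V ^ N * ν ^ p := hi
      _ ≤ (V₀ ^ volExp N p)⁻¹ * (1 + 2 * δ) + ((c * V₀ ^ N * s ^ p) * (1 + 2 ^ N * δ) +
          2 ^ N * (p * 2 ^ (p - 1) * τ) * (K * r₀⁻¹)) := by linarith
      _ ≤ (V₀ ^ volExp N p)⁻¹ * (1 + (2 + 2 ^ N) * δ) +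
          ((c * V₀ ^ N * s ^ p) * (1 + (2 + 2 ^ N) * δ) +
          2 ^ N * (p * 2 ^ (p - 1) * τ) * (K * r₀⁻¹)) := by
          gcongr <;> linarith
      _ = r₀⁻¹ * (1 + (2 + 2 ^ N) * δ + 2 ^ N * B * τ) := by rw [hi0, hB]; ring
      _ ≤ _ := by
          refine mul_le_mul_of_nonneg_left ?_ h7.le
          have e1 : (2 + 2 ^ N) * δ ≤ C * δ := by gcongr; linarith
          have e2 : 2 ^ N * B * τ ≤ C * τ := by gcongr; linarith
          linarith
  have hlo : r₀⁻¹ * (1 - N * δ) ≤ r⁻¹ := by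
    rw [hi, hi0, add_mul]
    refine add_le_add (le_trans ?_ u2) ?_
    · have := mul_le_mul_of_nonneg_right hN1 hδ
      exact mul_le_mul_of_nonneg_left (by linarith) (by positivity)
    · calc c * V₀ ^ N * s ^ p * (1 - N * δ) = c * (V₀ ^ N * (1 - N * δ)) * s ^ p := by ring
        _ ≤ c * V ^ N * ν ^ p := by gcongr
  obtain ⟨h1, h2⟩ := bounds_of_inv_bounds hr0 hr (by positivity) hNδ hup hlo
  refine ⟨h1, h2.trans (mul_le_mul_of_nonneg_left ?_ hr0.le)⟩
  have e1 : 2 * N * δ ≤ C * δ := by gcongr; linarith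
  have e2 : 0 ≤ C * τ := by positivity
  linarith

end Compare

section Uniform

variable {N : ℕ} {p c K : ℝ} {γ : ℝ → ℂ}

lemma abs_quadProd_sub_le {z w : ℂ} {d : ℝ} (h2 : 0 ≤ z.im) (h1 : z.im ≤ z.re) (hd : 0 ≤ d)
    (hd1 : d ≤ 1) (h : ‖w - z‖ ≤ d * z.im) : |quadProd w - quadProd z| ≤ 3 * d * quadProd z := by
  have hr := abs_le.1 ((Complex.abs_re_le_norm (w - z)).trans h)
  have hi := abs_le.1 ((Complex.abs_im_le_norm (w - z)).trans h)
  rw [Complex.sub_re] at hr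
  rw [Complex.sub_im] at hi
  have hdz : d * z.im ≤ z.im := by nlinarith
  rw [quadProd_of_nonneg (h2.trans h1) h2, quadProd_of_nonneg (by linarith) (by linarith)]
  have hx : 0 ≤ z.re := h2.trans h1
  have hdx : d * z.im ≤ d * z.re := by gcongr
  have e1 : |w.re - z.re| ≤ d * z.re := abs_le.2 ⟨by linarith, by linarith⟩
  have e2 : |w.im - z.im| ≤ d * z.im := abs_le.2 ⟨by linarith, by linarith⟩
  have e3 : w.re * w.im - z.re * z.im =
      (w.re - z.re) * z.im + z.re * (w.im - z.im) + (w.re - z.re) * (w.im - z.im) := by ring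
  rw [e3]
  refine (abs_add_le _ _).trans ?_
  refine (add_le_add_left (abs_add_le _ _) _).trans ?_
  rw [abs_mul, abs_mul, abs_mul, abs_of_nonneg h2, abs_of_nonneg hx]
  calc |w.re - z.re| * z.im + z.re * |w.im - z.im| + |w.re - z.re| * |w.im - z.im|
      ≤ d * z.re * z.im + z.re * (d * z.im) + (d * z.re) * (1 * z.im) := by
        gcongr
        exact e2.trans (by linarith)
    _ = _ := by ring

/-- On a window of length `h` around clock time `s` a decaying extremal trajectory moves at
constant speed up to a relative error of order `h / (1 + s)`. -/
lemma IsExtremal.exists_uniform (hγ : IsExtremal N p c γ) (hN : 1 ≤ N)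
    (hp : 2 * (N : ℝ) + 1 ≤ p) (hc : 0 ≤ c) (hK : HasDecay N p c K γ) :
    ∃ C, 1 ≤ C ∧ ∀ s h s₁ s₂, 0 ≤ s → C * h ≤ 1 + s → s ≤ s₁ → s₁ ≤ s₂ → s₂ ≤ s + h →
      speed N p c γ s * (1 - C * (h / (1 + s))) * (s₂ - s₁) ≤ ‖γ s₂ - γ s₁‖ ∧
      ‖γ s₂ - γ s₁‖ ≤ speed N p c γ s * (1 + C * (h / (1 + s))) * (s₂ - s₁) := by
  have hK1 := hK.one_le
  obtain ⟨C₁, hC₁, hnear⟩ := exists_rate_near hN hp hc (zero_le_one.trans hK1)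
  refine ⟨2 * C₁ * (6 * K + 1), by nlinarith, fun s h s₁ s₂ hs hCh h1 h12 h2 => ?_⟩
  have hs1 : 0 < 1 + s := by linarith
  have hh : 0 ≤ h := by linarith
  set C := 2 * C₁ * (6 * K + 1) with hC
  set τ := h / (1 + s) with hτd
  have hτ0 : 0 ≤ τ := by positivity
  have hhτ : h = τ * (1 + s) := by rw [hτd, div_mul_cancel₀ _ hs1.ne']
  have hCτ : C * τ ≤ 1 := by
    rw [hτd, ← mul_div_assoc, div_le_one hs1]; exact hCh
  have hKτ0 : 0 ≤ K * τ := by positivity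
  have hK0 : 0 ≤ K := by linarith
  have hexp : C * τ = 2 * C₁ * (6 * (K * τ)) + 2 * C₁ * τ := by rw [hC]; ring
  have hC₁τ : 0 ≤ C₁ * τ := by positivity
  have hC₁K : 6 * (K * τ) ≤ C₁ * (6 * (K * τ)) := le_mul_of_one_le_left (by positivity) hC₁
  have hC₁τ' : τ ≤ C₁ * τ := le_mul_of_one_le_left hτ0 hC₁
  have hτ1 : τ ≤ 1 := by linarith
  have hKτ : 2 * (K * τ) ≤ 1 := by linarith
  have hr := hγ.speed_pos hc hs
  set r := speed N p c γ s with hrd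
  have hV := hγ.prod_pos s hs
  have hy := hγ.im_nonneg s
  have hxy := hγ.im_le_re s
  have hspeed := hK.speed_le s hs
  -- rates near `γ s`
  have hloc : ∀ z ν, ‖z - γ s‖ ≤ 2 * r * h → ν ∈ Icc s (s + h) →
      r * (1 - C / 2 * τ) ≤ rate N p c (quadProd z) ν ∧
      rate N p c (quadProd z) ν ≤ r * (1 + C / 2 * τ) := by
    intro z ν hz hν
    have hz' : ‖z - γ s‖ ≤ 2 * (K * τ) * (γ s).im := by
      refine hz.trans ?_
      rw [hhτ]
      calc 2 * r * (τ * (1 + s)) = 2 * τ * (r * (1 + s)) := by ring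
        _ ≤ 2 * τ * (K * (γ s).im) := by gcongr
        _ = _ := by ring
    have hVz := abs_quadProd_sub_le hy hxy (by positivity) hKτ hz'
    have := hnear (quadProd (γ s)) (quadProd z) s ν (3 * (2 * (K * τ))) τ hV hs hτ0 hτ1
      (by positivity) (by linarith) hVz hν.1 (by rw [← hhτ]; exact hν.2) (hK.clock_le s hs)
    have e : C₁ * (3 * (2 * (K * τ)) + τ) = C / 2 * τ := by rw [hC]; ring
    rw [e] at this
    exact this
  have hhalf : C / 2 * τ ≤ 1 / 2 := by linarith
  -- the trajectory stays close
  have hclose : ∀ ν ∈ Icc s (s + h), ‖γ ν - γ s‖ ≤ 2 * r * h := by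
    intro ν hν
    by_contra hcon
    push Not at hcon
    have hh0 : 0 < h := by
      rcases hh.eq_or_lt with h0 | h0
      · obtain rfl : ν = s := le_antisymm (by linarith [hν.2]) hν.1
        rw [sub_self, norm_zero, ← h0] at hcon
        simp at hcon
      · exact h0
    obtain ⟨t, ht, ht1, ht2⟩ := exists_first_hit (f := fun ν => ‖γ ν - γ s‖)
      (hγ.cont.sub continuous_const).norm hν.1 (r := 2 * r * h) (by simp; positivity) hcon.le
    have := hγ.le s t (r * (1 + C / 2 * τ)) ht.1 fun ν' hν' =>
      (hloc (γ ν') ν' (ht2 ν' hν') ⟨hν'.1, hν'.2.trans (ht.2.trans hν.2)⟩).2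
    rw [ht1] at this
    have h3 : r * (1 + C / 2 * τ) * (t - s) ≤ r * (3 / 2) * h := by
      have : t - s ≤ h := by linarith [ht.2, hν.2]
      have : 0 ≤ t - s := sub_nonneg.2 ht.1
      gcongr
      linarith
    have : 0 < r * h := by positivity
    linarith
  have hC0 : 0 ≤ C := by rw [hC]; positivity
  have hCτ0 : 0 ≤ C * τ := by positivity
  have hm : ∀ ν, s₁ ≤ ν → ν ≤ s₂ → ν ∈ Icc s (s + h) := fun ν hν1 hν2 =>
    ⟨h1.trans hν1, hν2.trans h2⟩
  have h12' : 0 ≤ s₂ - s₁ := sub_nonneg.2 h12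
  constructor
  · refine le_trans ?_ (hγ.min s₁ s₂ (r * (1 - C / 2 * τ)) (hs.trans h1) h12 fun θ hθ ν hν => ?_)
    · gcongr; linarith
    · refine (hloc _ ν ?_ (hm ν hν.1 hν.2)).1
      have e : γ s₁ + θ * (γ s₂ - γ s₁) - γ s =
          ((1 - θ : ℝ) : ℂ) * (γ s₁ - γ s) + (θ : ℂ) * (γ s₂ - γ s) := by push_cast; ring
      rw [e]
      refine (norm_add_le _ _).trans ?_
      rw [norm_mul, norm_mul, Complex.norm_real, Complex.norm_real, Real.norm_of_nonneg hθ.1,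
        Real.norm_of_nonneg (sub_nonneg.2 hθ.2)]
      calc (1 - θ) * ‖γ s₁ - γ s‖ + θ * ‖γ s₂ - γ s‖
          ≤ (1 - θ) * (2 * r * h) + θ * (2 * r * h) :=
            add_le_add (mul_le_mul_of_nonneg_left (hclose _ (hm _ le_rfl h12))
              (sub_nonneg.2 hθ.2)) (mul_le_mul_of_nonneg_left (hclose _ (hm _ h12 le_rfl)) hθ.1)
        _ = _ := by ring
  · refine (hγ.le s₁ s₂ (r * (1 + C / 2 * τ)) h12 fun ν hν =>
      (hloc _ ν (hclose ν (hm ν hν.1 hν.2)) (hm ν hν.1 hν.2)).2).trans ?_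
    gcongr; linarith

end Uniform

section Chord

/-- Two consecutive displacements of nearly maximal total length are nearly parallel. -/
lemma norm_mean_sub_le {a b : ℂ} {r u l : ℝ} (hr : 0 ≤ r) (hu : 0 ≤ u) (hl : 1 / 2 ≤ l)
    (hl1 : l ≤ 1) (hu1 : u ≤ 1) (ha : ‖a‖ ≤ r * (1 + u)) (hb : ‖b‖ ≤ r * (1 + u))
    (hm : r * (1 - u) ≤ ‖l • a + (1 - l) • b‖) :
    ‖a - (l • a + (1 - l) • b)‖ ≤ 2 * r * √u := by
  have e1 : ‖l • a + (1 - l) • b‖ ^ 2 = l * ‖a‖ ^ 2 + (1 - l) * ‖b‖ ^ 2 -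
      l * (1 - l) * ‖a - b‖ ^ 2 := by
    simp only [← Complex.normSq_eq_norm_sq, Complex.normSq_apply, Complex.add_re, Complex.add_im,
      Complex.sub_re, Complex.sub_im, Complex.real_smul, Complex.mul_re, Complex.mul_im,
      Complex.ofReal_re, Complex.ofReal_im]
    ring
  have e2 : ‖a - (l • a + (1 - l) • b)‖ = (1 - l) * ‖a - b‖ := by
    have : a - (l • a + (1 - l) • b) = (1 - l) • (a - b) := by module
    rw [this, norm_smul, Real.norm_of_nonneg (by linarith)]
  have h1 : ‖a‖ ^ 2 ≤ (r * (1 + u)) ^ 2 := pow_le_pow_left₀ (norm_nonneg _) ha 2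
  have h2 : ‖b‖ ^ 2 ≤ (r * (1 + u)) ^ 2 := pow_le_pow_left₀ (norm_nonneg _) hb 2
  have h3 : (r * (1 - u)) ^ 2 ≤ ‖l • a + (1 - l) • b‖ ^ 2 :=
    pow_le_pow_left₀ (mul_nonneg hr (by linarith)) hm 2
  have h4 : l * (1 - l) * ‖a - b‖ ^ 2 ≤ 4 * u * r ^ 2 := by
    have g1 := mul_le_mul_of_nonneg_left h1 (show 0 ≤ l by linarith)
    have g2 := mul_le_mul_of_nonneg_left h2 (show 0 ≤ 1 - l by linarith)
    nlinarith
  rw [e2]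
  refine abs_le_of_sq_le_sq' ?_ (by positivity) |>.2
  rw [mul_pow, mul_pow, mul_pow, Real.sq_sqrt hu]
  have h5 : (1 - l) ^ 2 ≤ l * (1 - l) := by nlinarith
  have := mul_le_mul_of_nonneg_right h5 (sq_nonneg ‖a - b‖)
  linarith

variable {f : ℝ → ℂ} {s r σ : ℝ}

/-- `f` moves away from `s` at constant speed `r`, up to a relative error `σ h` at scale `h`. -/
def UniformSpeed (f : ℝ → ℂ) (s r σ : ℝ) : Prop :=
  ∀ h s₁ s₂, σ * h ≤ 1 → s ≤ s₁ → s₁ ≤ s₂ → s₂ ≤ s + h →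
    r * (1 - σ * h) * (s₂ - s₁) ≤ ‖f s₂ - f s₁‖ ∧ ‖f s₂ - f s₁‖ ≤ r * (1 + σ * h) * (s₂ - s₁)

lemma UniformSpeed.chord_half (H : UniformSpeed f s r σ) (hr : 0 ≤ r) (hσ : 0 ≤ σ) {h h' : ℝ}
    (h0 : 0 < h) (hh : h / 2 ≤ h') (hh' : h' ≤ h) (hs : σ * h ≤ 1) :
    ‖h'⁻¹ • (f (s + h') - f s) - h⁻¹ • (f (s + h) - f s)‖ ≤ 2 * r * √(σ * h) := by
  have h0' : 0 < h' := by linarith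
  rcases hh'.eq_or_lt with rfl | hlt
  · rw [sub_self, norm_zero]; positivity
  have hd : 0 < h - h' := sub_pos.2 hlt
  have e : h⁻¹ • (f (s + h) - f s) = (h' / h) • (h'⁻¹ • (f (s + h') - f s)) +
      (1 - h' / h) • ((h - h')⁻¹ • (f (s + h) - f (s + h'))) := by
    have e1 : 1 - h' / h = (h - h') / h := by field_simp
    have e2 : h' / h * h'⁻¹ = h⁻¹ := by field_simp
    have e3 : (h - h') / h * (h - h')⁻¹ = h⁻¹ := by field_simp
    rw [e1, smul_smul, smul_smul, e2, e3, ← smul_add]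
    congr 1; ring
  have ha := (H h s (s + h') hs le_rfl (by linarith) (by linarith)).2
  have hb := (H h (s + h') (s + h) hs (by linarith) (by linarith) le_rfl).2
  have hm := (H h s (s + h) hs le_rfl (by linarith) le_rfl).1
  rw [e]
  refine norm_mean_sub_le hr (by positivity) (by rw [le_div_iff₀ h0]; linarith)
    (by rw [div_le_one h0]; exact hh') hs ?_ ?_ ?_
  · rw [norm_smul, Real.norm_of_nonneg (by positivity), inv_mul_le_iff₀ h0']
    rw [add_sub_cancel_left] at ha
    linarith
  · rw [norm_smul, Real.norm_of_nonneg (by positivity), inv_mul_le_iff₀ hd]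
    rw [show s + h - (s + h') = h - h' by ring] at hb
    linarith
  · rw [← e, norm_smul, Real.norm_of_nonneg (by positivity), inv_mul_eq_div, le_div_iff₀ h0]
    rwa [add_sub_cancel_left] at hm

lemma UniformSpeed.chord (H : UniformSpeed f s r σ) (hr : 0 ≤ r) (hσ : 0 ≤ σ) {h h' : ℝ}
    (h0 : 0 < h') (hh' : h' ≤ h) (hs : σ * h ≤ 1) :
    ‖h'⁻¹ • (f (s + h') - f s) - h⁻¹ • (f (s + h) - f s)‖ ≤ 8 * r * √(σ * h) := by
  obtain ⟨k, hk⟩ := pow_unbounded_of_one_lt (h / h') (one_lt_two)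
  rw [div_lt_iff₀ h0] at hk
  induction k generalizing h with
  | zero => exact absurd hk (by simpa using hh')
  | succ k ih =>
    have hh0 : 0 < h := h0.trans_le hh'
    rcases le_total (h / 2) h' with h2 | h2
    · refine (H.chord_half hr hσ hh0 h2 hh' hs).trans ?_
      have : 0 ≤ r * √(σ * h) := by positivity
      linarith
    · have i1 := ih h2 (by nlinarith) (by rw [pow_succ] at hk; linarith)
      have i2 := H.chord_half hr hσ hh0 le_rfl (by linarith : h / 2 ≤ h) hs
      have i3 : √(σ * (h / 2)) ≤ 3 / 4 * √(σ * h) := by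
        rw [show (3:ℝ) / 4 = √((3 / 4) ^ 2) from (Real.sqrt_sq (by norm_num)).symm,
          ← Real.sqrt_mul (by positivity)]
        refine Real.sqrt_le_sqrt ?_
        have : 0 ≤ σ * h := by positivity
        linarith
      calc _ ≤ 8 * r * √(σ * (h / 2)) + 2 * r * √(σ * h) :=
            (norm_sub_le_norm_sub_add_norm_sub _ _ _).trans (add_le_add i1 i2)
        _ ≤ 8 * r * (3 / 4 * √(σ * h)) + 2 * r * √(σ * h) := by gcongr
        _ = _ := by ring

/-- The chords converge, with a rate, to a right derivative of norm `r`. -/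
lemma UniformSpeed.exists_deriv (H : UniformSpeed f s r σ) (hr : 0 ≤ r) (hσ : 0 ≤ σ) :
    ∃ E, HasDerivWithinAt f E (Ici s) s ∧ ‖E‖ = r ∧ ∀ h, 0 < h → σ * h ≤ 1 →
      ‖h⁻¹ • (f (s + h) - f s) - E‖ ≤ 8 * r * √(σ * h) := by
  let D : ℝ → ℂ := fun h => h⁻¹ • (f (s + h) - f s)
  have hz : Tendsto (fun h : ℝ => σ * h) (𝓝[>] 0) (𝓝 0) := by
    have : Tendsto (fun h : ℝ => σ * h) (𝓝 0) (𝓝 (σ * 0)) :=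
      (continuous_const.mul continuous_id).tendsto 0
    rw [mul_zero] at this
    exact this.mono_left nhdsWithin_le_nhds
  have hsm : ∀ᶠ h in 𝓝[>] (0:ℝ), σ * h ≤ 1 := hz.eventually (ge_mem_nhds one_pos)
  have hq : Tendsto (fun h : ℝ => 8 * r * √(σ * h)) (𝓝[>] 0) (𝓝 0) := by
    simpa using (hz.sqrt).const_mul (8 * r)
  have hcau : Cauchy (map D (𝓝[>] 0)) := by
    rw [Metric.cauchy_iff]
    refine ⟨inferInstance, fun ε hε => ?_⟩
    obtain ⟨h, ⟨h1, h2⟩, h3⟩ := ((hsm.and (hq.eventually (gt_mem_nhds (half_pos hε)))).and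
      self_mem_nhdsWithin).exists
    have h3 : 0 < h := h3
    refine ⟨D '' Ioc 0 h, image_mem_map (Ioc_mem_nhdsGT h3), ?_⟩
    rintro _ ⟨x, hx, rfl⟩ _ ⟨y, hy, rfl⟩
    have hx' := H.chord hr hσ hx.1 hx.2 h1
    have hy' := H.chord hr hσ hy.1 hy.2 h1
    calc dist (D x) (D y) ≤ dist (D x) (D h) + dist (D y) (D h) := dist_triangle_right _ _ _
      _ < ε := by rw [dist_eq_norm, dist_eq_norm]; simp only [D]; linarith
  obtain ⟨E, hE⟩ := CompleteSpace.complete hcau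
  have hE : Tendsto D (𝓝[>] 0) (𝓝 E) := hE
  refine ⟨E, ?_, ?_, fun h hh hs => ?_⟩
  · rw [hasDerivWithinAt_iff_tendsto_slope, Ici_sdiff_left]
    have : Tendsto (fun t : ℝ => t - s) (𝓝[>] s) (𝓝[>] 0) := by
      refine tendsto_nhdsWithin_iff.2 ⟨?_, ?_⟩
      · have : Tendsto (fun t : ℝ => t - s) (𝓝 s) (𝓝 (s - s)) :=
          (continuous_id.sub continuous_const).tendsto s
        rw [sub_self] at this
        exact this.mono_left nhdsWithin_le_nhds
      · filter_upwards [self_mem_nhdsWithin] with t ht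
        exact mem_Ioi.2 (sub_pos.2 (mem_Ioi.1 ht))
    refine (hE.comp this).congr fun t => ?_
    simp [D, slope]
  · have hb : ∀ᶠ h in 𝓝[>] (0:ℝ), r * (1 - σ * h) ≤ ‖D h‖ ∧ ‖D h‖ ≤ r * (1 + σ * h) := by
      filter_upwards [hsm, self_mem_nhdsWithin] with h h1 h2
      have h2 : 0 < h := h2
      obtain ⟨g1, g2⟩ := H h s (s + h) h1 le_rfl (by linarith) le_rfl
      simp only [D]
      rw [norm_smul, Real.norm_of_nonneg (by positivity), inv_mul_eq_div, le_div_iff₀ h2,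
        div_le_iff₀ h2]
      rw [add_sub_cancel_left] at g1 g2
      exact ⟨g1, g2⟩
    refine tendsto_nhds_unique hE.norm (tendsto_of_tendsto_of_tendsto_of_le_of_le' ?_ ?_
      (hb.mono fun _ h => h.1) (hb.mono fun _ h => h.2))
    · simpa using (hz.const_sub 1).const_mul r
    · simpa using (hz.const_add 1).const_mul r
  · rw [norm_sub_rev]
    refine le_of_tendsto (hE.sub_const _).norm ?_
    filter_upwards [Ioc_mem_nhdsGT hh] with x hx
    exact H.chord hr hσ hx.1 hx.2 hs

end Chord

section Smooth

variable {f : ℝ → ℂ} {r : ℝ → ℝ} {C : ℝ}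

/-- Locally uniform speed forces continuous differentiability. -/
lemma exists_velocity (hf : Continuous f) (hr : Continuous r) (hrp : ∀ s, 0 ≤ s → 0 < r s)
    (hC : 0 ≤ C) (H : ∀ s, 0 ≤ s → UniformSpeed f s (r s) (C / (1 + s))) :
    ∃ E : ℝ → ℂ, Continuous E ∧ (∀ s, ‖E s‖ = r (max s 0)) ∧
      (∀ s, 0 ≤ s → f s = f 0 + ∫ t in (0:ℝ)..s, E t) ∧
      ∀ s h, 0 ≤ s → 0 < h → C / (1 + s) * h ≤ 1 →
        ‖h⁻¹ • (f (s + h) - f s) - E s‖ ≤ 8 * r s * √(C / (1 + s) * h) := by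
  have hex := fun s : ℝ => (H (max s 0) (le_max_right _ _)).exists_deriv (hrp _ (le_max_right _ _)).le
    (div_nonneg hC (by positivity))
  choose E hE1 hE2 hE3 using hex
  have hcont : Continuous E := by
    have hunit : Continuous fun s => (r (max s 0))⁻¹ • E s := by
      refine continuous_of_uniform_approx_of_continuous fun u hu => ?_
      obtain ⟨ε, hε, hεu⟩ := Metric.mem_uniformity_dist.1 hu
      have hz : Tendsto (fun h : ℝ => C * h) (𝓝[>] 0) (𝓝 0) := by
        have : Tendsto (fun h : ℝ => C * h) (𝓝 0) (𝓝 (C * 0)) :=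
          (continuous_const.mul continuous_id).tendsto 0
        rw [mul_zero] at this
        exact this.mono_left nhdsWithin_le_nhds
      have hq : Tendsto (fun h : ℝ => 8 * √(C * h)) (𝓝[>] 0) (𝓝 0) := by
        simpa using (hz.sqrt).const_mul 8
      obtain ⟨h, ⟨h1, h2⟩, h3⟩ := (((hz.eventually (ge_mem_nhds one_pos)).and
        (hq.eventually (gt_mem_nhds hε))).and self_mem_nhdsWithin).exists
      have h3 : 0 < h := h3
      refine ⟨fun s => (r (max s 0))⁻¹ • h⁻¹ • (f (max s 0 + h) - f (max s 0)), ?_, fun s => hεu ?_⟩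
      · have : Continuous fun s : ℝ => (r (max s 0))⁻¹ :=
          (hr.comp (by fun_prop)).inv₀ fun s => (hrp _ (le_max_right _ _)).ne'
        fun_prop
      · have hp := hrp (max s 0) (le_max_right _ _)
        have hC1 : C / (1 + max s 0) * h ≤ C * h := by
          gcongr
          exact div_le_self hC (by simp)
        rw [dist_comm, dist_eq_norm, ← smul_sub, norm_smul, Real.norm_of_nonneg (by positivity),
          inv_mul_lt_iff₀ hp]
        refine (hE3 s h h3 (hC1.trans h1)).trans_lt ?_
        have := Real.sqrt_le_sqrt hC1
        nlinarith
    have : E = fun s => r (max s 0) • ((r (max s 0))⁻¹ • E s) := by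
      ext1 s
      rw [smul_smul, mul_inv_cancel₀ (hrp _ (le_max_right _ _)).ne', one_smul]
    rw [this]
    exact (hr.comp (by fun_prop)).smul hunit
  refine ⟨E, hcont, hE2, fun s hs => ?_, fun s h hs => ?_⟩
  · have := constant_of_has_deriv_right_zero (f := fun s => f s - ∫ t in (0:ℝ)..s, E t) (a := 0)
      (b := s) (hf.sub (intervalIntegral.continuous_primitive
        (fun _ _ => hcont.intervalIntegrable _ _) _)).continuousOn (fun x hx => by
        have h1 := hE1 x
        rw [max_eq_left hx.1] at h1
        have h2 := (hcont.integral_hasStrictDerivAt 0 x).hasDerivAt.hasDerivWithinAt (s := Ici x)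
        have h3 := h1.sub h2
        rw [sub_self] at h3
        exact h3) s ⟨hs, le_rfl⟩
    simp only [intervalIntegral.integral_same, sub_zero] at this
    rw [← this]; ring
  · have := hE3 s h
    rwa [max_eq_left hs] at this

end Smooth

/-- `E` is a continuous velocity field along the critical trajectory `γ`. -/
structure IsVelocity (N : ℕ) (p c X₀ C : ℝ) (γ E : ℝ → ℂ) : Prop extends
    IsCritical N p c X₀ C γ where
  cont_vel : Continuous E
  norm_vel : ∀ s, ‖E s‖ = speed N p c γ (max s 0)
  eq_integral : ∀ s, 0 ≤ s → γ s = γ 0 + ∫ t in (0:ℝ)..s, E t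

section Velocity

variable {N : ℕ} {p c X₀ C K : ℝ} {γ E : ℝ → ℂ}

lemma IsVelocity.norm_pos (hγ : IsVelocity N p c X₀ C γ E) (hc : 0 ≤ c) (s : ℝ) : 0 < ‖E s‖ := by
  rw [hγ.norm_vel]
  exact hγ.speed_pos hc (le_max_right _ _)

lemma IsVelocity.norm_eq (hγ : IsVelocity N p c X₀ C γ E) {s : ℝ} (hs : 0 ≤ s) :
    ‖E s‖ = speed N p c γ s := by rw [hγ.norm_vel, max_eq_left hs]

lemma IsVelocity.hasDerivAt (hγ : IsVelocity N p c X₀ C γ E) {s : ℝ} (hs : 0 < s) :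
    HasDerivAt γ (E s) s := by
  refine ((hγ.cont_vel.integral_hasStrictDerivAt 0 s).hasDerivAt.const_add (γ 0)).congr_of_eventuallyEq ?_
  filter_upwards [Ioi_mem_nhds hs] with t ht using hγ.eq_integral t (le_of_lt ht)

lemma IsVelocity.integrableOn (hγ : IsVelocity N p c X₀ C γ E) (hp : 1 < p)
    (hK : HasDecay N p c K γ) : IntegrableOn E (Ioi 0) := by
  have he : 0 < (p - 1) / ((N : ℝ) + 1) := div_pos (by linarith) (by positivity)
  have h := (integrableOn_add_rpow_Ioi_of_lt (a := -((p - 1) / ((N : ℝ) + 1)) - 1) (c := 0) (m := 1)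
    (by linarith) (by norm_num)).const_mul K
  refine h.mono' hγ.cont_vel.aestronglyMeasurable ?_
  filter_upwards [ae_restrict_mem measurableSet_Ioi] with s hs
  rw [hγ.norm_eq (le_of_lt hs), add_comm s 1]
  exact hK.speed_le_rpow s (le_of_lt hs)

lemma IsVelocity.tendsto (hγ : IsVelocity N p c X₀ C γ E) (hp : 1 < p)
    (hK : HasDecay N p c K γ) : Tendsto γ atTop (𝓝 (γ 0 + ∫ t in Ioi 0, E t)) := by
  refine ((intervalIntegral_tendsto_integral_Ioi 0 (hγ.integrableOn hp hK)
    tendsto_id).const_add (γ 0)).congr' ?_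
  filter_upwards [eventually_ge_atTop 0] with s hs using (hγ.eq_integral s hs).symm

lemma HasDecay.tendsto_im (hK : HasDecay N p c K γ) (hp : 1 < p) (hi : ∀ s, 0 ≤ (γ s).im) :
    Tendsto (fun s => (γ s).im) atTop (𝓝 0) := by
  have he : 0 < (p - 1) / ((N : ℝ) + 1) := div_pos (by linarith) (by positivity)
  have hK1 := hK.one_le
  refine tendsto_of_tendsto_of_tendsto_of_le_of_le' tendsto_const_nhds
    (tendsto_mul_rpow_neg he (K * K)) (Eventually.of_forall hi) ?_
  filter_upwards [eventually_gt_atTop 0] with s hs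
  refine (hK.im_le s hs.le).trans ?_
  have h1 := hK.speed_le_rpow s hs.le
  have h2 : (1 + s) ^ (-((p - 1) / ((N : ℝ) + 1)) - 1) * (1 + s) =
      (1 + s) ^ (-((p - 1) / ((N : ℝ) + 1))) := by
    rw [← Real.rpow_add_one (by positivity)]; congr 1; ring
  have h3 : (1 + s) ^ (-((p - 1) / ((N : ℝ) + 1))) ≤ s ^ (-((p - 1) / ((N : ℝ) + 1))) :=
    Real.rpow_le_rpow_of_nonpos hs (by linarith) (by linarith)
  calc K * (speed N p c γ s * (1 + s)) ≤ K * (K * (1 + s) ^ (-((p - 1) / ((N : ℝ) + 1)) - 1) * (1 + s)) := by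
        gcongr
    _ = K * K * (1 + s) ^ (-((p - 1) / ((N : ℝ) + 1))) := by rw [← h2]; ring
    _ ≤ _ := by gcongr

/-- The height lost by a critical trajectory nearly accounts for its length. -/
lemma IsVelocity.energy_le (hγ : IsVelocity N p c X₀ C γ E) (hp : 1 < p) (hc : 0 < c)
    (hK : HasDecay N p c K γ) {s h X₁ c₀ : ℝ} (hs : 0 < s) (hh : 0 ≤ h) (hX₁ : 0 < X₁)
    (hX : ∀ t, s ≤ t → X₁ ≤ (γ t).re) (hc₀ : ∀ t ∈ Icc s (s + h), c₀ ≤ (γ t).im ^ N) :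
    c₀ * (‖γ (s + h) - γ s‖ + ((γ (s + h)).im - (γ s).im)) ≤
      s ^ (-(p - 1)) / (c * (p - 1) * X₁ ^ N) - (γ s).im ^ (N + 1) / (N + 1) := by
  have hp1 : 0 < p - 1 := by linarith
  let W : ℝ → ℝ := fun t => t ^ (-(p - 1)) / (c * (p - 1) * X₁ ^ N) - (γ t).im ^ (N + 1) / (N + 1)
  have him : ∀ t, 0 < t → HasDerivAt (fun t => (γ t).im) (E t).im t := fun t ht =>
    Complex.imCLM.hasFDerivAt.comp_hasDerivAt t (hγ.hasDerivAt ht)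
  have hW : ∀ t, 0 < t → HasDerivAt W (-(t ^ (-p) / (c * X₁ ^ N)) - (γ t).im ^ N * (E t).im) t := by
    intro t ht
    convert! (((Real.hasDerivAt_rpow_const (p := -(p - 1)) (Or.inl ht.ne')).div_const
      (c * (p - 1) * X₁ ^ N)).sub (((him t ht).pow (N + 1)).div_const ((N : ℝ) + 1))) using 1
    rw [show -(p - 1) - 1 = -p by ring]
    push_cast
    field_simp
  have hW' : ∀ t, s ≤ t → -(t ^ (-p) / (c * X₁ ^ N)) - (γ t).im ^ N * (E t).im ≤
      -((γ t).im ^ N * (‖E t‖ + (E t).im)) := by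
    intro t ht
    have ht0 : 0 < t := hs.trans_le ht
    have h1 : ‖E t‖ ≤ (c * quadProd (γ t) ^ N * t ^ p)⁻¹ := by
      rw [hγ.norm_eq ht0.le]
      exact rate_le_inv hc (hγ.prod_pos t ht0.le) ht0
    have hy := hγ.im_pos ht0.le
    have hx : 0 < (γ t).re := hX₁.trans_le (hX t ht)
    have h2 : (γ t).im ^ N * ‖E t‖ ≤ t ^ (-p) / (c * X₁ ^ N) := by
      calc (γ t).im ^ N * ‖E t‖ ≤ (γ t).im ^ N * (c * quadProd (γ t) ^ N * t ^ p)⁻¹ := by gcongr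
        _ = t ^ (-p) / (c * (γ t).re ^ N) := by
            rw [hγ.quadProd_eq, mul_pow, Real.rpow_neg ht0.le]
            have : t ^ p ≠ 0 := (Real.rpow_pos_of_pos ht0 p).ne'
            field_simp
        _ ≤ _ := by
            have := hX t ht
            gcongr
    linarith
  have hE0 : ∀ t, 0 ≤ ‖E t‖ + (E t).im := fun t => by
    have := (abs_le.1 (Complex.abs_im_le_norm (E t))).1
    linarith
  have hWanti : AntitoneOn W (Ici s) := by
    refine antitoneOn_of_deriv_nonpos (convex_Ici s)
      (fun t ht => (hW t (hs.trans_le ht)).continuousAt.continuousWithinAt)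
      (fun t ht => (hW t (hs.trans_le (interior_subset ht))).differentiableAt.differentiableWithinAt)
      fun t ht => ?_
    have ht := interior_subset ht
    rw [(hW t (hs.trans_le ht)).deriv]
    refine (hW' t ht).trans (neg_nonpos.2 (mul_nonneg (pow_nonneg (hγ.im_nonneg t) _) (hE0 t)))
  have hWlim : Tendsto W atTop (𝓝 0) := by
    have h1 : Tendsto (fun t : ℝ => t ^ (-(p - 1)) / (c * (p - 1) * X₁ ^ N)) atTop (𝓝 0) := by
      simpa using (tendsto_rpow_neg_atTop hp1).div_const (c * (p - 1) * X₁ ^ N)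
    have h2 : Tendsto (fun t => (γ t).im ^ (N + 1) / ((N : ℝ) + 1)) atTop (𝓝 0) := by
      simpa using ((hK.tendsto_im hp hγ.im_nonneg).pow (N + 1)).div_const ((N : ℝ) + 1)
    have h3 := h1.sub h2
    rw [sub_zero] at h3
    exact h3
  have hWnn : 0 ≤ W (s + h) := by
    refine le_of_tendsto hWlim ?_
    filter_upwards [eventually_ge_atTop (s + h)] with t ht
    exact hWanti (mem_Ici.2 (by linarith)) (mem_Ici.2 (by linarith)) ht
  let U : ℝ → ℝ := fun t => W t + c₀ * ((∫ u in s..t, ‖E u‖) + (γ t).im)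
  have hU : ∀ t, 0 < t → HasDerivAt U (-(t ^ (-p) / (c * X₁ ^ N)) - (γ t).im ^ N * (E t).im +
      c₀ * (‖E t‖ + (E t).im)) t := fun t ht =>
    (hW t ht).add (((hγ.cont_vel.norm.integral_hasStrictDerivAt s t).hasDerivAt.add
      (him t ht)).const_mul c₀)
  have hUanti : AntitoneOn U (Icc s (s + h)) := by
    refine antitoneOn_of_deriv_nonpos (convex_Icc _ _)
      (fun t ht => (hU t (hs.trans_le ht.1)).continuousAt.continuousWithinAt)
      (fun t ht => (hU t (hs.trans_le
        (interior_subset ht).1)).differentiableAt.differentiableWithinAt) fun t ht => ?_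
    have ht := interior_subset ht
    rw [(hU t (hs.trans_le ht.1)).deriv]
    have h1 := hW' t ht.1
    have h2 := mul_le_mul_of_nonneg_right (hc₀ t ht) (hE0 t)
    linarith
  have hfin := hUanti ⟨le_rfl, by linarith⟩ ⟨by linarith, le_rfl⟩ (show s ≤ s + h by linarith)
  have hlen : ‖γ (s + h) - γ s‖ ≤ ∫ u in s..(s + h), ‖E u‖ := by
    rw [hγ.eq_integral s hs.le, hγ.eq_integral (s + h) (by linarith), add_sub_add_left_eq_sub,
      intervalIntegral.integral_interval_sub_left (hγ.cont_vel.intervalIntegrable _ _)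
        (hγ.cont_vel.intervalIntegrable _ _)]
    exact intervalIntegral.norm_integral_le_integral_norm (by linarith)
  simp only [U, intervalIntegral.integral_same, zero_add] at hfin
  have hW0 : W s = s ^ (-(p - 1)) / (c * (p - 1) * X₁ ^ N) - (γ s).im ^ (N + 1) / (N + 1) := rfl
  rw [← hW0]
  rcases le_total 0 c₀ with hc0 | hc0
  · have := mul_le_mul_of_nonneg_left hlen hc0
    linarith
  · have h3 : 0 ≤ ‖γ (s + h) - γ s‖ + ((γ (s + h)).im - (γ s).im) := by
      have := (abs_le.1 (Complex.abs_im_le_norm (γ (s + h) - γ s))).1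
      rw [Complex.sub_im] at this
      linarith
    have h4 := hWanti (mem_Ici.2 le_rfl) (mem_Ici.2 (by linarith : s ≤ s + h)) (by linarith)
    have h5 := mul_nonneg_of_nonpos_of_nonpos hc0 (neg_nonpos.2 h3)
    linarith

/-- The height of a critical trajectory cannot halve within a short clock window. -/
lemma IsVelocity.half_im_le (hγ : IsVelocity N p c X₀ C γ E) (hK : HasDecay N p c K γ)
    {s h t D θ : ℝ} (hs : 0 ≤ s) (hθ : h = θ * (1 + s)) (hθ1 : θ * K * 4 ≤ 1)
    (ht : t ∈ Icc s (s + h)) (hsp : ‖γ t - γ s‖ ≤ speed N p c γ s * (1 + D) * (t - s))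
    (hD : D ≤ 1) : (γ s).im / 2 ≤ (γ t).im := by
  have h1 := (abs_le.1 (Complex.abs_im_le_norm (γ t - γ s))).1
  rw [Complex.sub_im] at h1
  have h2 : speed N p c γ s * (1 + D) * (t - s) ≤ speed N p c γ s * 2 * h := by
    have h0 : 0 ≤ speed N p c γ s := (norm_nonneg (E s)).trans_eq (hγ.norm_eq hs)
    have := ht.1
    have := ht.2
    gcongr
    · linarith
    · linarith
  have h3 : speed N p c γ s * 2 * h ≤ 2 * θ * (K * (γ s).im) := by
    have hθ0 : 0 ≤ θ := by
      have : 0 ≤ θ * (1 + s) := by rw [← hθ]; linarith [ht.1, ht.2]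
      exact nonneg_of_mul_nonneg_left this (by linarith)
    have := mul_le_mul_of_nonneg_left (hK.speed_le s hs) (show 0 ≤ 2 * θ by linarith)
    rw [hθ]
    linarith
  have h4 : 2 * θ * (K * (γ s).im) ≤ (γ s).im / 2 := by
    have := mul_le_mul_of_nonneg_right hθ1 (hγ.im_nonneg s)
    linarith
  linarith

/-- A critical trajectory becomes vertical in the limit. -/
lemma IsVelocity.tendsto_direction (hγ : IsVelocity N p c X₀ C γ E) (hp : 1 < p) (hc : 0 < c)
    (hK : HasDecay N p c K γ) {A : ℝ} (hA : 0 < A)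
    (hsp : ∀ s, 0 ≤ s → UniformSpeed γ s (speed N p c γ s) (A / (1 + s)))
    (hch : ∀ s h, 0 ≤ s → 0 < h → A / (1 + s) * h ≤ 1 →
      ‖h⁻¹ • (γ (s + h) - γ s) - E s‖ ≤ 8 * speed N p c γ s * √(A / (1 + s) * h)) :
    Tendsto (fun s => (‖E s‖ + (E s).im) / ‖E s‖) atTop (𝓝 0) := by
  have hp1 : 0 < p - 1 := by linarith
  have hK1 := hK.one_le
  have hE0 : ∀ z : ℂ, 0 ≤ ‖z‖ + z.im := fun z => by
    have := (abs_le.1 (Complex.abs_im_le_norm z)).1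
    linarith
  set xi := (γ 0 + ∫ t in Ioi 0, E t).re with hxi
  have hre : Tendsto (fun s => (γ s).re) atTop (𝓝 xi) :=
    (Complex.continuous_re.tendsto _).comp (hγ.tendsto hp hK)
  have hxi0 : 0 < xi := hγ.X₀_pos.trans_le (ge_of_tendsto' hre hγ.le_re)
  rw [Metric.tendsto_atTop]
  intro ε hε
  -- choose the window
  obtain ⟨θ, hθ0, hθK, hθA, hθε⟩ : ∃ θ : ℝ, 0 < θ ∧ θ * K * 4 ≤ 1 ∧ A * θ ≤ 1 ∧
      16 * √(A * θ) ≤ ε / 4 := by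
    refine ⟨min (1 / (4 * K)) (min (1 / A) ((ε / 64) ^ 2 / A)), by positivity, ?_, ?_, ?_⟩
    · have := min_le_left (1 / (4 * K)) (min (1 / A) ((ε / 64) ^ 2 / A))
      rw [le_div_iff₀ (by positivity)] at this
      linarith
    · have := (min_le_right (1 / (4 * K)) (min (1 / A) ((ε / 64) ^ 2 / A))).trans (min_le_left _ _)
      rw [le_div_iff₀ hA] at this
      linarith
    · have := (min_le_right (1 / (4 * K)) (min (1 / A) ((ε / 64) ^ 2 / A))).trans (min_le_right _ _)
      rw [le_div_iff₀ hA, mul_comm] at this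
      have := Real.sqrt_le_sqrt this
      rw [Real.sqrt_sq (by positivity)] at this
      linarith
  -- choose the relative error in the clock
  obtain ⟨ε₁, hε₁, hε₁'⟩ : ∃ ε₁ : ℝ, 0 < ε₁ ∧
      ε₁ / (N + 1) * (2 ^ N * K / θ) ≤ ε / 4 := by
    refine ⟨ε / 4 * θ * (N + 1) / (2 ^ N * K), by positivity, le_of_eq ?_⟩
    field_simp
  obtain ⟨η, hη, hη'⟩ : ∃ η : ℝ, 0 < η ∧ (1 + η) * ((1 + η) ^ 2) ^ N ≤ 1 + ε₁ := by
    have : Tendsto (fun η : ℝ => (1 + η) * ((1 + η) ^ 2) ^ N) (𝓝[>] 0)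
        (𝓝 ((1 + 0) * ((1 + 0) ^ 2) ^ N)) := by
      refine Tendsto.mono_left (Continuous.tendsto ?_ 0) nhdsWithin_le_nhds
      fun_prop
    have h0 : (1 + (0:ℝ)) * ((1 + 0) ^ 2) ^ N < 1 + ε₁ := by simp [hε₁]
    obtain ⟨η, h1, h2⟩ := ((this.eventually (ge_mem_nhds h0)).and
      self_mem_nhdsWithin).exists
    exact ⟨η, h2, h1⟩
  have hX₁ : 0 < xi / (1 + η) := by positivity
  have e1 : ∀ᶠ s in atTop, xi / (1 + η) ≤ (γ s).re :=
    hre.eventually (le_mem_nhds (by rw [div_lt_iff₀ (by positivity)]; nlinarith))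
  have e2 : ∀ᶠ s in atTop, (γ s).re ≤ xi * (1 + η) :=
    hre.eventually (ge_mem_nhds (by nlinarith))
  obtain ⟨s₁, hs₁⟩ := eventually_atTop.1 e1
  obtain ⟨s₀, hs₀⟩ := eventually_atTop.1 ((e2.and (hγ.lower η hη)).and (eventually_ge_atTop s₁))
  refine ⟨max s₀ 1, fun s hs => ?_⟩
  have hs1 : 1 ≤ s := (le_max_right _ _).trans hs
  have hs0 : 0 < s := by linarith
  obtain ⟨⟨hx, hlow⟩, hss⟩ := hs₀ s ((le_max_left _ _).trans hs)
  set r := speed N p c γ s with hr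
  have hr0 : 0 < r := hγ.speed_pos hc.le hs0.le
  set h := θ * (1 + s) with hh
  have hh0 : 0 < h := by positivity
  have hAh : A / (1 + s) * h = A * θ := by rw [hh]; field_simp
  have hy0 := hγ.im_pos hs0.le
  set y := (γ s).im with hy
  have hen := hγ.energy_le hp hc hK hs0 hh0.le hX₁ (fun t ht => hs₁ t (hss.trans ht))
    (c₀ := (y / 2) ^ N) (fun t ht => pow_le_pow_left₀ (by positivity)
      (hγ.half_im_le hK hs0.le hh hθK ht (D := A / (1 + s) * h)
        (hsp s hs0.le h s t (by rw [hAh]; exact hθA) le_rfl ht.1 ht.2).2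
        (by rw [hAh]; exact hθA)) N)
  have hW : s ^ (-(p - 1)) / (c * (p - 1) * (xi / (1 + η)) ^ N) - y ^ (N + 1) / (N + 1) ≤
      ε₁ * (y ^ (N + 1) / (N + 1)) := by
    have h1 : s ^ (-(p - 1)) / (c * (p - 1) * (xi / (1 + η)) ^ N) ≤
        (1 + η) * ((1 + η) ^ 2) ^ N * (y ^ (N + 1) / (N + 1)) := by
      rw [div_le_iff₀ (by positivity)]
      rw [hγ.quadProd_eq] at hlow
      refine hlow.trans ?_
      have h3 : (γ s).re ^ N ≤ (xi * (1 + η)) ^ N :=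
        pow_le_pow_left₀ (hγ.X₀_pos.le.trans (hγ.le_re s)) hx N
      calc (1 + η) * (c * (p - 1) / (N + 1)) * (((γ s).re * y) ^ N * y)
          = (γ s).re ^ N * ((1 + η) * (c * (p - 1) / (N + 1)) * y ^ (N + 1)) := by
            rw [mul_pow]; ring
        _ ≤ (xi * (1 + η)) ^ N * ((1 + η) * (c * (p - 1) / (N + 1)) * y ^ (N + 1)) := by gcongr
        _ = _ := by
            rw [div_pow, mul_pow, ← pow_mul, mul_comm 2 N, pow_mul]
            field_simp
    have h2 := mul_le_mul_of_nonneg_right hη' (show 0 ≤ y ^ (N + 1) / ((N : ℝ) + 1) by positivity)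
    linarith
  set D := h⁻¹ • (γ (s + h) - γ s) with hD
  have hDn : ‖γ (s + h) - γ s‖ + ((γ (s + h)).im - y) = h * (‖D‖ + D.im) := by
    have : γ (s + h) - γ s = h • D := by rw [hD, smul_smul, mul_inv_cancel₀ hh0.ne', one_smul]
    rw [hy, ← Complex.sub_im, this, norm_smul, Real.norm_of_nonneg hh0.le, Complex.smul_im,
      smul_eq_mul]
    ring
  have hD1 : ‖D‖ + D.im ≤ ε / 4 * r := by
    rw [hDn] at hen
    have h1 : (y / 2) ^ N * (h * (‖D‖ + D.im)) ≤ (y / 2) ^ N * (ε₁ / (N + 1) * (2 ^ N * y)) := by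
      refine (hen.trans hW).trans_eq ?_
      rw [div_pow]; field_simp
      ring
    have h2 : h * (‖D‖ + D.im) ≤ h * (ε₁ / (N + 1) * (2 ^ N * K / θ) * r) := by
      refine (le_of_mul_le_mul_left h1 (by positivity)).trans ?_
      calc ε₁ / (N + 1) * (2 ^ N * y) ≤ ε₁ / (N + 1) * (2 ^ N * (K * (r * (1 + s)))) := by
            have := hK.im_le s hs0.le
            gcongr
        _ = _ := by rw [hh]; field_simp
    refine (le_of_mul_le_mul_left h2 hh0).trans ?_
    gcongr
  have hDE := hch s h hs0.le hh0 (by rw [hAh]; exact hθA)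
  rw [← hD, hAh] at hDE
  have h1 : ‖E s‖ ≤ ‖D‖ + ‖D - E s‖ := by
    have := norm_sub_norm_le (E s) D
    rw [norm_sub_rev] at this
    linarith
  have h2 := (abs_le.1 (Complex.abs_im_le_norm (D - E s))).1
  rw [Complex.sub_im] at h2
  have h3 : 16 * √(A * θ) * r ≤ ε / 4 * r := by gcongr
  have h4 : ‖E s‖ + (E s).im ≤ ε / 2 * r := by linarith
  have hEr : ‖E s‖ = r := hγ.norm_eq hs0.le
  rw [dist_zero_right, Real.norm_of_nonneg (div_nonneg (hE0 _) (norm_nonneg _)),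
    div_lt_iff₀ (hEr ▸ hr0)]
  refine h4.trans_lt ?_
  rw [hEr]
  nlinarith

end Velocity

/-- A path with positive integrable speed has an inverse arclength clock on `[0, 1)`. -/
lemma exists_arclength_clock {ρ : ℝ → ℝ} (hρ : Continuous ρ) (hpos : ∀ s, 0 < ρ s)
    (hint : IntegrableOn ρ (Ioi 0)) :
    ∃ (L : ℝ) (G : ℝ → ℝ), 0 < L ∧ G 0 = 0 ∧ StrictMonoOn G (Ico 0 1) ∧
      (∀ t ∈ Ico (0:ℝ) 1, HasDerivAt G (L / ρ (G t)) t) ∧ Tendsto G (𝓝[<] 1) atTop := by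
  let S : ℝ → ℝ := fun s => ∫ u in (0:ℝ)..s, ρ u
  have hS : ∀ s, HasStrictDerivAt S (ρ s) s := fun s => hρ.integral_hasStrictDerivAt 0 s
  have hSm : StrictMono S := strictMono_of_deriv_pos fun s => by
    rw [(hS s).hasDerivAt.deriv]; exact hpos s
  have hSc : Continuous S := continuous_iff_continuousAt.2 fun s => (hS s).hasDerivAt.continuousAt
  have hS0 : S 0 = 0 := intervalIntegral.integral_same
  have hlim := intervalIntegral_tendsto_integral_Ioi 0 hint tendsto_id
  set L := ∫ u in Ioi 0, ρ u
  have hlt : ∀ s, S s < L := fun s =>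
    (hSm (show s < s + 1 by linarith)).trans_le (hSm.monotone.ge_of_tendsto hlim _)
  have hL : 0 < L := hS0 ▸ hlt 0
  let g := Function.invFun S
  have hg : ∀ s, g (S s) = s := Function.leftInverse_invFun hSm.injective
  have hsurj : ∀ t ∈ Ico (0:ℝ) 1, ∃ s, 0 ≤ s ∧ S s = t * L := fun t ht => by
    have h1 : t * L < L := by nlinarith [ht.2]
    obtain ⟨s, h2, h3⟩ := ((hlim.eventually (lt_mem_nhds h1)).and (eventually_ge_atTop 0)).exists
    obtain ⟨u, hu, hu'⟩ := intermediate_value_Icc h3 hSc.continuousOn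
      (show t * L ∈ Icc (S 0) (S s) from ⟨by rw [hS0]; nlinarith [ht.1], le_of_lt h2⟩)
    exact ⟨u, hu.1, hu'⟩
  refine ⟨L, fun t => g (t * L), hL, ?_, ?_, ?_, ?_⟩
  · dsimp only
    rw [zero_mul]
    simpa [hS0] using hg 0
  · intro t ht u hu htu
    obtain ⟨a, -, ha⟩ := hsurj t ht
    obtain ⟨b, -, hb⟩ := hsurj u hu
    dsimp only
    rw [← ha, ← hb, hg, hg, ← hSm.lt_iff_lt, ha, hb]
    exact mul_lt_mul_of_pos_right htu hL
  · intro t ht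
    obtain ⟨a, -, ha⟩ := hsurj t ht
    have h1 := ((hS a).to_local_left_inverse (hpos a).ne' (Eventually.of_forall hg)).hasDerivAt
    rw [ha] at h1
    have h2 := h1.comp t ((hasDerivAt_id t).mul_const L)
    dsimp only
    rw [show g (t * L) = a by rw [← ha, hg]]
    convert! h2 using 1
    rw [one_mul, mul_comm, div_eq_mul_inv]
  · rw [tendsto_atTop]
    intro b
    have h1 : S (max b 0) / L < 1 := by rw [div_lt_one hL]; exact hlt _
    have h0 : 0 ≤ S (max b 0) := by
      simpa [hS0] using hSm.monotone (le_max_right b 0)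
    filter_upwards [Ioo_mem_nhdsLT h1] with t ht
    obtain ⟨a, -, ha⟩ := hsurj t ⟨(div_nonneg h0 hL.le).trans ht.1.le, ht.2⟩
    rw [← ha, hg]
    refine (le_max_left b 0).trans (hSm.le_iff_le.1 ?_)
    rw [ha]
    exact ((div_lt_iff₀ hL).1 ht.1).le

section Curve

variable {N : ℕ} {p c X₀ C K : ℝ} {γ E : ℝ → ℂ}

lemma IsExtremal.injOn (hγ : IsExtremal N p c γ) (hN : 1 ≤ N) (hp : 2 * (N : ℝ) + 1 ≤ p)
    (hc : 0 ≤ c) : InjOn γ (Ici 0) := by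
  have key : ∀ s t, 0 ≤ s → s < t → γ s ≠ γ t := by
    intro s t hs hst he
    have hV := hγ.prod_pos s hs
    have h := hγ.min s t (rate N p c (quadProd (γ s)) t) hs hst.le fun θ _ ν hν => by
      rw [← he, sub_self, mul_zero, add_zero]
      exact rate_anti hN hp hc le_rfl hV.le hν.2
    rw [he, sub_self, norm_zero, ← he] at h
    have := mul_pos (rate_pos (N := N) (p := p) hc hV t) (sub_pos.2 hst)
    linarith
  intro s hs t ht he
  rcases lt_trichotomy s t with h | h | h
  · exact absurd he (key s t hs h)
  · exact h
  · exact absurd he.symm (key t s ht h)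

/-- The critical trajectory, reparametrized to constant speed, reaches the axis at time `1`
orthogonally. -/
lemma IsVelocity.exists_curve (hγ : IsVelocity N p c X₀ C γ E) (hp : 1 < p) (hc : 0 < c)
    (hK : HasDecay N p c K γ)
    (hdir : Tendsto (fun s => (‖E s‖ + (E s).im) / ‖E s‖) atTop (𝓝 0)) :
    ∃ (L : ℝ) (G : ℝ → ℝ) (α d : ℝ → ℂ), 0 < L ∧ G 0 = 0 ∧ StrictMonoOn G (Ico 0 1) ∧
      (∀ t ∈ Ico (0:ℝ) 1, HasDerivAt G (L / speed N p c γ (G t)) t) ∧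
      (∀ t ∈ Ico (0:ℝ) 1, α t = γ (G t)) ∧ Continuous d ∧ (∀ t, HasDerivAt α (d t) t) ∧
      (∀ t ∈ Icc (0:ℝ) 1, ‖d t‖ = L) ∧ (d 1).re = 0 ∧ (α 1).im = 0 ∧ X₀ ≤ (α 1).re := by
  have hEn := hγ.norm_pos hc.le
  obtain ⟨L, G, hL, hG0, hGm, hGd, hGlim⟩ := exists_arclength_clock hγ.cont_vel.norm hEn
    (hγ.integrableOn hp hK).norm
  have hGnn : ∀ t ∈ Ico (0:ℝ) 1, 0 ≤ G t := fun t ht => by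
    rw [← hG0]; exact hGm.monotoneOn ⟨le_rfl, zero_lt_one⟩ ht ht.1
  let e : ℝ → ℂ := fun s => ‖E s‖⁻¹ • E s
  have hec : Continuous e := (hγ.cont_vel.norm.inv₀ fun s => (hEn s).ne').smul hγ.cont_vel
  have hen : ∀ s, ‖e s‖ = 1 := fun s => by
    simp only [e]
    rw [norm_smul, norm_inv, norm_norm, inv_mul_cancel₀ (hEn s).ne']
  have helim : Tendsto e atTop (𝓝 (-Complex.I)) := by
    rw [tendsto_iff_norm_sub_tendsto_zero]
    have h1 : ∀ s, ‖e s - -Complex.I‖ = √(2 * ((‖E s‖ + (E s).im) / ‖E s‖)) := fun s => by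
      rw [← Real.sqrt_sq (norm_nonneg (e s - -Complex.I))]
      congr 1
      have h2 : (e s).re ^ 2 + (e s).im ^ 2 = 1 := by
        have := Complex.normSq_eq_norm_sq (e s)
        rw [hen, Complex.normSq_apply] at this
        linarith
      have h3 : (‖E s‖ + (E s).im) / ‖E s‖ = 1 + (e s).im := by
        simp only [e, Complex.smul_im, smul_eq_mul]
        have := (hEn s).ne'
        field_simp
      rw [h3, ← Complex.normSq_eq_norm_sq, Complex.normSq_apply]
      simp
      linarith
    simp only [h1]
    simpa using (hdir.const_mul 2).sqrt
  let d₀ : ℝ → ℂ := fun t => if t < 1 then L • e (G t) else L • -Complex.I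
  have hd₀ : ContinuousOn d₀ (Icc 0 1) := by
    intro t ht
    rcases ht.2.lt_or_eq with h | rfl
    · have h1 : ContinuousAt (fun t => L • e (G t)) t :=
        (ContinuousAt.comp (g := e) hec.continuousAt
          (hGd t ⟨ht.1, h⟩).continuousAt).const_smul L
      refine (h1.congr ?_).continuousWithinAt
      filter_upwards [Iio_mem_nhds h] with u hu
      exact (if_pos hu).symm
    · have h1 : Tendsto d₀ (𝓝[<] 1) (𝓝 (d₀ 1)) := by
        simp only [d₀, lt_irrefl, if_false]
        refine ((helim.comp hGlim).const_smul L).congr' ?_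
        filter_upwards [self_mem_nhdsWithin] with u hu
        exact (if_pos hu).symm
      have h2 : ContinuousWithinAt d₀ (Iic 1) 1 := by
        rw [← continuousWithinAt_Iio_iff_Iic]; exact h1
      exact h2.mono fun x hx => hx.2
  let d : ℝ → ℂ := IccExtend (zero_le_one : (0:ℝ) ≤ 1) ((Icc 0 1).domRestrict d₀)
  have hdc : Continuous d := (continuousOn_iff_continuous_domRestrict.1 hd₀).Icc_extend'
  have hd : ∀ t ∈ Icc (0:ℝ) 1, d t = d₀ t := fun t ht => IccExtend_of_mem _ _ ht
  let α : ℝ → ℂ := fun t => γ 0 + ∫ u in (0:ℝ)..t, d u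
  have hα : ∀ t, HasDerivAt α (d t) t := fun t =>
    (hdc.integral_hasStrictDerivAt 0 t).hasDerivAt.const_add (γ 0)
  let Γ : ℝ → ℂ := fun s => γ 0 + ∫ u in (0:ℝ)..s, E u
  have hΓ : ∀ s, HasDerivAt Γ (E s) s := fun s =>
    (hγ.cont_vel.integral_hasStrictDerivAt 0 s).hasDerivAt.const_add (γ 0)
  have hαγ : ∀ t ∈ Ico (0:ℝ) 1, α t = γ (G t) := by
    intro t ht
    have hder : ∀ u ∈ Icc 0 t, HasDerivAt (fun u => α u - Γ (G u)) 0 u := fun u hu => by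
      have hu1 : u < 1 := hu.2.trans_lt ht.2
      have h1 := (hΓ (G u)).scomp u (hGd u ⟨hu.1, hu1⟩)
      have h2 := (hα u).sub h1
      have h3 : d u - (L / ‖E (G u)‖) • E (G u) = 0 := by
        rw [hd u ⟨hu.1, hu1.le⟩]
        simp only [d₀, if_pos hu1, e, smul_smul, div_eq_mul_inv, sub_self]
      rw [h3] at h2
      exact h2
    have := constant_of_has_deriv_right_zero (f := fun u => α u - Γ (G u))
      (fun u hu => (hder u hu).continuousAt.continuousWithinAt)
      (fun u hu => (hder u ⟨hu.1, hu.2.le⟩).hasDerivWithinAt) t ⟨ht.1, le_rfl⟩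
    simp only [α, Γ, hG0, intervalIntegral.integral_same, add_zero, sub_self] at this
    rw [hγ.eq_integral _ (hGnn t ht)]
    exact sub_eq_zero.1 this
  have hα1 : Tendsto α (𝓝[<] 1) (𝓝 (α 1)) := (hα 1).continuousAt.tendsto.mono_left nhdsWithin_le_nhds
  have hmem : Ico (0:ℝ) 1 ∈ 𝓝[<] (1:ℝ) := Ico_mem_nhdsLT zero_lt_one
  have hα1' : Tendsto (fun t => γ (G t)) (𝓝[<] 1) (𝓝 (α 1)) :=
    hα1.congr' (by filter_upwards [hmem] with t ht using hαγ t ht)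
  refine ⟨L, G, α, d, hL, hG0, hGm, fun t ht => ?_, hαγ, hdc, hα, fun t ht => ?_, ?_, ?_, ?_⟩
  · rw [← hγ.norm_eq (hGnn t ht)]; exact hGd t ht
  · rw [hd t ht]
    simp only [d₀]
    split_ifs
    · rw [norm_smul, hen, mul_one, Real.norm_of_nonneg hL.le]
    · rw [norm_smul, norm_neg, Complex.norm_I, mul_one, Real.norm_of_nonneg hL.le]
  · rw [hd 1 ⟨zero_le_one, le_rfl⟩]
    simp [d₀]
  · exact tendsto_nhds_unique ((Complex.continuous_im.tendsto _).comp hα1')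
      ((hK.tendsto_im hp hγ.im_nonneg).comp hGlim)
  · exact ge_of_tendsto' ((Complex.continuous_re.tendsto _).comp hα1') fun t => hγ.le_re _

end Curve

lemma exists_lipschitzOnWith_Icc {f f' : ℝ → ℝ} {a b : ℝ}
    (hf : ∀ t ∈ Icc a b, HasDerivWithinAt f (f' t) (Icc a b) t) (hf' : ContinuousOn f' (Icc a b)) :
    ∃ K, LipschitzOnWith K f (Icc a b) := by
  obtain ⟨R, hR⟩ := isCompact_Icc.exists_bound_of_continuousOn hf'
  refine ⟨R.toNNReal, (convex_Icc a b).lipschitzOnWith_of_nnnorm_hasDerivWithin_le hf fun t ht => ?_⟩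
  rw [← NNReal.coe_le_coe, coe_nnnorm]
  exact (hR t ht).trans (Real.le_coe_toNNReal R)

section Picone

variable {N : ℕ} {p c L : ℝ}

lemma young_mul_rpow {m u k : ℝ} (hp : 1 < p) (hm : 0 ≤ m) (hu : 0 ≤ u) (hk : 0 < k) :
    p * (m ^ (p - 1) * u) ≤ u ^ p * k ^ (p - 1) + (p - 1) * (m ^ p / k) := by
  have hp0 : 0 < p := by linarith
  have hp1 : 0 < p - 1 := by linarith
  have h := Real.young_inequality_of_nonneg (mul_nonneg hu hk.le) (Real.rpow_nonneg hm (p - 1))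
    (Real.HolderConjugate.conjExponent hp)
  rw [Real.conjExponent, ← Real.rpow_mul hm, mul_div_cancel₀ _ hp1.ne', Real.mul_rpow hu hk.le,
    show k ^ p = k ^ (p - 1) * k by rw [← Real.rpow_add_one hk.ne']; ring_nf] at h
  have h2 := mul_le_mul_of_nonneg_left h hp0.le
  rw [← mul_le_mul_iff_left₀ hk]
  calc p * (m ^ (p - 1) * u) * k = p * (u * k * m ^ (p - 1)) := by ring
    _ ≤ _ := h2
    _ = _ := by field_simp

lemma picone_pointwise (hN : 1 ≤ N) (hp : 2 * (N : ℝ) + 1 ≤ p) (hc : 0 ≤ c) (hL : 0 < L)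
    {v μ : ℝ} (hv : 0 < v) (hμ : 0 < μ) (w w' : ℝ) :
    -(p - 1) * μ ^ (-(p - 1) - 1) * (L / rate N p c v μ) * |w| ^ p +
        μ ^ (-(p - 1)) * (p * |w| ^ (p - 2) * w * w') ≤
      |w'| ^ p * v ^ N * L ^ (1 - p) - c * (p - 1) * (|w| ^ p * v ^ N * L) := by
  have hp3 := three_le_of_exponent hN hp
  have hva : 0 < v ^ volExp N p := Real.rpow_pos_of_pos hv _
  have hk : (v ^ volExp N p / L) ^ (p - 1) = v ^ N * L ^ (1 - p) := by
    rw [Real.div_rpow hva.le hL.le, ← Real.rpow_mul hv.le, volExp_mul hN hp, Real.rpow_natCast,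
      show 1 - p = -(p - 1) by ring, Real.rpow_neg hL.le, div_eq_mul_inv]
  have hy := young_mul_rpow (p := p) (by linarith) (div_nonneg (abs_nonneg w) hμ.le)
    (abs_nonneg w') (div_pos hva hL)
  rw [hk, Real.div_rpow (abs_nonneg w) hμ.le, Real.div_rpow (abs_nonneg w) hμ.le] at hy
  have h1 : p * |w| ^ (p - 2) * w * w' ≤ p * (|w| ^ (p - 1) * |w'|) := by
    have h2 : w * w' ≤ |w| * |w'| := by rw [← abs_mul]; exact le_abs_self _
    have h3 : |w| ^ (p - 1) = |w| ^ (p - 2) * |w| := by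
      rw [← Real.rpow_add_one' (abs_nonneg w) (by linarith)]; ring_nf
    rw [h3]
    have := mul_le_mul_of_nonneg_left h2
      (show 0 ≤ p * |w| ^ (p - 2) from mul_nonneg (by linarith) (Real.rpow_nonneg (abs_nonneg w) _))
    linarith
  have hμp : 0 < μ ^ (-(p - 1)) := Real.rpow_pos_of_pos hμ _
  have h4 := mul_le_mul_of_nonneg_left h1 hμp.le
  have h5 : μ ^ (-(p - 1)) * (p * (|w| ^ (p - 1) * |w'|)) =
      p * (|w| ^ (p - 1) / μ ^ (p - 1) * |w'|) := by
    rw [Real.rpow_neg hμ.le]; ring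
  have h6 : -(p - 1) * μ ^ (-(p - 1) - 1) * (L / rate N p c v μ) * |w| ^ p =
      -(c * (p - 1) * (|w| ^ p * v ^ N * L)) -
        (p - 1) * (|w| ^ p / μ ^ p / (v ^ volExp N p / L)) := by
    rw [div_eq_mul_inv L, inv_rate hc hv hμ.le, show -(p - 1) - 1 = -p by ring, Real.rpow_neg hμ.le]
    have : μ ^ p ≠ 0 := (Real.rpow_pos_of_pos hμ p).ne'
    field_simp
    ring
  linarith

/-- Picone's inequality on a compact subinterval of `(0, 1)`. -/
lemma picone_Icc (hN : 1 ≤ N) (hp : 2 * (N : ℝ) + 1 ≤ p) (hc : 0 ≤ c) (hL : 0 < L)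
    {V G w : ℝ → ℝ} {K : NNReal} {a b : ℝ} (ha : 0 < a) (hab : a ≤ b) (hb : b < 1)
    (hV : ∀ t ∈ Icc a b, 0 < V t) (hVc : ContinuousOn V (Icc a b)) (hG0 : ∀ t ∈ Icc a b, 0 < G t)
    (hG : ∀ t ∈ Icc a b, HasDerivAt G (L / rate N p c (V t) (G t)) t)
    (hw : LipschitzOnWith K w (Icc 0 1))
    (hnum : IntervalIntegrable (fun t => |derivWithin w (Icc 0 1) t| ^ p * V t ^ N * L ^ (1 - p))
      volume a b)
    (hden : IntervalIntegrable (fun t => |w t| ^ p * V t ^ N * L) volume a b) :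
    -(G a ^ (-(p - 1)) * |w a| ^ p) ≤
      ∫ t in a..b, (|derivWithin w (Icc 0 1) t| ^ p * V t ^ N * L ^ (1 - p) -
        c * (p - 1) * (|w t| ^ p * V t ^ N * L)) := by
  have hp3 := three_le_of_exponent hN hp
  have hsub : Icc a b ⊆ Icc 0 1 := Icc_subset_Icc ha.le hb.le
  have hGc : ContinuousOn G (Icc a b) := fun t ht => (hG t ht).continuousAt.continuousWithinAt
  have hwc : ContinuousOn w (Icc a b) := hw.continuousOn.mono hsub
  have hq : ∀ t ∈ Icc a b, HasDerivAt (fun t => G t ^ (-(p - 1)))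
      (-(p - 1) * G t ^ (-(p - 1) - 1) * (L / rate N p c (V t) (G t))) t := fun t ht => by
    convert! (hG t ht).rpow_const (p := -(p - 1)) (Or.inl (hG0 t ht).ne') using 1
    ring
  have hratec : ContinuousOn (fun t => rate N p c (V t) (G t)) (Icc a b) := by
    simp only [continuousOn_iff_continuous_domRestrict] at hVc hGc ⊢
    exact continuous_rate hN hp hc hVc hGc fun t => (hV t t.2).le
  have hqAC : AbsolutelyContinuousOnInterval (fun t => G t ^ (-(p - 1))) a b := by
    obtain ⟨K₁, hK₁⟩ := exists_lipschitzOnWith_Icc (fun t ht => (hq t ht).hasDerivWithinAt) (by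
      refine ContinuousOn.mul (continuousOn_const.mul (hGc.rpow_const fun t ht =>
        Or.inl (hG0 t ht).ne')) (continuousOn_const.div hratec fun t ht =>
          (rate_pos hc (hV t ht) _).ne'))
    rw [← uIcc_of_le hab] at hK₁
    exact hK₁.absolutelyContinuousOnInterval
  have hwAC : AbsolutelyContinuousOnInterval (fun t => |w t| ^ p) a b := by
    obtain ⟨R, hR⟩ := isCompact_Icc.exists_bound_of_continuousOn hwc
    obtain ⟨K₂, hK₂⟩ := exists_lipschitzOnWith_Icc (a := -R) (b := R)
      (fun x _ => (hasDerivAt_abs_rpow x (p := p) (by linarith)).hasDerivWithinAt) (by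
        refine Continuous.continuousOn ?_
        exact (continuous_const.mul (continuous_abs.rpow_const fun _ => Or.inr (by linarith))).mul
          continuous_id)
    have h := hK₂.comp (hw.mono hsub) fun t ht => abs_le.1 (hR t ht)
    rw [← uIcc_of_le hab] at h
    exact h.absolutelyContinuousOnInterval
  have hAC := hqAC.mul hwAC
  have hint := hAC.intervalIntegrable_deriv
  have hFTC := hAC.integral_deriv_eq_sub
  have hle : ∫ t in a..b, deriv ((fun t => G t ^ (-(p - 1))) * fun t => |w t| ^ p) t ≤
      ∫ t in a..b, (|derivWithin w (Icc 0 1) t| ^ p * V t ^ N * L ^ (1 - p) -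
        c * (p - 1) * (|w t| ^ p * V t ^ N * L)) := by
    refine intervalIntegral.integral_mono_ae_restrict hab hint (hnum.sub (hden.const_mul _)) ?_
    have h1 := hw.ae_differentiableWithinAt_real measurableSet_Icc
    have h2 : ∀ᵐ t ∂volume.restrict (Icc a b), DifferentiableWithinAt ℝ w (Icc 0 1) t :=
      ae_restrict_of_ae_restrict_of_subset hsub h1
    filter_upwards [h2, ae_restrict_mem measurableSet_Icc] with t ht htm
    have htn : Icc (0:ℝ) 1 ∈ 𝓝 t := Icc_mem_nhds (ha.trans_le htm.1) (htm.2.trans_lt hb)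
    have hwd : HasDerivAt w (derivWithin w (Icc 0 1) t) t := ht.hasDerivWithinAt.hasDerivAt htn
    have hd := (hq t htm).mul ((hasDerivAt_abs_rpow (w t) (p := p) (by linarith)).comp t hwd)
    have hd' : deriv ((fun t => G t ^ (-(p - 1))) * fun t => |w t| ^ p) t = _ := hd.deriv
    rw [hd']
    exact picone_pointwise hN hp hc hL (hV t htm) (hG0 t htm) (w t) _
  rw [hFTC] at hle
  refine le_trans ?_ hle
  simp only [Pi.mul_apply]
  have := mul_nonneg (Real.rpow_nonneg (hG0 b ⟨hab, le_rfl⟩).le (-(p - 1)))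
    (Real.rpow_nonneg (abs_nonneg (w b)) p)
  linarith

/-- Picone's inequality: the clock bounds the Rayleigh quotient of its curve from below. -/
lemma picone (hN : 1 ≤ N) (hp : 2 * (N : ℝ) + 1 ≤ p) (hc : 0 ≤ c) (hL : 0 < L)
    {V G w : ℝ → ℝ} {K : NNReal}
    (hV : ∀ t ∈ Ico (0:ℝ) 1, 0 < V t) (hVc : ContinuousOn V (Ico 0 1)) (hG00 : G 0 = 0)
    (hG0 : ∀ t ∈ Ioo (0:ℝ) 1, 0 < G t)
    (hG : ∀ t ∈ Ico (0:ℝ) 1, HasDerivAt G (L / rate N p c (V t) (G t)) t)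
    (hw : LipschitzOnWith K w (Icc 0 1)) (hw0 : w 0 = 0)
    (hnum : IntervalIntegrable (fun t => |derivWithin w (Icc 0 1) t| ^ p * V t ^ N * L ^ (1 - p))
      volume 0 1)
    (hden : IntervalIntegrable (fun t => |w t| ^ p * V t ^ N * L) volume 0 1) :
    c * (p - 1) * (∫ t in (0:ℝ)..1, |w t| ^ p * V t ^ N * L) ≤
      ∫ t in (0:ℝ)..1, |derivWithin w (Icc 0 1) t| ^ p * V t ^ N * L ^ (1 - p) := by
  have hp3 := three_le_of_exponent hN hp
  set f : ℝ → ℝ := fun t => |derivWithin w (Icc 0 1) t| ^ p * V t ^ N * L ^ (1 - p) -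
        c * (p - 1) * (|w t| ^ p * V t ^ N * L) with hf
  have hfi : IntervalIntegrable f volume 0 1 := hnum.sub (hden.const_mul _)
  suffices h : 0 ≤ ∫ t in (0:ℝ)..1, f t by
    rw [hf, intervalIntegral.integral_sub hnum (hden.const_mul _),
      intervalIntegral.integral_const_mul] at h
    linarith
  -- the boundary term at the left end
  obtain ⟨A, hA⟩ : ∃ A : ℝ, ∀ᶠ δ in 𝓝[>] (0:ℝ), G δ ^ (-(p - 1)) * |w δ| ^ p ≤ A * δ := by
    set k := L / rate N p c (V 0) (G 0) with hk
    have h0 : (0:ℝ) ∈ Ico (0:ℝ) 1 := ⟨le_rfl, zero_lt_one⟩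
    have hk0 : 0 < k := div_pos hL (rate_pos hc (hV 0 h0) _)
    have h1 : Tendsto (fun δ => G δ / δ) (𝓝[>] 0) (𝓝 k) := by
      have := hasDerivWithinAt_iff_tendsto_slope.1 ((hG 0 h0).hasDerivWithinAt (s := Ici 0))
      rw [Ici_sdiff_left] at this
      refine this.congr fun t => ?_
      rw [slope_def_field, hG00, sub_zero, sub_zero]
    refine ⟨(2 * K / k) ^ (p - 1) * K, ?_⟩
    filter_upwards [h1.eventually (lt_mem_nhds (half_lt_self hk0)), Ioo_mem_nhdsGT zero_lt_one]
      with δ h2 h3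
    rw [lt_div_iff₀ h3.1] at h2
    have hwδ : |w δ| ≤ K * δ := by
      have := hw.dist_le_mul δ ⟨h3.1.le, h3.2.le⟩ 0 ⟨le_rfl, zero_le_one⟩
      rwa [hw0, Real.dist_eq, Real.dist_eq, sub_zero, sub_zero, abs_of_pos h3.1] at this
    have hGδ := hG0 δ h3
    have hr : |w δ| / G δ ≤ 2 * K / k := by
      rw [div_le_div_iff₀ hGδ hk0]
      have := mul_le_mul_of_nonneg_left h2.le K.2
      have h5 := mul_le_mul_of_nonneg_right hwδ hk0.le
      nlinarith
    calc G δ ^ (-(p - 1)) * |w δ| ^ p = (|w δ| / G δ) ^ (p - 1) * |w δ| := by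
          rw [Real.div_rpow (abs_nonneg _) hGδ.le, Real.rpow_neg hGδ.le,
            show |w δ| ^ p = |w δ| ^ (p - 1) * |w δ| by
              rw [← Real.rpow_add_one' (abs_nonneg _) (by linarith)]; ring_nf]
          ring
      _ ≤ (2 * K / k) ^ (p - 1) * (K * δ) := by
          gcongr
          linarith
      _ = _ := by ring
  have hlimA : Tendsto (fun δ : ℝ => -(A * δ)) (𝓝[>] 0) (𝓝 0) := by
    have : Tendsto (fun δ : ℝ => -(A * δ)) (𝓝 0) (𝓝 (-(A * 0))) :=
      (continuous_const.mul continuous_id).neg.tendsto 0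
    rw [mul_zero, neg_zero] at this
    exact this.mono_left nhdsWithin_le_nhds
  have hlim : Tendsto (fun δ : ℝ => ∫ t in δ..(1 - δ), f t) (𝓝[>] 0) (𝓝 (∫ t in (0:ℝ)..1, f t)) := by
    have hprim := intervalIntegral.continuousOn_primitive_interval' hfi (left_mem_uIcc)
    rw [uIcc_of_le zero_le_one] at hprim
    have h1 : Tendsto (fun δ : ℝ => ∫ t in (0:ℝ)..δ, f t) (𝓝[>] 0) (𝓝 (∫ t in (0:ℝ)..0, f t)) := by
      refine (hprim 0 ⟨le_rfl, zero_le_one⟩).tendsto.comp (tendsto_nhdsWithin_iff.2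
        ⟨nhdsWithin_le_nhds, ?_⟩)
      filter_upwards [Ioo_mem_nhdsGT (zero_lt_one' ℝ)] with δ h using ⟨h.1.le, h.2.le⟩
    have h2 : Tendsto (fun δ : ℝ => ∫ t in (0:ℝ)..(1 - δ), f t) (𝓝[>] 0)
        (𝓝 (∫ t in (0:ℝ)..1, f t)) := by
      refine (hprim 1 ⟨zero_le_one, le_rfl⟩).tendsto.comp (tendsto_nhdsWithin_iff.2 ⟨?_, ?_⟩)
      · have : Tendsto (fun δ : ℝ => 1 - δ) (𝓝 0) (𝓝 (1 - 0)) :=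
          (continuous_const.sub continuous_id).tendsto 0
        rw [sub_zero] at this
        exact this.mono_left nhdsWithin_le_nhds
      · filter_upwards [Ioo_mem_nhdsGT (zero_lt_one' ℝ)] with δ h
        exact ⟨by linarith [h.2], by linarith [h.1]⟩
    have h3 := h2.sub h1
    rw [intervalIntegral.integral_same, sub_zero] at h3
    refine h3.congr' ?_
    filter_upwards [Ioo_mem_nhdsGT (zero_lt_one' ℝ)] with δ h
    refine intervalIntegral.integral_interval_sub_left (hfi.mono_set ?_) (hfi.mono_set ?_) <;>
    · rw [uIcc_of_le (by linarith [h.1, h.2]), uIcc_of_le zero_le_one]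
      exact Icc_subset_Icc le_rfl (by linarith [h.1, h.2])
  refine le_of_tendsto_of_tendsto hlimA hlim ?_
  filter_upwards [hA, Ioo_mem_nhdsGT (show (0:ℝ) < 1 / 2 by norm_num)] with δ h1 h2
  have hab : δ ≤ 1 - δ := by linarith [h2.2]
  have hb : 1 - δ < 1 := by linarith [h2.1]
  have hsub : uIcc δ (1 - δ) ⊆ uIcc 0 1 := by
    rw [uIcc_of_le hab, uIcc_of_le zero_le_one]
    exact Icc_subset_Icc h2.1.le hb.le
  have hI : ∀ t ∈ Icc δ (1 - δ), t ∈ Ioo (0:ℝ) 1 := fun t ht =>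
    ⟨h2.1.trans_le ht.1, ht.2.trans_lt hb⟩
  have := picone_Icc hN hp hc hL h2.1 hab hb (fun t ht => hV t (Ioo_subset_Ico_self (hI t ht)))
    (hVc.mono fun t ht => Ioo_subset_Ico_self (hI t ht)) (fun t ht => hG0 t (hI t ht))
    (fun t ht => hG t (Ioo_subset_Ico_self (hI t ht))) hw (hnum.mono_set hsub)
    (hden.mono_set hsub)
  linarith

end Picone

section Clock

lemma exists_antideriv_Icc {g : ℝ → ℝ} {a b : ℝ} (hab : a ≤ b) (hg : ContinuousOn g (Icc a b)) :
    ∃ J : ℝ → ℝ, J a = 0 ∧ ∀ t ∈ Icc a b, HasDerivAt J (g t) t := by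
  have hc : Continuous (IccExtend hab ((Icc a b).domRestrict g)) :=
    (continuousOn_iff_continuous_domRestrict.1 hg).Icc_extend'
  refine ⟨fun t => ∫ s in a..t, IccExtend hab ((Icc a b).domRestrict g) s,
    intervalIntegral.integral_same, fun t ht => ?_⟩
  have := (hc.integral_hasStrictDerivAt a t).hasDerivAt
  rwa [IccExtend_of_mem _ _ ht] at this

/-- Global solvability on `[0, 1]` of the truncated clock equation `ν' = q (ν + I)₊ᵖ`. -/
lemma exists_truncated_clock {p B : ℝ} (hp : 1 ≤ p) (hB : 0 ≤ B) {q I : ℝ → ℝ}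
    (hq : ContinuousOn q (Icc 0 1))
    (hI : ContinuousOn I (Icc 0 1)) :
    ∃ ν : ℝ → ℝ, ν 0 = 0 ∧ ∀ t ∈ Icc (0:ℝ) 1,
      HasDerivWithinAt ν (q t * (max 0 (min (ν t + I t) B)) ^ p) (Icc 0 1) t := by
  obtain ⟨Q, hQ⟩ := isCompact_Icc.exists_bound_of_continuousOn hq
  have hQ0 : 0 ≤ Q := (norm_nonneg _).trans (hQ 0 ⟨le_rfl, zero_le_one⟩)
  obtain ⟨K, hK⟩ : ∃ K, LipschitzOnWith K (fun y : ℝ => y ^ p) (Icc 0 B) := by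
    refine exists_lipschitzOnWith_Icc (f' := fun y => p * y ^ (p - 1))
      (fun y _ => (Real.hasDerivAt_rpow_const (Or.inr hp)).hasDerivWithinAt) ?_
    exact (continuous_const.mul (Real.continuous_rpow_const (by linarith))).continuousOn
  have hmem : ∀ y : ℝ, max 0 (min y B) ∈ Icc 0 B := fun y =>
    ⟨le_max_left _ _, max_le hB (min_le_right _ _)⟩
  have hcl : ∀ x y z : ℝ, |max 0 (min (x + z) B) - max 0 (min (y + z) B)| ≤ |x - y| := by
    intro x y z
    have h1 := abs_max_sub_max_le_max 0 (min (x + z) B) 0 (min (y + z) B)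
    have h2 := abs_min_sub_min_le_max (x + z) B (y + z) B
    rw [sub_self, abs_zero, max_eq_right (abs_nonneg (min (x + z) B - min (y + z) B))] at h1
    rw [sub_self, abs_zero, max_eq_left (abs_nonneg (x + z - (y + z))), add_sub_add_right_eq_sub] at h2
    exact h1.trans h2
  have hpl : IsPicardLindelof (fun t x => q t * (max 0 (min (x + I t) B)) ^ p)
      (⟨0, ⟨le_rfl, zero_le_one⟩⟩ : Icc (0:ℝ) 1) (0:ℝ) (Real.toNNReal (Q * B ^ p)) 0
      (Real.toNNReal (Q * B ^ p)) (Real.toNNReal Q * K) := by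
    refine ⟨fun t ht => LipschitzWith.lipschitzOnWith (LipschitzWith.of_dist_le_mul fun x y => ?_),
      fun x _ => ?_, fun t ht x _ => ?_, ?_⟩
    · have h1 := hK.dist_le_mul _ (hmem (x + I t)) _ (hmem (y + I t))
      rw [Real.dist_eq, ← mul_sub, abs_mul, NNReal.coe_mul, Real.coe_toNNReal _ hQ0, mul_assoc]
      rw [Real.dist_eq, Real.dist_eq] at h1
      refine mul_le_mul (hQ t ht) (h1.trans ?_) (abs_nonneg _) hQ0
      rw [Real.dist_eq]
      exact mul_le_mul_of_nonneg_left (hcl _ _ _) K.2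
    · exact hq.mul (((continuousOn_const.sup
        ((continuousOn_const.add hI).inf continuousOn_const)).rpow_const
        fun _ _ => Or.inr (by linarith)))
    · rw [Real.coe_toNNReal _ (mul_nonneg hQ0 (Real.rpow_nonneg hB _)), norm_mul]
      refine mul_le_mul (hQ t ht) ?_ (norm_nonneg _) hQ0
      rw [Real.norm_eq_abs, abs_of_nonneg (Real.rpow_nonneg (hmem _).1 _)]
      exact Real.rpow_le_rpow (hmem _).1 (hmem _).2 (by linarith)
    · simp
  obtain ⟨ν, h0, hν⟩ := hpl.exists_eq_forall_mem_Icc_hasDerivWithinAt₀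
  exact ⟨ν, h0, hν⟩

end Clock

section TestFunction

variable {N : ℕ} {p c L B t₁ : ℝ} {V I M : ℝ → ℝ}

lemma rpow_cancel (hN : 1 ≤ N) (hp : 2 * (N : ℝ) + 1 ≤ p) {L v e : ℝ} (hL : 0 < L) (hv : 0 < v)
    (he : 0 < e) :
    (L * (v ^ volExp N p)⁻¹ * e) ^ p * v ^ N * L ^ (1 - p) =
      L * (v ^ volExp N p)⁻¹ * e ^ p := by
  have h1 : (0:ℝ) < v ^ volExp N p := Real.rpow_pos_of_pos hv _
  rw [Real.mul_rpow (by positivity) he.le, Real.mul_rpow hL.le (by positivity)]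
  have h2 : v ^ N = (v ^ volExp N p) ^ (p - 1) := by
    rw [← Real.rpow_mul hv.le, volExp_mul hN hp, Real.rpow_natCast]
  have h3 : (v ^ volExp N p)⁻¹ ^ p * v ^ N = (v ^ volExp N p)⁻¹ := by
    rw [h2, Real.inv_rpow h1.le, Real.rpow_sub h1, Real.rpow_one]
    have := Real.rpow_pos_of_pos h1 p
    field_simp
  have h4 : L ^ p * L ^ (1 - p) = L := by
    rw [← Real.rpow_add hL]; simp
  calc _ = (L ^ p * L ^ (1 - p)) * ((v ^ volExp N p)⁻¹ ^ p * v ^ N) * e ^ p := by ring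
    _ = _ := by rw [h3, h4]

/-- Data of a clock that reaches the level `B` at time `t₁ < 1`, damped by the exponential of the
growth term, gives the profile of a test function. -/
lemma exists_profile (hN : 1 ≤ N) (hp : 2 * (N : ℝ) + 1 ≤ p) (hc : 0 < c) (hL : 0 < L)
    (hV : Continuous V) (hVpos : ∀ t ∈ Ico (0:ℝ) 1, 0 < V t) (hI0 : I 0 = 0)
    (hI : ∀ t ∈ Ico (0:ℝ) 1, HasDerivAt I (L * (V t ^ volExp N p)⁻¹) t)
    (hB : 0 < B) (ht₁ : t₁ ∈ Ioo (0:ℝ) 1) (hM0 : M 0 = 0) (hMB : M t₁ = B)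
    (hMnn : ∀ t ∈ Icc 0 t₁, 0 ≤ M t)
    (hM : ∀ t ∈ Icc 0 t₁,
      HasDerivWithinAt M (L * ((V t ^ volExp N p)⁻¹ + c * V t ^ N * M t ^ p)) (Icc 0 t₁) t) :
    ∃ φ e : ℝ → ℝ, φ 0 = 0 ∧ 0 < φ t₁ ∧ ContinuousOn e (Icc 0 t₁) ∧ (∀ t ∈ Icc 0 t₁, 0 < e t) ∧
      (∀ t ∈ Icc 0 t₁, HasDerivWithinAt φ (L * (V t ^ volExp N p)⁻¹ * e t) (Icc 0 t₁) t) ∧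
      (∀ t ∈ Icc 0 t₁, φ t₁ * I t ≤ φ t * I t₁) ∧
      ∫ t in (0:ℝ)..t₁, L * (V t ^ volExp N p)⁻¹ * e t ^ p =
        c * (p - 1) * (∫ t in (0:ℝ)..t₁, φ t ^ p * V t ^ N * L) + B ^ (1 - p) * φ t₁ ^ p := by
  have hp3 := three_le_of_exponent hN hp
  have hMc : ContinuousOn M (Icc 0 t₁) := fun t ht => (hM t ht).continuousWithinAt
  have hlt : ∀ t ∈ Icc 0 t₁, t ∈ Ico (0:ℝ) 1 := fun t ht => ⟨ht.1, ht.2.trans_lt ht₁.2⟩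
  have hVN : ContinuousOn (fun t => c * L * V t ^ N * M t ^ (p - 1)) (Icc 0 t₁) :=
    ((continuousOn_const.mul (hV.pow N).continuousOn).mul
      (hMc.rpow_const fun _ _ => Or.inr (by linarith)))
  obtain ⟨J, hJ0, hJ⟩ := exists_antideriv_Icc ht₁.1.le hVN
  have hJc : ContinuousOn J (Icc 0 t₁) := fun t ht => (hJ t ht).continuousAt.continuousWithinAt
  have hJm : MonotoneOn J (Icc 0 t₁) := by
    refine monotoneOn_of_deriv_nonneg (convex_Icc _ _) hJc (fun t ht => ?_) (fun t ht => ?_)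
    · exact (hJ t (interior_subset ht)).differentiableAt.differentiableWithinAt
    · have ht' := interior_subset ht
      rw [(hJ t ht').deriv]
      have := hVpos t (hlt t ht')
      have := Real.rpow_nonneg (hMnn t ht') (p - 1)
      positivity
  have hVa : ∀ t ∈ Icc 0 t₁, 0 < L * (V t ^ volExp N p)⁻¹ := fun t ht =>
    mul_pos hL (inv_pos.2 (Real.rpow_pos_of_pos (hVpos t (hlt t ht)) _))
  have hVac : ContinuousOn (fun t => L * (V t ^ volExp N p)⁻¹) (Icc 0 t₁) :=
    continuousOn_const.mul ((hV.continuousOn.rpow_const fun t ht =>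
      Or.inl (hVpos t (hlt t ht)).ne').inv₀ fun t ht =>
        (Real.rpow_pos_of_pos (hVpos t (hlt t ht)) _).ne')
  have hIc : ContinuousOn I (Icc 0 t₁) := fun t ht =>
    (hI t (hlt t ht)).continuousAt.continuousWithinAt
  have hMp : ∀ t ∈ Icc 0 t₁, M t * M t ^ (p - 1) = M t ^ p := fun t ht => by
    rw [mul_comm, ← Real.rpow_add_one' (hMnn t ht) (by linarith)]; ring_nf
  have hec : ContinuousOn (fun t => Real.exp (-J t)) (Icc 0 t₁) := hJc.neg.rexp
  have hφ : ∀ t ∈ Icc 0 t₁, HasDerivWithinAt (fun t => M t * Real.exp (-J t))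
      (L * (V t ^ volExp N p)⁻¹ * Real.exp (-J t)) (Icc 0 t₁) t := by
    intro t ht
    have h := (hM t ht).mul (hJ t ht).neg.exp.hasDerivWithinAt
    convert! h using 1
    simp only [Pi.neg_apply]
    rw [← hMp t ht]; ring
  have hφc : ContinuousOn (fun t => M t * Real.exp (-J t)) (Icc 0 t₁) := hMc.mul hec
  have h1mem : t₁ ∈ Icc 0 t₁ := ⟨ht₁.1.le, le_rfl⟩
  have h0mem : (0:ℝ) ∈ Icc 0 t₁ := ⟨le_rfl, ht₁.1.le⟩
  have hint : ∀ a ∈ Icc 0 t₁, ∀ b ∈ Icc 0 t₁, ∀ t ∈ Ioo a b, t ∈ Icc 0 t₁ ∧ Icc 0 t₁ ∈ 𝓝 t :=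
    fun a ha b hb t ht => ⟨⟨ha.1.trans ht.1.le, ht.2.le.trans hb.2⟩,
      Icc_mem_nhds (ha.1.trans_lt ht.1) (ht.2.trans_le hb.2)⟩
  refine ⟨fun t => M t * Real.exp (-J t), fun t => Real.exp (-J t), by simp [hM0],
    by dsimp only; rw [hMB]; positivity, hec, fun t _ => Real.exp_pos _, hφ, fun t ht => ?_, ?_⟩
  · have hIm : I 0 ≤ I t := by
      have hmono : MonotoneOn I (Icc 0 t₁) := by
        refine monotoneOn_of_deriv_nonneg (convex_Icc _ _) hIc (fun t ht => ?_) (fun t ht => ?_)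
        · exact (hI t (hlt t (interior_subset ht))).differentiableAt.differentiableWithinAt
        · rw [(hI t (hlt t (interior_subset ht))).deriv]
          exact (hVa t (interior_subset ht)).le
      exact hmono h0mem ht ht.1
    have hImt : I t ≤ I t₁ := by
      have hmono : MonotoneOn I (Icc 0 t₁) := by
        refine monotoneOn_of_deriv_nonneg (convex_Icc _ _) hIc (fun t ht => ?_) (fun t ht => ?_)
        · exact (hI t (hlt t (interior_subset ht))).differentiableAt.differentiableWithinAt
        · rw [(hI t (hlt t (interior_subset ht))).deriv]
          exact (hVa t (interior_subset ht)).le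
      exact hmono ht h1mem ht.2
    have hD : ∀ s ∈ Ioo 0 t₁, HasDerivAt
        (fun s => M s * Real.exp (-J s) - Real.exp (-J t) * I s)
        (L * (V s ^ volExp N p)⁻¹ * (Real.exp (-J s) - Real.exp (-J t))) s := by
      intro s hs
      obtain ⟨h1, h2⟩ := hint 0 h0mem t₁ h1mem s hs
      have h := ((hφ s h1).hasDerivAt h2).sub ((hI s (hlt s h1)).const_mul (Real.exp (-J t)))
      convert! h using 1
      ring
    have hDc : ContinuousOn (fun s => M s * Real.exp (-J s) - Real.exp (-J t) * I s)
        (Icc 0 t₁) := hφc.sub (continuousOn_const.mul hIc)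
    have hlow : M 0 * Real.exp (-J 0) - Real.exp (-J t) * I 0 ≤
        M t * Real.exp (-J t) - Real.exp (-J t) * I t := by
      refine monotoneOn_of_deriv_nonneg (convex_Icc 0 t)
        (hDc.mono (Icc_subset_Icc le_rfl ht.2)) (fun s hs => ?_) (fun s hs => ?_)
        ⟨le_rfl, ht.1⟩ ⟨ht.1, le_rfl⟩ ht.1
      · rw [interior_Icc] at hs
        exact (hD s ⟨hs.1, hs.2.trans_le ht.2⟩).differentiableAt.differentiableWithinAt
      · rw [interior_Icc] at hs
        have hs' : s ∈ Icc 0 t₁ := ⟨hs.1.le, (hs.2.trans_le ht.2).le⟩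
        rw [(hD s ⟨hs.1, hs.2.trans_le ht.2⟩).deriv]
        exact mul_nonneg (hVa s hs').le (sub_nonneg.2 (Real.exp_le_exp.2
          (neg_le_neg (hJm hs' ht hs.2.le))))
    have hupp : M t₁ * Real.exp (-J t₁) - Real.exp (-J t) * I t₁ ≤
        M t * Real.exp (-J t) - Real.exp (-J t) * I t := by
      refine antitoneOn_of_deriv_nonpos (convex_Icc t t₁)
        (hDc.mono (Icc_subset_Icc ht.1 le_rfl)) (fun s hs => ?_) (fun s hs => ?_)
        ⟨le_rfl, ht.2⟩ ⟨ht.2, le_rfl⟩ ht.2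
      · rw [interior_Icc] at hs
        exact (hD s ⟨ht.1.trans_lt hs.1, hs.2⟩).differentiableAt.differentiableWithinAt
      · rw [interior_Icc] at hs
        have hs' : s ∈ Icc 0 t₁ := ⟨(ht.1.trans_lt hs.1).le, hs.2.le⟩
        rw [(hD s ⟨ht.1.trans_lt hs.1, hs.2⟩).deriv]
        exact mul_nonpos_of_nonneg_of_nonpos (hVa s hs').le (sub_nonpos.2 (Real.exp_le_exp.2
          (neg_le_neg (hJm ht hs' hs.1.le))))
    rw [hM0, hI0] at hlow
    rw [hI0] at hIm
    have h1 : M t₁ * Real.exp (-J t₁) * I t ≤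
        (M t * Real.exp (-J t) + Real.exp (-J t) * (I t₁ - I t)) * I t :=
      mul_le_mul_of_nonneg_right (by linarith) hIm
    have h2 : Real.exp (-J t) * I t * (I t₁ - I t) ≤ M t * Real.exp (-J t) * (I t₁ - I t) :=
      mul_le_mul_of_nonneg_right (by linarith) (by linarith)
    dsimp only
    linarith
  · dsimp only
    have hexp : ∀ t, Real.exp (-J t) ^ p = Real.exp (-(p * J t)) := fun t => by
      rw [← Real.exp_mul]; ring_nf
    have hd : ∀ t ∈ Icc 0 t₁, HasDerivWithinAt (fun t => M t * Real.exp (-(p * J t)))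
        (L * (V t ^ volExp N p)⁻¹ * Real.exp (-J t) ^ p -
          c * (p - 1) * ((M t * Real.exp (-J t)) ^ p * V t ^ N * L)) (Icc 0 t₁) t := by
      intro t ht
      have h := (hM t ht).mul ((hJ t ht).const_mul p).neg.exp.hasDerivWithinAt
      convert! h using 1
      simp only [Pi.neg_apply]
      rw [Real.mul_rpow (hMnn t ht) (Real.exp_pos _).le, hexp, ← hMp t ht]; ring
    have hnumc : ContinuousOn (fun t => L * (V t ^ volExp N p)⁻¹ * Real.exp (-J t) ^ p)
        (Icc 0 t₁) := hVac.mul (hec.rpow_const fun _ _ => Or.inr (by linarith))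
    have hdenc : ContinuousOn (fun t => (M t * Real.exp (-J t)) ^ p * V t ^ N * L)
        (Icc 0 t₁) := ((hφc.rpow_const fun _ _ => Or.inr (by linarith)).mul
          (hV.pow N).continuousOn).mul continuousOn_const
    rw [← uIcc_of_le ht₁.1.le] at hnumc hdenc
    have hftc := intervalIntegral.integral_eq_sub_of_hasDerivAt_of_le ht₁.1.le
      (fun t ht => (hd t ht).continuousWithinAt)
      (fun t ht => (hd t (Ioo_subset_Icc_self ht)).hasDerivAt (Icc_mem_nhds ht.1 ht.2))
      (hnumc.intervalIntegrable.sub (hdenc.intervalIntegrable.const_mul _))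
    rw [intervalIntegral.integral_sub hnumc.intervalIntegrable
      (hdenc.intervalIntegrable.const_mul _), intervalIntegral.integral_const_mul] at hftc
    rw [hM0, zero_mul, sub_zero, hMB] at hftc
    have h2 : B ^ (1 - p) * (B * Real.exp (-J t₁)) ^ p = B * Real.exp (-(p * J t₁)) := by
      rw [Real.mul_rpow hB.le (Real.exp_pos _).le, hexp, ← mul_assoc, ← Real.rpow_add hB]
      simp
    rw [hMB, h2]
    linarith

end TestFunction

section TestFunction

variable {N : ℕ} {p c L B t₁ : ℝ} {V I : ℝ → ℝ}

/-- Freezing the profile after time `t₁` gives a test function whose Rayleigh quotient is at most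
`c (p - 1)` up to an error of order `B ^ (1 - p)`. -/
lemma exists_testFunction (hN : 1 ≤ N) (hp : 2 * (N : ℝ) + 1 ≤ p) (hc : 0 < c) (hL : 0 < L)
    (hV : Continuous V) (hV0 : ∀ t, 0 ≤ V t) (hVpos : ∀ t ∈ Ico (0:ℝ) 1, 0 < V t) (hI0 : I 0 = 0)
    (hIm : StrictMonoOn I (Icc 0 1)) (hB : 0 < B) (ht₁ : t₁ ∈ Ioo (0:ℝ) 1) {φ e : ℝ → ℝ}
    (hφ0 : φ 0 = 0) (hφ1 : 0 < φ t₁) (hec : ContinuousOn e (Icc 0 t₁))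
    (he : ∀ t ∈ Icc 0 t₁, 0 < e t)
    (hφ : ∀ t ∈ Icc 0 t₁, HasDerivWithinAt φ (L * (V t ^ volExp N p)⁻¹ * e t) (Icc 0 t₁) t)
    (hφI : ∀ t ∈ Icc 0 t₁, φ t₁ * I t ≤ φ t * I t₁)
    (hid : ∫ t in (0:ℝ)..t₁, L * (V t ^ volExp N p)⁻¹ * e t ^ p =
        c * (p - 1) * (∫ t in (0:ℝ)..t₁, φ t ^ p * V t ^ N * L) + B ^ (1 - p) * φ t₁ ^ p) :
    ∃ w : ℝ → ℝ, (∃ K, LipschitzOnWith K w (Icc 0 1)) ∧ w 0 = 0 ∧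
      IntervalIntegrable (fun t => |derivWithin w (Icc 0 1) t| ^ p * V t ^ N * L ^ (1 - p))
        volume 0 1 ∧
      IntervalIntegrable (fun t => |w t| ^ p * V t ^ N * L) volume 0 1 ∧
      0 < (∫ t in (0:ℝ)..1, |w t| ^ p * V t ^ N * L) ∧
      (∫ t in (0:ℝ)..1, |derivWithin w (Icc 0 1) t| ^ p * V t ^ N * L ^ (1 - p)) ≤
        (c * (p - 1) + B ^ (1 - p) /
          ((I (1 / 2) / I 1) ^ p * ∫ t in (1 / 2 : ℝ)..1, V t ^ N * L)) *
          ∫ t in (0:ℝ)..1, |w t| ^ p * V t ^ N * L := by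
  have hp3 := three_le_of_exponent hN hp
  have hlt : ∀ t ∈ Icc 0 t₁, t ∈ Ico (0:ℝ) 1 := fun t ht => ⟨ht.1, ht.2.trans_lt ht₁.2⟩
  have hVac : ContinuousOn (fun t => L * (V t ^ volExp N p)⁻¹) (Icc 0 t₁) :=
    continuousOn_const.mul ((hV.continuousOn.rpow_const fun t ht =>
      Or.inl (hVpos t (hlt t ht)).ne').inv₀ fun t ht =>
        (Real.rpow_pos_of_pos (hVpos t (hlt t ht)) _).ne')
  have hI1 : 0 < I t₁ := by
    rw [← hI0]; exact hIm ⟨le_rfl, zero_le_one⟩ (Ioo_subset_Icc_self ht₁) ht₁.1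
  have hφnn : ∀ t ∈ Icc 0 t₁, 0 ≤ φ t := by
    intro t ht
    have h1 : 0 ≤ I t := by
      rw [← hI0]
      exact hIm.monotoneOn ⟨le_rfl, zero_le_one⟩ (Ico_subset_Icc_self (hlt t ht)) ht.1
    exact nonneg_of_mul_nonneg_left ((mul_nonneg hφ1.le h1).trans (hφI t ht)) hI1
  obtain ⟨K, hK⟩ := exists_lipschitzOnWith_Icc hφ (hVac.mul hec)
  have hmin : ∀ t ∈ Icc (0:ℝ) 1, min t t₁ ∈ Icc 0 t₁ := fun t ht =>
    ⟨le_min ht.1 ht₁.1.le, min_le_right _ _⟩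
  have hw : LipschitzOnWith K (fun t => φ (min t t₁)) (Icc 0 1) := by
    refine LipschitzOnWith.of_dist_le_mul fun x hx y hy => ?_
    refine (hK.dist_le_mul _ (hmin x hx) _ (hmin y hy)).trans
      (mul_le_mul_of_nonneg_left ?_ K.2)
    have := abs_min_sub_min_le_max x t₁ y t₁
    rwa [sub_self, abs_zero, max_eq_left (abs_nonneg (x - y))] at this
  have hd1 : ∀ t ∈ Ioo 0 t₁, derivWithin (fun t => φ (min t t₁)) (Icc 0 1) t =
      L * (V t ^ volExp N p)⁻¹ * e t := by
    intro t ht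
    have h1 := (hφ t (Ioo_subset_Icc_self ht)).hasDerivAt (Icc_mem_nhds ht.1 ht.2)
    have h2 : HasDerivAt (fun t => φ (min t t₁)) (L * (V t ^ volExp N p)⁻¹ * e t) t := by
      refine h1.congr_of_eventuallyEq ?_
      filter_upwards [ge_mem_nhds ht.2] with s hs
      rw [min_eq_left hs]
    exact h2.hasDerivWithinAt.derivWithin
      (uniqueDiffOn_Icc zero_lt_one t ⟨ht.1.le, (ht.2.trans ht₁.2).le⟩)
  have hd2 : ∀ t ∈ Ioo t₁ 1, derivWithin (fun t => φ (min t t₁)) (Icc 0 1) t = 0 := by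
    intro t ht
    have h2 : HasDerivAt (fun t => φ (min t t₁)) 0 t := by
      refine (hasDerivAt_const t (φ t₁)).congr_of_eventuallyEq ?_
      filter_upwards [le_mem_nhds ht.1] with s hs
      rw [min_eq_right hs]
    exact h2.hasDerivWithinAt.derivWithin
      (uniqueDiffOn_Icc zero_lt_one t ⟨(ht₁.1.trans ht.1).le, ht.2.le⟩)
  have hn1 : ∀ t ∈ Ioo 0 t₁, L * (V t ^ volExp N p)⁻¹ * e t ^ p =
      |derivWithin (fun t => φ (min t t₁)) (Icc 0 1) t| ^ p * V t ^ N * L ^ (1 - p) := by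
    intro t ht
    have ht' := Ioo_subset_Icc_self ht
    have h1 := Real.rpow_pos_of_pos (hVpos t (hlt t ht')) (volExp N p)
    have h2 := he t ht'
    rw [hd1 t ht, abs_of_pos (by positivity),
      rpow_cancel hN hp hL (hVpos t (hlt t ht')) (he t ht')]
  have hn2 : ∀ t ∈ Ioo t₁ 1, 0 =
      |derivWithin (fun t => φ (min t t₁)) (Icc 0 1) t| ^ p * V t ^ N * L ^ (1 - p) := by
    intro t ht
    rw [hd2 t ht, abs_zero, Real.zero_rpow (by linarith), zero_mul, zero_mul]
  have hni1 : IntervalIntegrable (fun t =>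
      |derivWithin (fun t => φ (min t t₁)) (Icc 0 1) t| ^ p * V t ^ N * L ^ (1 - p))
      volume 0 t₁ := by
    refine IntervalIntegrable.congr_uIoo (f := fun t => L * (V t ^ volExp N p)⁻¹ * e t ^ p) ?_ ?_
    · refine ContinuousOn.intervalIntegrable ?_
      rw [uIcc_of_le ht₁.1.le]
      exact hVac.mul (hec.rpow_const fun _ _ => Or.inr (by linarith))
    · rw [uIoo_of_le ht₁.1.le]; exact hn1
  have hni2 : IntervalIntegrable (fun t =>
      |derivWithin (fun t => φ (min t t₁)) (Icc 0 1) t| ^ p * V t ^ N * L ^ (1 - p))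
      volume t₁ 1 := by
    refine IntervalIntegrable.congr_uIoo (f := fun _ => (0:ℝ)) intervalIntegrable_const ?_
    rw [uIoo_of_le ht₁.2.le]; exact hn2
  have hnum : (∫ t in (0:ℝ)..1,
      |derivWithin (fun t => φ (min t t₁)) (Icc 0 1) t| ^ p * V t ^ N * L ^ (1 - p)) =
      ∫ t in (0:ℝ)..t₁, L * (V t ^ volExp N p)⁻¹ * e t ^ p := by
    rw [← intervalIntegral.integral_add_adjacent_intervals hni1 hni2,
      ← intervalIntegral.integral_congr_uIoo (f := fun _ => (0:ℝ)) (a := t₁) (b := 1),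
      ← intervalIntegral.integral_congr_uIoo (a := 0) (b := t₁)
        (f := fun t => L * (V t ^ volExp N p)⁻¹ * e t ^ p)]
    · simp
    · rw [uIoo_of_le ht₁.1.le]; exact hn1
    · rw [uIoo_of_le ht₁.2.le]; exact hn2
  have hdc : ContinuousOn (fun t => |φ (min t t₁)| ^ p * V t ^ N * L) (Icc 0 1) :=
    ((hw.continuousOn.abs.rpow_const fun _ _ => Or.inr (by linarith)).mul
      (hV.pow N).continuousOn).mul continuousOn_const
  have hdi : ∀ a ∈ Icc (0:ℝ) 1, ∀ b ∈ Icc (0:ℝ) 1, IntervalIntegrable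
      (fun t => |φ (min t t₁)| ^ p * V t ^ N * L) volume a b := fun a ha b hb =>
    (hdc.mono (uIcc_subset_Icc ha hb)).intervalIntegrable
  have m0 : (0:ℝ) ∈ Icc (0:ℝ) 1 := ⟨le_rfl, zero_le_one⟩
  have m1 : (1:ℝ) ∈ Icc (0:ℝ) 1 := ⟨zero_le_one, le_rfl⟩
  have mh : (1 / 2:ℝ) ∈ Icc (0:ℝ) 1 := ⟨by norm_num, by norm_num⟩
  have mt := Ioo_subset_Icc_self ht₁
  have hdnn : ∀ t, 0 ≤ |φ (min t t₁)| ^ p * V t ^ N * L := fun t =>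
    mul_nonneg (mul_nonneg (Real.rpow_nonneg (abs_nonneg _) _) (pow_nonneg (hV0 t) _)) hL.le
  have hsplit1 := intervalIntegral.integral_add_adjacent_intervals (hdi 0 m0 t₁ mt) (hdi t₁ mt 1 m1)
  have hsplit2 := intervalIntegral.integral_add_adjacent_intervals (hdi 0 m0 _ mh) (hdi _ mh 1 m1)
  have hpos1 := intervalIntegral.integral_nonneg_of_forall (μ := volume) ht₁.2.le hdnn
  have hpos2 := intervalIntegral.integral_nonneg_of_forall (μ := volume)
    (show (0:ℝ) ≤ 1 / 2 by norm_num) hdnn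
  have hden1 : (∫ t in (0:ℝ)..t₁, φ t ^ p * V t ^ N * L) =
      ∫ t in (0:ℝ)..t₁, |φ (min t t₁)| ^ p * V t ^ N * L := by
    refine intervalIntegral.integral_congr fun t ht => ?_
    rw [uIcc_of_le ht₁.1.le] at ht
    rw [min_eq_left ht.2, abs_of_nonneg (hφnn t ht)]
  have hI1' : 0 < I 1 := by rw [← hI0]; exact hIm m0 m1 zero_lt_one
  have hIh : 0 < I (1 / 2) := by rw [← hI0]; exact hIm m0 mh (by norm_num)
  have hr : 0 < I (1 / 2) / I 1 := div_pos hIh hI1'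
  have hVint : 0 < ∫ t in (1 / 2 : ℝ)..1, V t ^ N * L := by
    refine intervalIntegral.intervalIntegral_pos_of_pos_on
      ((hV.pow N).mul continuous_const).continuousOn.intervalIntegrable (fun t ht => ?_)
      (by norm_num)
    have := hVpos t ⟨by linarith [ht.1], ht.2⟩
    positivity
  have hlow : ∀ t ∈ Icc (1 / 2 : ℝ) 1, φ t₁ * (I (1 / 2) / I 1) ≤ φ (min t t₁) := by
    intro t ht
    have ht' : t ∈ Icc (0:ℝ) 1 := ⟨by linarith [ht.1], ht.2⟩
    rcases le_total t t₁ with h | h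
    · rw [min_eq_left h, ← mul_div_assoc, div_le_iff₀ hI1']
      have h1 := hφI t ⟨ht'.1, h⟩
      have h2 := mul_le_mul_of_nonneg_left (hIm.monotoneOn mh ht' ht.1) hφ1.le
      have h3 := mul_le_mul_of_nonneg_left (hIm.monotoneOn mt m1 ht₁.2.le) (hφnn t ⟨ht'.1, h⟩)
      linarith
    · rw [min_eq_right h]
      refine mul_le_of_le_one_right hφ1.le ((div_le_one hI1').2 ?_)
      exact hIm.monotoneOn mh m1 (by norm_num)
  have hκ : (I (1 / 2) / I 1) ^ p * (∫ t in (1 / 2 : ℝ)..1, V t ^ N * L) * φ t₁ ^ p ≤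
      ∫ t in (1 / 2 : ℝ)..1, |φ (min t t₁)| ^ p * V t ^ N * L := by
    rw [mul_right_comm, ← Real.mul_rpow hr.le hφ1.le, ← intervalIntegral.integral_const_mul]
    refine intervalIntegral.integral_mono_on (by norm_num)
      (continuous_const.mul ((hV.pow N).mul continuous_const)).continuousOn.intervalIntegrable
      (hdi _ mh 1 m1) fun t ht => ?_
    rw [← mul_assoc]
    have h1 := hlow t ht
    rw [mul_comm] at h1
    have h2 := pow_nonneg (hV0 t) N
    gcongr
    exact h1.trans (le_abs_self _)
  have hκ0 : 0 < (I (1 / 2) / I 1) ^ p * ∫ t in (1 / 2 : ℝ)..1, V t ^ N * L := by positivity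
  have hφp := Real.rpow_pos_of_pos hφ1 p
  set κ := (I (1 / 2) / I 1) ^ p * ∫ t in (1 / 2 : ℝ)..1, V t ^ N * L with hκdef
  refine ⟨fun t => φ (min t t₁), ⟨K, hw⟩, by simp [min_eq_left ht₁.1.le, hφ0],
    hni1.trans hni2, hdi 0 m0 1 m1, ?_, ?_⟩
  · have := mul_pos hκ0 hφp
    dsimp only
    linarith
  · dsimp only
    rw [hnum, hid, hden1, add_mul]
    have hΛ : 0 ≤ c * (p - 1) := mul_nonneg hc.le (by linarith)
    have hBp := Real.rpow_pos_of_pos hB (1 - p)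
    refine add_le_add (mul_le_mul_of_nonneg_left (by linarith) hΛ) ?_
    rw [div_mul_eq_mul_div, le_div_iff₀ hκ0, mul_assoc]
    refine mul_le_mul_of_nonneg_left ?_ hBp.le
    linarith

end TestFunction

section UpperBound

variable {N : ℕ} {p c L : ℝ}

lemma exists_primitive_of_linear_bound (hN : 1 ≤ N) (hp : 2 * (N : ℝ) + 1 ≤ p) (L : ℝ)
    {V : ℝ → ℝ} (hV : Continuous V) {k : ℝ} (hk : 0 < k)
    (hlow : ∀ t ∈ Icc (0:ℝ) 1, k * (1 - t) ≤ V t) :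
    ∃ I : ℝ → ℝ, I 0 = 0 ∧ ContinuousOn I (Icc 0 1) ∧
      ∀ t ∈ Ico (0:ℝ) 1, HasDerivAt I (L * (V t ^ volExp N p)⁻¹) t := by
  have ha := volExp_pos hN hp
  have ha2 := volExp_le_half hN hp
  have hpos : ∀ t ∈ Ico (0:ℝ) 1, 0 < V t := fun t ht =>
    (mul_pos hk (by linarith [ht.2])).trans_le (hlow t ⟨ht.1, ht.2.le⟩)
  have hmeas : Measurable fun t => L * (V t ^ volExp N p)⁻¹ :=
    measurable_const.mul (hV.rpow_const fun _ => Or.inr ha.le).measurable.inv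
  have hdom : IntervalIntegrable (fun t : ℝ => |L| * ((k ^ volExp N p)⁻¹ * (1 - t) ^ (-volExp N p)))
      volume 0 1 := by
    have h1 := ((intervalIntegral.intervalIntegrable_rpow' (a := 0) (b := 1)
      (r := -volExp N p) (by linarith)).comp_sub_left 1).symm
    rw [sub_zero, sub_self] at h1
    exact (h1.const_mul _).const_mul _
  have hint : IntervalIntegrable (fun t => L * (V t ^ volExp N p)⁻¹) volume 0 1 := by
    refine hdom.mono_fun hmeas.aestronglyMeasurable ?_
    rw [uIoc_of_le zero_le_one]
    refine (ae_restrict_iff' measurableSet_Ioc).2 ?_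
    have hne : ∀ᵐ t : ℝ ∂volume, t ≠ 1 := Measure.ae_ne volume 1
    filter_upwards [hne] with t ht1 ht
    have ht' : t ∈ Ico (0:ℝ) 1 := ⟨ht.1.le, lt_of_le_of_ne ht.2 ht1⟩
    have h1t : 0 < 1 - t := by linarith [ht'.2]
    have hp1 := Real.rpow_pos_of_pos (hpos t ht') (volExp N p)
    have hp2 := Real.rpow_pos_of_pos (mul_pos hk h1t) (volExp N p)
    rw [norm_mul, norm_mul, Real.norm_eq_abs, Real.norm_eq_abs |L|, abs_abs]
    refine mul_le_mul_of_nonneg_left ?_ (abs_nonneg _)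
    rw [Real.rpow_neg h1t.le, ← mul_inv, ← Real.mul_rpow hk.le h1t.le, norm_inv, norm_inv,
      Real.norm_of_nonneg hp1.le, Real.norm_of_nonneg hp2.le]
    exact inv_anti₀ hp2 (Real.rpow_le_rpow (mul_pos hk h1t).le (hlow t ⟨ht.1.le, ht.2⟩) ha.le)
  refine ⟨fun t => ∫ s in (0:ℝ)..t, L * (V s ^ volExp N p)⁻¹, intervalIntegral.integral_same,
    ?_, fun t ht => ?_⟩
  · have := intervalIntegral.continuousOn_primitive_interval' hint left_mem_uIcc
    rwa [uIcc_of_le zero_le_one] at this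
  · refine intervalIntegral.integral_hasDerivAt_right (hint.mono_set ?_)
      hmeas.stronglyMeasurable.stronglyMeasurableAtFilter ?_
    · rw [uIcc_of_le ht.1, uIcc_of_le zero_le_one]
      exact Icc_subset_Icc le_rfl ht.2.le
    · exact continuousAt_const.mul ((hV.continuousAt.rpow_const (Or.inr ha.le)).inv₀
        (Real.rpow_pos_of_pos (hpos t ht) _).ne')

/-- If the starting point of a curve cannot reach the boundary slowly with constant `c`, then the
weighted Rayleigh quotient along the curve can be made arbitrarily close to `c (p - 1)`. -/
lemma exists_quotient_le (hN : 1 ≤ N) (hp : 2 * (N : ℝ) + 1 ≤ p) (hc : 0 < c) (hL : 0 < L)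
    {β β' : ℝ → ℂ} (hβ : Continuous β)
    (hβ' : ∀ t ∈ Ico (0:ℝ) 1, HasDerivWithinAt β (β' t) (Ici t) t)
    (hsp : ∀ t ∈ Ico (0:ℝ) 1, ‖β' t‖ ≤ L) (h1 : quadProd (β 1) = 0) {k : ℝ} (hk : 0 < k)
    (hlow : ∀ t ∈ Icc (0:ℝ) 1, k * (1 - t) ≤ quadProd (β t)) (hnot : ¬ Reaches N p c (β 0)) :
    ∃ κ, 0 < κ ∧ ∀ B, 0 < B → ∃ w : ℝ → ℝ, (∃ K, LipschitzOnWith K w (Icc 0 1)) ∧ w 0 = 0 ∧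
      IntervalIntegrable
        (fun t => |derivWithin w (Icc 0 1) t| ^ p * quadProd (β t) ^ N * L ^ (1 - p)) volume 0 1 ∧
      IntervalIntegrable (fun t => |w t| ^ p * quadProd (β t) ^ N * L) volume 0 1 ∧
      0 < (∫ t in (0:ℝ)..1, |w t| ^ p * quadProd (β t) ^ N * L) ∧
      (∫ t in (0:ℝ)..1, |derivWithin w (Icc 0 1) t| ^ p * quadProd (β t) ^ N * L ^ (1 - p)) ≤
        (c * (p - 1) + B ^ (1 - p) / κ) *
          ∫ t in (0:ℝ)..1, |w t| ^ p * quadProd (β t) ^ N * L := by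
  have hp3 := three_le_of_exponent hN hp
  have hV : Continuous fun t => quadProd (β t) := continuous_quadProd.comp hβ
  have hVpos : ∀ t ∈ Ico (0:ℝ) 1, 0 < quadProd (β t) := fun t ht =>
    (mul_pos hk (by linarith [ht.2])).trans_le (hlow t ⟨ht.1, ht.2.le⟩)
  obtain ⟨I, hI0, hIc, hI⟩ := exists_primitive_of_linear_bound hN hp L hV hk hlow
  have hI'pos : ∀ t ∈ Ico (0:ℝ) 1, 0 < L * (quadProd (β t) ^ volExp N p)⁻¹ := fun t ht =>
    mul_pos hL (inv_pos.2 (Real.rpow_pos_of_pos (hVpos t ht) _))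
  have hIm : StrictMonoOn I (Icc 0 1) := by
    refine strictMonoOn_of_deriv_pos (convex_Icc _ _) hIc fun t ht => ?_
    rw [interior_Icc] at ht
    rw [(hI t (Ioo_subset_Ico_self ht)).deriv]
    exact hI'pos t (Ioo_subset_Ico_self ht)
  have m0 : (0:ℝ) ∈ Icc (0:ℝ) 1 := ⟨le_rfl, zero_le_one⟩
  have m1 : (1:ℝ) ∈ Icc (0:ℝ) 1 := ⟨zero_le_one, le_rfl⟩
  have mh : (1 / 2:ℝ) ∈ Icc (0:ℝ) 1 := ⟨by norm_num, by norm_num⟩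
  have hI1' : 0 < I 1 := by rw [← hI0]; exact hIm m0 m1 zero_lt_one
  have hIh : 0 < I (1 / 2) := by rw [← hI0]; exact hIm m0 mh (by norm_num)
  have hr : 0 < I (1 / 2) / I 1 := div_pos hIh hI1'
  have hVint : 0 < ∫ t in (1 / 2 : ℝ)..1, quadProd (β t) ^ N * L := by
    refine intervalIntegral.intervalIntegral_pos_of_pos_on
      ((hV.pow N).mul continuous_const).continuousOn.intervalIntegrable (fun t ht => ?_)
      (by norm_num)
    have := hVpos t ⟨by linarith [ht.1], ht.2⟩
    positivity
  refine ⟨_, mul_pos (Real.rpow_pos_of_pos hr p) hVint, fun B hB => ?_⟩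
  obtain ⟨ν, hν0, hν⟩ := exists_truncated_clock (p := p) (by linarith) hB.le
    (q := fun t => c * L * quadProd (β t) ^ N)
    (continuous_const.mul (hV.pow N)).continuousOn hIc
  set M : ℝ → ℝ := fun t => ν t + I t with hMdef
  have hM0 : M 0 = 0 := by simp [hMdef, hν0, hI0]
  have hMd : ∀ t ∈ Ico (0:ℝ) 1, HasDerivWithinAt M
      (L * ((quadProd (β t) ^ volExp N p)⁻¹ +
        c * quadProd (β t) ^ N * (max 0 (min (M t) B)) ^ p)) (Icc 0 1) t := by
    intro t ht
    have h := (hν t (Ico_subset_Icc_self ht)).add (hI t ht).hasDerivWithinAt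
    convert! h using 1
    ring
  have hM'pos : ∀ t ∈ Ico (0:ℝ) 1, 0 < L * ((quadProd (β t) ^ volExp N p)⁻¹ +
        c * quadProd (β t) ^ N * (max 0 (min (M t) B)) ^ p) := by
    intro t ht
    have h1 := hVpos t ht
    have h2 : 0 ≤ (max 0 (min (M t) B)) ^ p := Real.rpow_nonneg (le_max_left _ _) _
    positivity
  have hMc : ContinuousOn M (Icc 0 1) :=
    ContinuousOn.add (fun t ht => (hν t ht).continuousWithinAt) hIc
  have hMm : StrictMonoOn M (Icc 0 1) := by
    refine strictMonoOn_of_deriv_pos (convex_Icc _ _) hMc fun t ht => ?_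
    rw [interior_Icc] at ht
    rw [((hMd t (Ioo_subset_Ico_self ht)).hasDerivAt (Icc_mem_nhds ht.1 ht.2)).deriv]
    exact hM'pos t (Ioo_subset_Ico_self ht)
  have hMnn : ∀ t ∈ Icc (0:ℝ) 1, 0 ≤ M t := fun t ht => by
    rw [← hM0]; exact hMm.monotoneOn m0 ht ht.1
  rcases le_or_gt (M 1) B with hMB | hMB
  · exfalso
    apply hnot
    have hcl : ∀ t ∈ Icc (0:ℝ) 1, max 0 (min (M t) B) = M t := fun t ht => by
      rw [min_eq_left ((hMm.monotoneOn ht m1 ht.2).trans hMB), max_eq_right (hMnn t ht)]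
    obtain ⟨γ, hγ, hγ0, hγ1⟩ := exists_isSlow_of_clock (N := N) (p := p) hc.le hβ.continuousOn hβ'
      hMc hMm (fun t ht => (hMd t ht).mono_of_mem_nhdsWithin
        (Icc_mem_nhdsGE_of_mem ht))
      (fun t ht => (hM'pos t ht).le) (fun t ht => by
        have ht' := Ico_subset_Icc_self ht
        rw [hcl t ht', ← inv_rate hc.le (hVpos t ht) (hMnn t ht')]
        have hr := rate_pos (N := N) (p := p) hc.le (hVpos t ht) (M t)
        rw [mul_left_comm, mul_inv_cancel₀ hr.ne', mul_one]
        exact hsp t ht)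
    rw [hM0] at hγ0
    exact ⟨γ, M 1, hγ, hMnn 1 m1, hγ0, by rw [hγ1, h1]⟩
  · obtain ⟨t₁, ht₁, hMt⟩ : ∃ t ∈ Ioo (0:ℝ) 1, M t = B :=
      intermediate_value_Ioo zero_le_one hMc ⟨by rwa [hM0], hMB⟩
    have hsub : ∀ t ∈ Icc 0 t₁, t ∈ Ico (0:ℝ) 1 := fun t ht => ⟨ht.1, ht.2.trans_lt ht₁.2⟩
    have hcl : ∀ t ∈ Icc 0 t₁, max 0 (min (M t) B) = M t := fun t ht => by
      have ht' := Ico_subset_Icc_self (hsub t ht)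
      rw [min_eq_left ((hMm.monotoneOn ht' (Ioo_subset_Icc_self ht₁) ht.2).trans hMt.le),
        max_eq_right (hMnn t ht')]
    obtain ⟨φ, e, hφ0, hφ1, hec, he, hφ, hφI, hid⟩ := exists_profile hN hp hc hL hV hVpos hI0 hI hB
      ht₁ hM0 hMt (fun t ht => hMnn t (Ico_subset_Icc_self (hsub t ht))) (fun t ht => by
        have h := (hMd t (hsub t ht)).mono (Icc_subset_Icc le_rfl ht₁.2.le)
        rwa [hcl t ht] at h)
    exact exists_testFunction hN hp hc hL hV (fun t => quadProd_nonneg _) hVpos hI0 hIm hB ht₁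
      hφ0 hφ1 hec he hφ hφI hid

end UpperBound

section Eigenvalue

variable {n : ℕ} {cn p L Λ : ℝ} {α : ℝ → ℝ × ℝ} {V : ℝ → ℝ}

lemma numG_eq (hV : ∀ t ∈ Icc (0:ℝ) 1, (α t).1 * (α t).2 = V t)
    (hs : ∀ t ∈ Icc (0:ℝ) 1, gSpeed α t = L) (w : ℝ → ℝ) :
    EqOn (fun t => cn * (|derivWithin w (Icc 0 1) t| ^ p * V t ^ (n - 1) * L ^ (1 - p)))
      (numG n cn p (Icc 0 1) α w) (Icc 0 1) := by
  intro t ht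
  have h := hs t ht
  rw [gSpeed] at h
  simp only [numG, Fvol, h, ← hV t ht, mul_pow]
  ring

lemma denG_eq (hV : ∀ t ∈ Icc (0:ℝ) 1, (α t).1 * (α t).2 = V t)
    (hs : ∀ t ∈ Icc (0:ℝ) 1, gSpeed α t = L) (w : ℝ → ℝ) :
    EqOn (fun t => cn * (|w t| ^ p * V t ^ (n - 1) * L))
      (denG n cn p (Icc 0 1) α w) (Icc 0 1) := by
  intro t ht
  have h := hs t ht
  rw [gSpeed] at h
  simp only [denG, Fvol, h, ← hV t ht, mul_pow]
  ring

lemma intervalIntegrable_iff_of_eqOn {f g : ℝ → ℝ} (hcn : 0 < cn)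
    (h : EqOn (fun t => cn * f t) g (Icc 0 1)) :
    IntervalIntegrable g volume 0 1 ↔ IntervalIntegrable f volume 0 1 := by
  have hsub : uIoo (0:ℝ) 1 ⊆ Icc 0 1 := by
    rw [uIoo_of_le zero_le_one]; exact Ioo_subset_Icc_self
  constructor
  · intro hg
    have h1 := (hg.congr_uIoo (h.symm.mono hsub)).const_mul cn⁻¹
    simpa only [inv_mul_cancel_left₀ hcn.ne'] using h1
  · exact fun hf => (hf.const_mul cn).congr_uIoo (h.mono hsub)

lemma integral_of_eqOn {f g : ℝ → ℝ} (h : EqOn (fun t => cn * f t) g (Icc 0 1)) :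
    ∫ t in (0:ℝ)..1, g t = cn * ∫ t in (0:ℝ)..1, f t := by
  rw [← intervalIntegral.integral_const_mul]
  refine (intervalIntegral.integral_congr ?_).symm
  rwa [uIcc_of_le zero_le_one]

lemma le_lambdaG (hcn : 0 < cn) (hp : 1 < p) (hL : 0 < L)
    (hV : ∀ t ∈ Icc (0:ℝ) 1, (α t).1 * (α t).2 = V t) (hVc : ContinuousOn V (Icc 0 1))
    (hVpos : ∀ t ∈ Ico (0:ℝ) 1, 0 < V t) (hs : ∀ t ∈ Icc (0:ℝ) 1, gSpeed α t = L)
    (H : ∀ (w : ℝ → ℝ) (K : NNReal), LipschitzOnWith K w (Icc 0 1) → w 0 = 0 →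
      IntervalIntegrable (fun t => |derivWithin w (Icc 0 1) t| ^ p * V t ^ (n - 1) * L ^ (1 - p))
        volume 0 1 →
      IntervalIntegrable (fun t => |w t| ^ p * V t ^ (n - 1) * L) volume 0 1 →
      Λ * (∫ t in (0:ℝ)..1, |w t| ^ p * V t ^ (n - 1) * L) ≤
        ∫ t in (0:ℝ)..1, |derivWithin w (Icc 0 1) t| ^ p * V t ^ (n - 1) * L ^ (1 - p)) :
    Λ ≤ lambdaG n cn p α := by
  have hi : ∀ {f : ℝ → ℝ}, ContinuousOn f (Icc 0 1) → IntervalIntegrable f volume 0 1 :=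
    fun hf => by
      rw [← uIcc_of_le zero_le_one] at hf
      exact hf.intervalIntegrable
  refine le_csInf ?_ ?_
  · have hd : IntervalIntegrable (fun t => |t| ^ p * V t ^ (n - 1) * L) volume 0 1 :=
      hi (((continuous_abs.rpow_const fun _ => Or.inr (by linarith)).continuousOn.mul
        (hVc.pow _)).mul continuousOn_const)
    refine ⟨_, fun t => t, ⟨1, LipschitzWith.id.lipschitzOnWith⟩, rfl,
      (intervalIntegrable_iff_of_eqOn hcn (numG_eq hV hs _)).2 ?_,
      (intervalIntegrable_iff_of_eqOn hcn (denG_eq hV hs _)).2 hd, ?_, rfl⟩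
    · have : IntervalIntegrable (fun t => V t ^ (n - 1) * L ^ (1 - p)) volume 0 1 :=
        hi ((hVc.pow _).mul continuousOn_const)
      refine this.congr_uIoo fun t ht => ?_
      rw [uIoo_of_le zero_le_one] at ht
      dsimp only
      rw [derivWithin_id' _ _ (uniqueDiffOn_Icc zero_lt_one t (Ioo_subset_Icc_self ht))]
      simp
    · rw [integral_of_eqOn (denG_eq hV hs _)]
      refine mul_pos hcn (intervalIntegral.intervalIntegral_pos_of_pos_on hd (fun t ht => ?_)
        zero_lt_one)
      have h1 := hVpos t (Ioo_subset_Ico_self ht)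
      have h2 : 0 < |t| := abs_pos.2 ht.1.ne'
      positivity
  · rintro q ⟨w, ⟨K, hK⟩, hw0, hn, hd, hpos, rfl⟩
    rw [le_div_iff₀ hpos, integral_of_eqOn (denG_eq hV hs w), integral_of_eqOn (numG_eq hV hs w),
      mul_left_comm]
    exact mul_le_mul_of_nonneg_left (H w K hK hw0
      ((intervalIntegrable_iff_of_eqOn hcn (numG_eq hV hs w)).1 hn)
      ((intervalIntegrable_iff_of_eqOn hcn (denG_eq hV hs w)).1 hd)) hcn.le

lemma lambdaG_le (hcn : 0 < cn) (hp : 1 < p) (hL : 0 < L)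
    (hV : ∀ t ∈ Icc (0:ℝ) 1, (α t).1 * (α t).2 = V t) (hV0 : ∀ t, 0 ≤ V t)
    (hs : ∀ t ∈ Icc (0:ℝ) 1, gSpeed α t = L) {κ : ℝ}
    (H : ∀ B, 0 < B → ∃ w : ℝ → ℝ, (∃ K, LipschitzOnWith K w (Icc 0 1)) ∧ w 0 = 0 ∧
      IntervalIntegrable
        (fun t => |derivWithin w (Icc 0 1) t| ^ p * V t ^ (n - 1) * L ^ (1 - p)) volume 0 1 ∧
      IntervalIntegrable (fun t => |w t| ^ p * V t ^ (n - 1) * L) volume 0 1 ∧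
      0 < (∫ t in (0:ℝ)..1, |w t| ^ p * V t ^ (n - 1) * L) ∧
      (∫ t in (0:ℝ)..1, |derivWithin w (Icc 0 1) t| ^ p * V t ^ (n - 1) * L ^ (1 - p)) ≤
        (Λ + B ^ (1 - p) / κ) * ∫ t in (0:ℝ)..1, |w t| ^ p * V t ^ (n - 1) * L) :
    lambdaG n cn p α ≤ Λ := by
  have hbdd : ∀ w : ℝ → ℝ, 0 ≤ ∫ t in (0:ℝ)..1, numG n cn p (Icc 0 1) α w t := fun w => by
    rw [integral_of_eqOn (numG_eq hV hs w)]
    refine mul_nonneg hcn.le (intervalIntegral.integral_nonneg zero_le_one fun t _ => ?_)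
    have := hV0 t
    positivity
  have key : ∀ B, 0 < B → lambdaG n cn p α ≤ Λ + B ^ (1 - p) / κ := by
    intro B hB
    obtain ⟨w, hw, hw0, hn, hd, hpos, hle⟩ := H B hB
    have hpos' : 0 < ∫ t in (0:ℝ)..1, denG n cn p (Icc 0 1) α w t := by
      rw [integral_of_eqOn (denG_eq hV hs w)]; exact mul_pos hcn hpos
    have hq : lambdaG n cn p α ≤ (∫ t in (0:ℝ)..1, numG n cn p (Icc 0 1) α w t) /
        ∫ t in (0:ℝ)..1, denG n cn p (Icc 0 1) α w t := csInf_le ⟨0, ?_⟩ ⟨w, hw, hw0,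
      (intervalIntegrable_iff_of_eqOn hcn (numG_eq hV hs w)).2 hn,
      (intervalIntegrable_iff_of_eqOn hcn (denG_eq hV hs w)).2 hd, hpos', rfl⟩
    · refine hq.trans ?_
      rw [div_le_iff₀ hpos', integral_of_eqOn (denG_eq hV hs w),
        integral_of_eqOn (numG_eq hV hs w), mul_left_comm]
      exact mul_le_mul_of_nonneg_left hle hcn.le
    · rintro q ⟨w, -, -, -, -, hpos, rfl⟩
      exact div_nonneg (hbdd w) hpos.le
  have hlim : Tendsto (fun B : ℝ => Λ + B ^ (1 - p) / κ) atTop (𝓝 Λ) := by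
    have h1 := (tendsto_rpow_neg_atTop (show 0 < p - 1 by linarith)).div_const κ
    have h2 := h1.const_add Λ
    simpa [neg_sub] using h2
  exact ge_of_tendsto hlim ((eventually_gt_atTop 0).mono key)

end Eigenvalue

section Admissible

lemma exists_linear_bound {V : ℝ → ℝ} {m : ℝ} (hVc : ContinuousOn V (Icc 0 1))
    (hVpos : ∀ t ∈ Ico (0:ℝ) 1, 0 < V t) (hV1 : V 1 = 0)
    (hd : HasDerivWithinAt V m (Icc 0 1) 1) (hm : m ≠ 0) :
    ∃ k, 0 < k ∧ ∀ t ∈ Icc (0:ℝ) 1, k * (1 - t) ≤ V t := by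
  have hm0 : 0 < |m| := abs_pos.2 hm
  have hnear := hd.isLittleO.def (half_pos hm0)
  obtain ⟨δ, hδ, hball⟩ := Metric.mem_nhdsWithin_iff.1 hnear
  set τ := max 0 (1 - δ / 2) with hτ
  have hτ1 : τ < 1 := max_lt zero_lt_one (by linarith)
  have hτ0 : 0 ≤ τ := le_max_left _ _
  obtain ⟨s, hs, hmin⟩ := isCompact_Icc.exists_isMinOn (nonempty_Icc.2 hτ0)
    (hVc.mono (Icc_subset_Icc le_rfl hτ1.le))
  have hs0 : 0 < V s := hVpos s ⟨hs.1, hs.2.trans_lt hτ1⟩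
  refine ⟨min (V s) (|m| / 2), lt_min hs0 (half_pos hm0), fun t ht => ?_⟩
  have h1t : 0 ≤ 1 - t := by linarith [ht.2]
  rcases le_total t τ with h | h
  · calc _ ≤ V s * (1 - t) := mul_le_mul_of_nonneg_right (min_le_left _ _) h1t
      _ ≤ V s := mul_le_of_le_one_right hs0.le (by linarith [ht.1])
      _ ≤ V t := hmin ⟨ht.1, h⟩
  · refine (mul_le_mul_of_nonneg_right (min_le_right _ _) h1t).trans ?_
    have hb : t ∈ Metric.ball (1:ℝ) δ ∩ Icc 0 1 := by
      refine ⟨?_, ht⟩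
      rw [Metric.mem_ball, Real.dist_eq, abs_sub_comm, abs_of_nonneg h1t]
      have := (le_max_right 0 (1 - δ / 2)).trans h
      linarith
    have h2 := hball hb
    simp only [mem_ofPred_eq, hV1, sub_zero, smul_eq_mul, Real.norm_eq_abs] at h2
    rw [abs_sub_comm t 1, abs_of_nonneg h1t] at h2
    have hVt : 0 ≤ V t := by
      rcases ht.2.lt_or_eq with h3 | h3
      · exact (hVpos t ⟨ht.1, h3⟩).le
      · rw [h3, hV1]
    have h4 : |(t - 1) * m| = (1 - t) * |m| := by
      rw [abs_mul, abs_sub_comm, abs_of_nonneg h1t]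
    have h5 := abs_sub_abs_le_abs_sub ((t - 1) * m) (V t)
    rw [abs_sub_comm, h4, abs_of_nonneg hVt] at h5
    nlinarith

/-- An admissible curve, viewed in the complex plane and extended to the whole line. -/
lemma MemC.exists_complex_curve {x0 y0 : ℝ} (hx0 : 0 < x0) (hy0 : 0 < y0) {β : ℝ → ℝ × ℝ}
    (hβ : MemC x0 y0 β) :
    ∃ (ζ ζ' : ℝ → ℂ) (L k : ℝ), Continuous ζ ∧ ζ 0 = ⟨x0, y0⟩ ∧ quadProd (ζ 1) = 0 ∧
      (∀ t ∈ Icc (0:ℝ) 1, (β t).1 * (β t).2 = quadProd (ζ t)) ∧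
      (∀ t ∈ Ico (0:ℝ) 1, HasDerivWithinAt ζ (ζ' t) (Ici t) t) ∧
      (∀ t ∈ Ico (0:ℝ) 1, ‖ζ' t‖ ≤ L) ∧ 0 < L ∧ (∀ t ∈ Icc (0:ℝ) 1, gSpeed β t = L) ∧
      0 < k ∧ ∀ t ∈ Icc (0:ℝ) 1, k * (1 - t) ≤ quadProd (ζ t) := by
  obtain ⟨hC1, h0, hint, h1b, h1ne, hsp, hx, hy⟩ := hβ
  have hdiff := hC1.differentiableOn one_ne_zero
  have hd1 : ∀ t ∈ Icc (0:ℝ) 1, HasDerivWithinAt (fun u => (β u).1)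
      (derivWithin (fun u => (β u).1) (Icc 0 1) t) (Icc 0 1) t := fun t ht =>
    (hdiff t ht).fst.hasDerivWithinAt
  have hd2 : ∀ t ∈ Icc (0:ℝ) 1, HasDerivWithinAt (fun u => (β u).2)
      (derivWithin (fun u => (β u).2) (Icc 0 1) t) (Icc 0 1) t := fun t ht =>
    (hdiff t ht).snd.hasDerivWithinAt
  set x' := derivWithin (fun u => (β u).1) (Icc 0 1)
  set y' := derivWithin (fun u => (β u).2) (Icc 0 1)
  have m0 : (0:ℝ) ∈ Icc (0:ℝ) 1 := ⟨le_rfl, zero_le_one⟩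
  have m1 : (1:ℝ) ∈ Icc (0:ℝ) 1 := ⟨zero_le_one, le_rfl⟩
  have hsq : ∀ t ∈ Icc (0:ℝ) 1, x' t ^ 2 + y' t ^ 2 = Lg β ^ 2 := fun t ht => by
    rw [← hsp t ht, gSpeed, gSpeedOn, Real.sq_sqrt (by positivity)]
  have hnn : ∀ t ∈ Icc (0:ℝ) 1, 0 ≤ (β t).1 ∧ 0 ≤ (β t).2 := fun t ht => by
    rcases ht.2.lt_or_eq with h | h
    · exact ⟨(hint t ⟨ht.1, h⟩).1.le, (hint t ⟨ht.1, h⟩).2.le⟩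
    · rw [h]; exact h1b.1
  have hL : 0 < Lg β := by
    have hLnn : 0 ≤ Lg β := by
      rw [← hsp 0 m0]; exact Real.sqrt_nonneg _
    refine hLnn.lt_of_ne fun hL0 => ?_
    have hz : ∀ t ∈ Icc (0:ℝ) 1, x' t = 0 ∧ y' t = 0 := fun t ht => by
      have := hsq t ht
      rw [← hL0] at this
      constructor <;> nlinarith [sq_nonneg (x' t), sq_nonneg (y' t)]
    have hc1 : (β 1).1 = (β 0).1 := constant_of_has_deriv_right_zero
      (f := fun u => (β u).1) (fun t ht => (hd1 t ht).continuousWithinAt) (fun t ht => by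
        have h := (hd1 t (Ico_subset_Icc_self ht)).mono_of_mem_nhdsWithin
          (Icc_mem_nhdsGE_of_mem ht)
        rwa [(hz t (Ico_subset_Icc_self ht)).1] at h) 1 m1
    have hc2 : (β 1).2 = (β 0).2 := constant_of_has_deriv_right_zero
      (f := fun u => (β u).2) (fun t ht => (hd2 t ht).continuousWithinAt) (fun t ht => by
        have h := (hd2 t (Ico_subset_Icc_self ht)).mono_of_mem_nhdsWithin
          (Icc_mem_nhdsGE_of_mem ht)
        rwa [(hz t (Ico_subset_Icc_self ht)).2] at h) 1 m1
    rw [h0] at hc1 hc2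
    rcases h1b.2 with h | h
    · rw [h] at hc1; exact hx0.ne hc1
    · rw [h] at hc2; exact hy0.ne hc2
  obtain ⟨k, hk, hlow⟩ := exists_linear_bound (V := fun t => (β t).1 * (β t).2)
    (fun t ht => ((hd1 t ht).continuousWithinAt.mul (hd2 t ht).continuousWithinAt))
    (fun t ht => mul_pos (hint t ht).1 (hint t ht).2)
    (by rcases h1b.2 with h | h <;> simp [h]) ((hd1 1 m1).mul (hd2 1 m1)) (by
      have h := hsq 1 m1
      rcases h1b.2 with h' | h'
      · have hn : (β 1).2 ≠ 0 := fun h2 => h1ne (Prod.ext h' h2)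
        have hn' : x' 1 ≠ 0 := fun h2 => by rw [hx h', h2] at h; nlinarith
        simpa only [h', zero_mul, add_zero] using mul_ne_zero hn' hn
      · have hn : (β 1).1 ≠ 0 := fun h2 => h1ne (Prod.ext h2 h')
        have hn' : y' 1 ≠ 0 := fun h2 => by rw [hy h', h2] at h; nlinarith
        simpa only [h', mul_zero, zero_add] using mul_ne_zero hn hn')
  have hclamp : ∀ t ∈ Icc (0:ℝ) 1, ((projIcc (0:ℝ) 1 zero_le_one t : Icc (0:ℝ) 1) : ℝ) = t :=
    fun t ht => by rw [projIcc_of_mem _ ht]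
  have hζ : ∀ t ∈ Icc (0:ℝ) 1, (⟨(β (projIcc (0:ℝ) 1 zero_le_one t)).1,
      (β (projIcc (0:ℝ) 1 zero_le_one t)).2⟩ : ℂ) = ⟨(β t).1, (β t).2⟩ := fun t ht => by
    rw [hclamp t ht]
  have hq : ∀ t ∈ Icc (0:ℝ) 1, (β t).1 * (β t).2 = quadProd ⟨(β t).1, (β t).2⟩ := fun t ht =>
    (quadProd_of_nonneg (z := ⟨(β t).1, (β t).2⟩) (hnn t ht).1 (hnn t ht).2).symm
  have hcont : Continuous fun t => β (projIcc (0:ℝ) 1 zero_le_one t) :=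
    hC1.continuousOn.comp_continuous (continuous_subtype_val.comp continuous_projIcc)
      fun t => (projIcc (0:ℝ) 1 zero_le_one t).2
  refine ⟨fun t => ⟨(β (projIcc (0:ℝ) 1 zero_le_one t)).1, (β (projIcc (0:ℝ) 1 zero_le_one t)).2⟩,
    fun t => ⟨x' t, y' t⟩, Lg β, k, ?_, ?_, ?_, fun t ht => ?_, fun t ht => ?_, fun t ht => ?_,
    hL, hsp, hk, fun t ht => ?_⟩
  · exact Complex.equivRealProdCLM.symm.continuous.comp hcont
  · dsimp only
    rw [hζ 0 m0, h0]
  · dsimp only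
    rw [hζ 1 m1, ← hq 1 m1]
    rcases h1b.2 with h | h <;> simp [h]
  · dsimp only
    rw [hζ t ht, hq t ht]
  · have ht' := Ico_subset_Icc_self ht
    have h := (Complex.equivRealProdCLM.symm.hasFDerivAt (x := β t)).comp_hasDerivWithinAt t
      ((hd1 t ht').prodMk (hd2 t ht'))
    refine (h.congr (fun s hs => ?_) ?_).mono_of_mem_nhdsWithin (Icc_mem_nhdsGE_of_mem ht)
    · exact hζ s hs
    · exact hζ t ht'
  · have := hsq t (Ico_subset_Icc_self ht)
    rw [Complex.norm_def, Complex.normSq_mk, ← sq, ← sq, this, Real.sqrt_sq hL.le]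
  · dsimp only
    rw [hζ t ht, ← hq t ht]
    exact hlow t ht

end Admissible

section Maximizer

lemma gSpeed_of_hasDerivAt {α d : ℝ → ℂ} (hα : ∀ t, HasDerivAt α (d t) t) :
    ∀ t ∈ Icc (0:ℝ) 1,
      derivWithin (fun u => (α u).re) (Icc 0 1) t = (d t).re ∧
      derivWithin (fun u => (α u).im) (Icc 0 1) t = (d t).im ∧
      gSpeed (fun t => ((α t).re, (α t).im)) t = ‖d t‖ := by
  intro t ht
  have hu := uniqueDiffOn_Icc (zero_lt_one (α := ℝ)) t ht
  have h1 : derivWithin (fun u => (α u).re) (Icc 0 1) t = (d t).re :=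
    (Complex.reCLM.hasFDerivAt.comp_hasDerivAt t (hα t)).hasDerivWithinAt.derivWithin hu
  have h2 : derivWithin (fun u => (α u).im) (Icc 0 1) t = (d t).im :=
    (Complex.imCLM.hasFDerivAt.comp_hasDerivAt t (hα t)).hasDerivWithinAt.derivWithin hu
  refine ⟨h1, h2, ?_⟩
  simp only [gSpeed, gSpeedOn]
  rw [h1, h2, Complex.norm_def, Complex.normSq_apply, ← sq, ← sq]

/-- A `C¹` curve of constant speed staying in the open quadrant and hitting the real axis
vertically is admissible. -/
lemma memC_of_hasDerivAt {α d : ℝ → ℂ} {L x y : ℝ} (h0 : α 0 = ⟨x, y⟩) (hd : Continuous d)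
    (hα : ∀ t, HasDerivAt α (d t) t) (hL : ∀ t ∈ Icc (0:ℝ) 1, ‖d t‖ = L)
    (hpos : ∀ t ∈ Ico (0:ℝ) 1, 0 < (α t).re ∧ 0 < (α t).im) (h1 : 0 < (α 1).re)
    (h1' : (α 1).im = 0) (hd1 : (d 1).re = 0) :
    MemC x y fun t => ((α t).re, (α t).im) := by
  have hs : ∀ t ∈ Icc (0:ℝ) 1, gSpeed (fun t => ((α t).re, (α t).im)) t = L := fun t ht => by
    rw [(gSpeed_of_hasDerivAt hα t ht).2.2, hL t ht]
  have hLg : Lg (fun t => ((α t).re, (α t).im)) = L := by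
    rw [Lg, intervalIntegral.integral_congr (g := fun _ => L) (by rwa [uIcc_of_le zero_le_one])]
    simp
  have hcd : ContDiff ℝ 1 α := by
    refine contDiff_one_iff_deriv.2 ⟨fun t => (hα t).differentiableAt, ?_⟩
    rwa [show deriv α = d from funext fun t => (hα t).deriv]
  refine ⟨(Complex.equivRealProdCLM.contDiff.comp hcd).contDiffOn, by simp [h0],
    fun t ht => hpos t ht, ⟨⟨h1.le, h1'.ge⟩, Or.inr h1'⟩, fun h => h1.ne' (congrArg Prod.fst h),
    fun t ht => by rw [hs t ht, hLg], fun h => absurd h h1.ne', fun _ => ?_⟩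
  exact (gSpeed_of_hasDerivAt hα 1 ⟨zero_le_one, le_rfl⟩).1.trans hd1

/-- At the critical level there is an admissible simple curve along which the weighted
Hardy inequality holds. -/
lemma exists_optimal_curve {n : ℕ} {cn p c x y : ℝ} (hcn : 0 < cn) (hN : 1 ≤ n - 1)
    (hp : 2 * ((n - 1 : ℕ) : ℝ) + 1 ≤ p) (hy : 0 < y) (hxy : y < x) (hc : 0 < c)
    (hnot : ¬Reaches (n - 1) p c ⟨x, y⟩)
    (hlt : ∀ c', 0 < c' → c' < c → Reaches (n - 1) p c' ⟨x, y⟩) :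
    ∃ α : ℝ → ℝ × ℝ, MemC x y α ∧ InjOn α (Icc 0 1) ∧ c * (p - 1) ≤ lambdaG n cn p α := by
  have hp1 : 1 < p := by linarith [three_le_of_exponent hN hp]
  obtain ⟨γ, hγ, hbase, hre, hup⟩ := exists_isExtremal hN hp hy hxy hc hnot hlt
  have hγ0 : γ 0 = ⟨x, y⟩ := hbase 0 le_rfl
  have hcr := hγ.isCritical hN hp hc (by rwa [hγ0]) (fun μ hμ => by rw [hbase μ hμ, hγ0])
    (Real.sqrt_pos.2 (show 0 < x ^ 2 - y ^ 2 by nlinarith)) hre hup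
  obtain ⟨K, hK⟩ := hcr.exists_hasDecay hN hp hc
  obtain ⟨A, hA, hunif⟩ := hγ.exists_uniform hN hp hc.le hK
  have hus : ∀ s, 0 ≤ s → UniformSpeed γ s (speed (n - 1) p c γ s) (A / (1 + s)) := by
    intro s hs h s₁ s₂ hh h₁ h₂ h₃
    rw [div_mul_eq_mul_div, div_le_one (by linarith)] at hh
    have := hunif s h s₁ s₂ hs hh h₁ h₂ h₃
    rwa [← mul_div_assoc, ← div_mul_eq_mul_div] at this
  obtain ⟨E, hE, hEn, hEi, hch⟩ := exists_velocity hγ.cont (hγ.continuous_speed hN hp hc.le)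
    (fun s hs => hγ.speed_pos hc.le hs) (by linarith) hus
  have hvel : IsVelocity (n - 1) p c _ _ γ E := ⟨hcr, hE, hEn, hEi⟩
  have hdir := hvel.tendsto_direction hp1 hc hK (by linarith) hus hch
  obtain ⟨L, G, α, d, hL, hG0, hGm, hGd, hαG, hd, hα, hdL, hd1, h1im, h1re⟩ :=
    hvel.exists_curve hp1 hc hK hdir
  have h1 : 0 < (α 1).re := hcr.X₀_pos.trans_le h1re
  have hGnn : ∀ t ∈ Ico (0:ℝ) 1, 0 ≤ G t := fun t ht => by
    rw [← hG0]; exact hGm.monotoneOn ⟨le_rfl, zero_lt_one⟩ ht ht.1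
  have hpos : ∀ t ∈ Ico (0:ℝ) 1, 0 < (α t).re ∧ 0 < (α t).im := fun t ht => by
    rw [hαG t ht]
    have := hγ.im_pos (hGnn t ht)
    exact ⟨this.trans_le (hγ.im_le_re _), this⟩
  have hα0 : α 0 = ⟨x, y⟩ := by rw [hαG 0 ⟨le_rfl, zero_lt_one⟩, hG0, hγ0]
  have hαc : Continuous α := continuous_iff_continuousAt.2 fun t => (hα t).continuousAt
  have hVc : Continuous fun t => quadProd (α t) := continuous_quadProd.comp hαc
  have hVpos : ∀ t ∈ Ico (0:ℝ) 1, 0 < quadProd (α t) := fun t ht => by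
    rw [hαG t ht]; exact hγ.prod_pos _ (hGnn t ht)
  refine ⟨fun t => ((α t).re, (α t).im), memC_of_hasDerivAt hα0 hd hα hdL hpos h1 h1im hd1, ?_, ?_⟩
  · intro s hs t ht hst
    have hst' : α s = α t := Complex.ext (congrArg Prod.fst hst) (congrArg Prod.snd hst)
    rcases hs.2.lt_or_eq with h | h <;> rcases ht.2.lt_or_eq with h' | h'
    · rw [hαG s ⟨hs.1, h⟩, hαG t ⟨ht.1, h'⟩] at hst'
      exact hGm.injOn ⟨hs.1, h⟩ ⟨ht.1, h'⟩ (hγ.injOn hN hp hc.le (hGnn s ⟨hs.1, h⟩)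
        (hGnn t ⟨ht.1, h'⟩) hst')
    · have := (hpos s ⟨hs.1, h⟩).2
      rw [hst', h', h1im] at this
      exact absurd this (lt_irrefl _)
    · have := (hpos t ⟨ht.1, h'⟩).2
      rw [← hst', h, h1im] at this
      exact absurd this (lt_irrefl _)
    · rw [h, h']
  · refine le_lambdaG (L := L) (V := fun t => quadProd (α t)) hcn hp1 hL (fun t ht => ?_)
      hVc.continuousOn hVpos (fun t ht => ?_) fun w K hw hw0 hnum hden =>
        picone hN hp hc.le hL hVpos hVc.continuousOn hG0 (fun t ht => ?_) (fun t ht => ?_)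
          hw hw0 hnum hden
    · refine (quadProd_of_nonneg ?_ ?_).symm <;> rcases ht.2.lt_or_eq with h | h
      · exact (hpos t ⟨ht.1, h⟩).1.le
      · rw [h]; exact h1.le
      · exact (hpos t ⟨ht.1, h⟩).2.le
      · rw [h]; exact h1im.ge
    · rw [(gSpeed_of_hasDerivAt hα t ht).2.2, hdL t ht]
    · rw [← hG0]
      exact hGm ⟨le_rfl, zero_lt_one⟩ (Ioo_subset_Ico_self ht) ht.1
    · rw [hαG t ht]
      exact hGd t ht

end Maximizer

/-- For `n ≥ 2`, `p ≥ 2n-1` and `x₀ ≠ y₀`, there is a simple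
curve `α ∈ 𝒞` maximizing `λ_{1,p}` over `𝒞`. -/
theorem simons_stmt0 (n : ℕ) (hn : 2 ≤ n) (cn : ℝ) (hcn : 0 < cn)
    (p : ℝ) (hp : 2 * (n : ℝ) - 1 ≤ p)
    (x0 y0 : ℝ) (hy0 : 0 < y0) (hxy : y0 ≤ x0) (hne : x0 ≠ y0) :
    ∃ α : ℝ → ℝ × ℝ, MemC x0 y0 α ∧ InjOn α (Icc 0 1) ∧
      ∀ β : ℝ → ℝ × ℝ, MemC x0 y0 β → lambdaG n cn p β ≤ lambdaG n cn p α := by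
  have hN : 1 ≤ n - 1 := Nat.le_sub_of_add_le hn
  have hp' : 2 * ((n - 1 : ℕ) : ℝ) + 1 ≤ p := by
    rw [Nat.cast_sub (by omega), Nat.cast_one]
    linarith
  have hlt : y0 < x0 := hxy.lt_of_ne' hne
  obtain ⟨c, hc, hnot, hreach⟩ := exists_critical hN hp' hy0 hlt
  obtain ⟨α, hα, hinj, hle⟩ := exists_optimal_curve hcn hN hp' hy0 hlt hc hnot hreach
  refine ⟨α, hα, hinj, fun β hβ => le_trans ?_ hle⟩
  obtain ⟨ζ, ζ', L, k, hζ, hζ0, hζ1, hV, hζ', hs, hL, hsp, hk, hlow⟩ :=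
    hβ.exists_complex_curve (hy0.trans hlt) hy0
  obtain ⟨κ, -, H⟩ := exists_quotient_le hN hp' hc hL hζ hζ' hs hζ1 hk hlow (by rwa [hζ0])
  have hp1 : 1 < p := by linarith [three_le_of_exponent hN hp']
  exact lambdaG_le hcn hp1 hL hV (fun t => quadProd_nonneg _) hsp H
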